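/- For every θ > 0 there exist c'' = c''(θ) > 0 and K = K(θ) ≥ 1 such that for all ρ ∈ (θ, 1/θ), all integers n ≥ K, and every axis-parallel rectangle R' ⊆ R(ρ) of area at least θ, the annealed crossing probability satisfies c'' < P_{R(ρ)}(H_{R'}) < 1 − c''. -/

import Mathlib

open MeasureTheory Set
open scoped Classical ENNReal

namespace VoronoiTest

/-- Squared Euclidean distance between two points of the plane. -/
def sqDist (p q : ℝ × ℝ) : ℝ := (p.1 - q.1) ^ 2 + (p.2 - q.2) ^ 2

/-- The closed axis-parallel rectangle `[x₁, x₂] × [y₁, y₂]`. -/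
def rect (x₁ x₂ y₁ y₂ : ℝ) : Set (ℝ × ℝ) := Icc x₁ x₂ ×ˢ Icc y₁ y₂

/-- The Voronoi cell (inside the region `R`) of the `i`-th point of the configuration `η`:
all points of `R` that are (Euclidean-)closer to `η i` than to any other point of `η`. -/
def cell {n : ℕ} (R : Set (ℝ × ℝ)) (η : Fin n → ℝ × ℝ) (i : Fin n) : Set (ℝ × ℝ) :=
  {p ∈ R | ∀ j : Fin n, sqDist p (η i) ≤ sqDist p (η j)}

/-- The union of the red Voronoi cells, for the colouring `c` (`true` = red). -/
def redSet {n : ℕ} (R : Set (ℝ × ℝ)) (η : Fin n → ℝ × ℝ) (c : Fin n → Bool) : Set (ℝ × ℝ) :=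
  ⋃ i ∈ {i : Fin n | c i = true}, cell R η i

/-- The event `H_{R'}` that the rectangle `R' = [x₁,x₂] × [y₁,y₂]` is crossed horizontally
by a continuous path contained in the union of the red Voronoi cells. -/
def Crossing {n : ℕ} (R : Set (ℝ × ℝ)) (x₁ x₂ y₁ y₂ : ℝ)
    (η : Fin n → ℝ × ℝ) (c : Fin n → Bool) : Prop :=
  ∃ γ : ℝ → ℝ × ℝ, ContinuousOn γ (Icc 0 1) ∧
    (∀ t ∈ Icc (0 : ℝ) 1, γ t ∈ redSet R η c ∩ rect x₁ x₂ y₁ y₂) ∧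
    (γ 0).1 = x₁ ∧ (γ 1).1 = x₂

/-- The conditional probability `P(H_{R'} | η)` of a red horizontal crossing of
`R' = [x₁,x₂] × [y₁,y₂]`, given the point configuration `η`: the proportion of the `2 ^ n`
(uniformly likely) colourings that produce a red crossing. -/
noncomputable def condProb {n : ℕ} (R : Set (ℝ × ℝ)) (x₁ x₂ y₁ y₂ : ℝ)
    (η : Fin n → ℝ × ℝ) : ℝ :=
  (Finset.univ.filter fun c : Fin n → Bool => Crossing R x₁ x₂ y₁ y₂ η c).card / 2 ^ n

/-- The conditional influence `Inf_j(H_{R'} | η)` of the `j`-th point: the probability, over a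
uniform random colouring, that flipping the colour of the `j`-th point changes the occurrence
of the crossing event. -/
noncomputable def influence {n : ℕ} (R : Set (ℝ × ℝ)) (x₁ x₂ y₁ y₂ : ℝ)
    (η : Fin n → ℝ × ℝ) (j : Fin n) : ℝ :=
  (Finset.univ.filter fun c : Fin n → Bool =>
      Crossing R x₁ x₂ y₁ y₂ η c ≠
        Crossing R x₁ x₂ y₁ y₂ η (Function.update c j (!c j))).card / 2 ^ n

/-- The uniform probability measure on the region `R ⊆ ℝ²`. -/
noncomputable def unif (R : Set (ℝ × ℝ)) : Measure (ℝ × ℝ) :=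
  (volume R)⁻¹ • volume.restrict R

/-- The law of the point configuration `η` in the binomial model `P_R`:
`n` points placed independently and uniformly at random in `R`. -/
noncomputable def pts (R : Set (ℝ × ℝ)) (n : ℕ) : Measure (Fin n → ℝ × ℝ) :=
  Measure.pi fun _ => unif R

/-- The annealed probability `P_R(H_{R'})` of a red horizontal crossing of
`R' = [x₁,x₂] × [y₁,y₂]` in the binomial model on `R` with `n` points: the average of
`P(H_{R'} | η)` over the point configuration. -/
noncomputable def annealed (R : Set (ℝ × ℝ)) (x₁ x₂ y₁ y₂ : ℝ) (n : ℕ) : ℝ :=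
  ∫ η, condProb R x₁ x₂ y₁ y₂ η ∂(pts R n)

/-- The rectangle `R(ρ, s)` of aspect ratio `ρ` and area `s`, centred at the origin,
given as the 4-tuple `(x₁, x₂, y₁, y₂)` of coordinates of its sides. -/
noncomputable def Rco (ρ s : ℝ) : ℝ × ℝ × ℝ × ℝ :=
  (-(Real.sqrt (ρ * s)) / 2, Real.sqrt (ρ * s) / 2,
    -(Real.sqrt (s / ρ)) / 2, Real.sqrt (s / ρ) / 2)

/-- The rectangle `R(ρ, s)` of aspect ratio `ρ` and area `s`, centred at the origin. -/
noncomputable def Rrect (ρ s : ℝ) : Set (ℝ × ℝ) :=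
  rect (Rco ρ s).1 (Rco ρ s).2.1 (Rco ρ s).2.2.1 (Rco ρ s).2.2.2

/-- The unit square `S = [-1/2, 1/2]²`. -/
def unitSq : Set (ℝ × ℝ) := rect (-(1/2)) (1/2) (-(1/2)) (1/2)

open scoped NNReal

set_option linter.unusedSectionVars false

/-- A continuous angle whose sine stays nonnegative cannot leave `[0, π]`. -/
lemma angle_trap {θ : ℝ → ℝ} (hθ : Continuous θ) (hs : ∀ t ∈ Icc (0 : ℝ) 1, 0 ≤ Real.sin (θ t))
    (k : ℝ) (hk : ∀ x, Real.sin (x + k) = Real.sin x) {t₀ t₁ : ℝ} (h0 : t₀ ∈ Icc (0 : ℝ) 1)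
    (h1 : t₁ ∈ Icc (0 : ℝ) 1)
    (ha : -Real.pi < θ t₀ + k) (hb : θ t₀ + k < 2 * Real.pi) :
    0 ≤ θ t₁ + k ∧ θ t₁ + k ≤ Real.pi := by
  have hpi := Real.pi_pos
  have key : ∀ x, -Real.pi < x → x < 2 * Real.pi → 0 ≤ Real.sin x → 0 ≤ x ∧ x ≤ Real.pi := by
    intro x hx1 hx2 hx
    constructor
    · by_contra! h
      exact absurd hx (not_le.mpr (Real.sin_neg_of_neg_of_neg_pi_lt h hx1))
    · by_contra! h
      have : Real.sin (x - 2 * Real.pi) < 0 :=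
        Real.sin_neg_of_neg_of_neg_pi_lt (by linarith) (by linarith)
      rw [Real.sin_sub_two_pi] at this
      linarith
  have hs' : ∀ t ∈ Icc (0 : ℝ) 1, 0 ≤ Real.sin (θ t + k) := fun t ht => by rw [hk]; exact hs t ht
  have hpre : IsPreconnected ((fun t => θ t + k) '' Icc (0 : ℝ) 1) :=
    isPreconnected_Icc.image _ (by fun_prop)
  have hoc := hpre.ordConnected
  have hm0 : θ t₀ + k ∈ (fun t => θ t + k) '' Icc (0 : ℝ) 1 := ⟨t₀, h0, rfl⟩
  have hm1 : θ t₁ + k ∈ (fun t => θ t + k) '' Icc (0 : ℝ) 1 := ⟨t₁, h1, rfl⟩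
  have h00 := key _ ha hb (hs' _ h0)
  by_cases hlo : -Real.pi < θ t₁ + k
  · by_cases hhi : θ t₁ + k < 2 * Real.pi
    · exact key _ hlo hhi (hs' _ h1)
    · exfalso
      have : (3 * Real.pi / 2) ∈ (fun t => θ t + k) '' Icc (0 : ℝ) 1 :=
        hoc.out hm0 hm1 ⟨by linarith, by linarith⟩
      obtain ⟨t, ht, hte⟩ := this
      have := key _ (by simp only [] at hte; linarith) (by simp only [] at hte; linarith) (hs' _ ht)
      simp only [] at hte
      linarith
  · exfalso
    have : (-Real.pi / 2) ∈ (fun t => θ t + k) '' Icc (0 : ℝ) 1 :=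
      hoc.out hm1 hm0 ⟨by linarith, by linarith⟩
    obtain ⟨t, ht, hte⟩ := this
    have := key _ (by simp only [] at hte; linarith) (by simp only [] at hte; linarith) (hs' _ ht)
    simp only [] at hte
    linarith

/-- The Poincaré–Miranda theorem in dimension two. -/
theorem poincare_miranda {f g : ℝ × ℝ → ℝ} (hf : Continuous f) (hg : Continuous g)
    (hl : ∀ t ∈ Icc (0 : ℝ) 1, f (0, t) ≤ 0) (hr : ∀ t ∈ Icc (0 : ℝ) 1, 0 ≤ f (1, t))
    (hb : ∀ s ∈ Icc (0 : ℝ) 1, g (s, 0) ≤ 0) (ht : ∀ s ∈ Icc (0 : ℝ) 1, 0 ≤ g (s, 1)) :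
    ∃ s ∈ Icc (0 : ℝ) 1, ∃ t ∈ Icc (0 : ℝ) 1, f (s, t) = 0 ∧ g (s, t) = 0 := by
  by_contra! hne
  let cl : ℝ → ℝ := fun x => (projIcc (0 : ℝ) 1 zero_le_one x : ℝ)
  have hcl : Continuous cl := continuous_subtype_val.comp continuous_projIcc
  have hclm : ∀ x, cl x ∈ Icc (0 : ℝ) 1 := fun x => (projIcc (0 : ℝ) 1 zero_le_one x).2
  have hcle : ∀ x ∈ Icc (0 : ℝ) 1, cl x = x := fun x hx => by
    simp only [cl, projIcc_of_mem zero_le_one hx]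
  let F : ℝ × ℝ → ℂ := fun p => ⟨f (cl p.1, cl p.2), g (cl p.1, cl p.2)⟩
  have hFc : Continuous F := by
    have : F = fun p => (f (cl p.1, cl p.2) : ℂ) + (g (cl p.1, cl p.2) : ℂ) * Complex.I := by
      funext p
      apply Complex.ext <;> simp [F]
    rw [this]
    fun_prop
  have hF0 : ∀ p, F p ≠ 0 := by
    intro p hp
    have h1 := congrArg Complex.re hp
    have h2 := congrArg Complex.im hp
    exact hne _ (hclm p.1) _ (hclm p.2) h1 h2
  let F' : C(ℝ × ℝ, {z : ℂ // z ≠ 0}) := ⟨fun p => ⟨F p, hF0 p⟩, hFc.subtype_mk _⟩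
  have : LocallyPathConnectedSpace (ℝ × ℝ) := inferInstance
  obtain ⟨L, ⟨-, hL⟩, -⟩ := Complex.isCoveringMap_exp.existsUnique_continuousMap_lifts F' (0, 0)
    (Complex.log (F (0, 0))) (by
      apply Subtype.ext
      simp [F', Complex.exp_log (hF0 (0, 0))])
  have hexp : ∀ p, Complex.exp (L p) = F p := fun p => by
    have := congrArg Subtype.val (congrFun hL p)
    simpa [F'] using this
  let θ : ℝ × ℝ → ℝ := fun p => (L p).im
  have hθ : Continuous θ := Complex.continuous_im.comp L.continuous
  have hcos : ∀ p, f (cl p.1, cl p.2) = Real.exp (L p).re * Real.cos (θ p) := fun p => by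
    have := congrArg Complex.re (hexp p)
    rw [Complex.exp_re] at this
    exact this.symm
  have hsin : ∀ p, g (cl p.1, cl p.2) = Real.exp (L p).re * Real.sin (θ p) := fun p => by
    have := congrArg Complex.im (hexp p)
    rw [Complex.exp_im] at this
    exact this.symm
  have e0 : cl 0 = 0 := hcle 0 (by simp)
  have e1 : cl 1 = 1 := hcle 1 (by simp)
  have pos : ∀ {a b : ℝ}, 0 ≤ Real.exp a * b → 0 ≤ b := fun {a b} h =>
    nonneg_of_mul_nonneg_right h (Real.exp_pos a)
  have sB : ∀ t ∈ Icc (0 : ℝ) 1, Real.sin (θ (t, 0)) ≤ 0 := fun t htt => by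
    have h := hsin (t, 0)
    simp only [hcle t htt, e0] at h
    have h2 := hb t htt
    have : 0 ≤ -Real.sin (θ (t, 0)) := pos (a := (L (t, 0)).re) (by linarith)
    linarith
  have sT : ∀ t ∈ Icc (0 : ℝ) 1, 0 ≤ Real.sin (θ (t, 1)) := fun t htt => by
    have h := hsin (t, 1)
    simp only [hcle t htt, e1] at h
    have h2 := ht t htt
    exact pos (a := (L (t, 1)).re) (by linarith)
  have sL : ∀ t ∈ Icc (0 : ℝ) 1, Real.cos (θ (0, t)) ≤ 0 := fun t htt => by
    have h := hcos (0, t)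
    simp only [hcle t htt, e0] at h
    have h2 := hl t htt
    have : 0 ≤ -Real.cos (θ (0, t)) := pos (a := (L (0, t)).re) (by linarith)
    linarith
  have sR : ∀ t ∈ Icc (0 : ℝ) 1, 0 ≤ Real.cos (θ (1, t)) := fun t htt => by
    have h := hcos (1, t)
    simp only [hcle t htt, e1] at h
    have h2 := hr t htt
    exact pos (a := (L (1, t)).re) (by linarith)
  have hpi := Real.pi_pos
  obtain ⟨m, hm⟩ : ∃ m : ℤ, 0 ≤ θ (0, 0) + m * (2 * Real.pi) ∧
      θ (0, 0) + m * (2 * Real.pi) < 2 * Real.pi := by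
    obtain ⟨m, hm, -⟩ := existsUnique_add_zsmul_mem_Ico (a := 2 * Real.pi) (by linarith)
      (θ (0, 0)) 0
    refine ⟨m, ?_, ?_⟩
    · simpa using hm.1
    · simpa using hm.2
  have z0 : (0 : ℝ) ∈ Icc (0 : ℝ) 1 := by simp
  have z1 : (1 : ℝ) ∈ Icc (0 : ℝ) 1 := by simp
  -- the angle at the corner lies in `[π, 3π/2]`
  set κ : ℝ := m * (2 * Real.pi) with hκ
  have psin : ∀ x, Real.sin (x + κ) = Real.sin x := fun x => Real.sin_add_int_mul_two_pi x m
  have pcos : ∀ x, Real.cos (x + κ) = Real.cos x := fun x => Real.cos_add_int_mul_two_pi x m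
  -- side by side
  have A : ∀ t ∈ Icc (0 : ℝ) 1, ∀ t' ∈ Icc (0 : ℝ) 1, 0 < θ (t, 0) + κ →
      θ (t, 0) + κ < 3 * Real.pi →
      Real.pi ≤ θ (t', 0) + κ ∧ θ (t', 0) + κ ≤ 2 * Real.pi := by
    intro t h1 t' h2 h3 h4
    have := angle_trap (θ := fun t => θ (t, 0) + Real.pi) (by fun_prop)
      (fun t htt => by rw [Real.sin_add_pi]; linarith [sB t htt]) (κ - 2 * Real.pi)
      (fun x => by rw [← add_sub_assoc, Real.sin_sub_two_pi, psin]) h1 h2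
      (by linarith) (by linarith)
    constructor <;> linarith [this.1, this.2]
  have B : ∀ t ∈ Icc (0 : ℝ) 1, ∀ t' ∈ Icc (0 : ℝ) 1, Real.pi / 2 < θ (1, t) + κ →
      θ (1, t) + κ < 7 * Real.pi / 2 →
      3 * Real.pi / 2 ≤ θ (1, t') + κ ∧ θ (1, t') + κ ≤ 5 * Real.pi / 2 := by
    intro t h1 t' h2 h3 h4
    have := angle_trap (θ := fun t => θ (1, t) + Real.pi / 2) (by fun_prop)
      (fun t htt => by rw [Real.sin_add_pi_div_two]; exact sR t htt) (κ - 2 * Real.pi)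
      (fun x => by rw [← add_sub_assoc, Real.sin_sub_two_pi, psin]) h1 h2
      (by linarith) (by linarith)
    constructor <;> linarith [this.1, this.2]
  have C : ∀ t ∈ Icc (0 : ℝ) 1, ∀ t' ∈ Icc (0 : ℝ) 1, Real.pi < θ (t, 1) + κ →
      θ (t, 1) + κ < 4 * Real.pi →
      2 * Real.pi ≤ θ (t', 1) + κ ∧ θ (t', 1) + κ ≤ 3 * Real.pi := by
    intro t h1 t' h2 h3 h4
    have := angle_trap (θ := fun t => θ (t, 1)) (by fun_prop)
      (fun t htt => sT t htt) (κ - 2 * Real.pi)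
      (fun x => by rw [← add_sub_assoc, Real.sin_sub_two_pi, psin]) h1 h2
      (by linarith) (by linarith)
    constructor <;> linarith [this.1, this.2]
  have D : ∀ t ∈ Icc (0 : ℝ) 1, ∀ t' ∈ Icc (0 : ℝ) 1, 3 * Real.pi / 2 < θ (0, t) + κ →
      θ (0, t) + κ < 9 * Real.pi / 2 →
      5 * Real.pi / 2 ≤ θ (0, t') + κ ∧ θ (0, t') + κ ≤ 7 * Real.pi / 2 := by
    intro t h1 t' h2 h3 h4
    have := angle_trap (θ := fun t => θ (0, t) - Real.pi / 2) (by fun_prop)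
      (fun t htt => by rw [Real.sin_sub_pi_div_two]; linarith [sL t htt]) (κ - 2 * Real.pi)
      (fun x => by rw [← add_sub_assoc, Real.sin_sub_two_pi, psin]) h1 h2
      (by linarith) (by linarith)
    constructor <;> linarith [this.1, this.2]
  have c0 : 0 < θ (0, 0) + κ := by
    rcases hm.1.lt_or_eq with h | h
    · exact h
    · exfalso
      have := sL 0 z0
      rw [← pcos, ← h, Real.cos_zero] at this
      linarith
  have a1 := A 0 z0 1 z1 c0 (by linarith [hm.2])
  have b1 := B 0 z0 1 z1 (by linarith) (by linarith)
  have d1 := C 1 z1 0 z0 (by linarith) (by linarith)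
  have f1 := D 1 z1 0 z0 (by linarith) (by linarith)
  linarith [hm.2]

/-- A left-right path and a bottom-top path cross. -/
lemma joinedIn_cross {F G : Set (ℝ × ℝ)} {p q a b : ℝ × ℝ} (hF : JoinedIn F p q)
    (hG : JoinedIn G a b) (hx : ∀ z ∈ G, p.1 ≤ z.1 ∧ z.1 ≤ q.1)
    (hy : ∀ z ∈ F, a.2 ≤ z.2 ∧ z.2 ≤ b.2) : (F ∩ G).Nonempty := by
  obtain ⟨h, hh⟩ := hF
  obtain ⟨v, hv⟩ := hG
  have mF : ∀ s ∈ Icc (0 : ℝ) 1, h.extend s ∈ F := fun s hs => by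
    rw [h.extend_apply hs]; exact hh _
  have mG : ∀ s ∈ Icc (0 : ℝ) 1, v.extend s ∈ G := fun s hs => by
    rw [v.extend_apply hs]; exact hv _
  have ch := h.continuous_extend
  have cv := v.continuous_extend
  obtain ⟨s, hs, t, ht, h1, h2⟩ := poincare_miranda
    (f := fun z => (h.extend z.1).1 - (v.extend z.2).1)
    (g := fun z => (v.extend z.2).2 - (h.extend z.1).2)
    (by fun_prop) (by fun_prop)
    (fun t ht => by simpa using (hx _ (mG t ht)).1)
    (fun t ht => by simpa using (hx _ (mG t ht)).2)
    (fun t ht => by simpa using (hy _ (mF t ht)).1)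
    (fun t ht => by simpa using (hy _ (mF t ht)).2)
  refine ⟨h.extend s, mF s hs, ?_⟩
  have : h.extend s = v.extend t := Prod.ext (by simp only [] at h1; linarith)
    (by simp only [] at h2; linarith)
  rw [this]
  exact mG t ht

lemma joinedIn_rect {x₁ x₂ y₁ y₂ : ℝ} {p q : ℝ × ℝ} (hp : p ∈ rect x₁ x₂ y₁ y₂)
    (hq : q ∈ rect x₁ x₂ y₁ y₂) : JoinedIn (rect x₁ x₂ y₁ y₂) p q :=
  JoinedIn.of_segment_subset
    (((convex_Icc x₁ x₂).prod (convex_Icc y₁ y₂)).segment_subset hp hq)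

lemma mem_rect {x₁ x₂ y₁ y₂ : ℝ} {p : ℝ × ℝ} :
    p ∈ rect x₁ x₂ y₁ y₂ ↔ (x₁ ≤ p.1 ∧ p.1 ≤ x₂) ∧ y₁ ≤ p.2 ∧ p.2 ≤ y₂ := Iff.rfl

/-- A path from the left side of a rectangle to its right side meets every path from below its
starting point to above it. -/
lemma joinedIn_trap {F G : Set (ℝ × ℝ)} {x₀ x₁ y₀ y₁ : ℝ} {p q a b : ℝ × ℝ}
    (hFD : F ⊆ rect x₀ x₁ y₀ y₁) (hGD : G ⊆ rect x₀ x₁ y₀ y₁) (hF : JoinedIn F p q)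
    (hG : JoinedIn G a b) (hp : p.1 = x₀) (hq : q.1 = x₁)
    (ha : a.2 = y₀ ∨ (a.1 = x₀ ∧ a.2 ≤ p.2)) (hb : b.2 = y₁ ∨ (b.1 = x₀ ∧ p.2 ≤ b.2)) :
    (F ∩ G).Nonempty := by
  have pF := hF.source_mem
  have qF := hF.target_mem
  have aG := hG.source_mem
  have bG := hG.target_mem
  have pD := mem_rect.1 (hFD pF)
  have qD := mem_rect.1 (hFD qF)
  have aD := mem_rect.1 (hGD aG)
  have bD := mem_rect.1 (hGD bG)
  by_contra hne
  have disj : ∀ z, z ∈ F → z ∈ G → False := fun z h1 h2 => hne ⟨z, h1, h2⟩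
  -- extension of the horizontal path
  let E := rect (x₀ - 1) x₀ p.2 p.2
  have hE : JoinedIn (E ∪ F) (x₀ - 1, p.2) q := by
    refine JoinedIn.trans ((joinedIn_rect (x₁ := x₀ - 1) (x₂ := x₀) (y₁ := p.2) (y₂ := p.2)
      (q := p) ?_ ?_).mono subset_union_left) (hF.mono subset_union_right)
    · simp [mem_rect]
    · simp [mem_rect, hp]
  obtain ⟨A, hA, hA1⟩ : ∃ A : Set (ℝ × ℝ), JoinedIn A (x₀ - 1, y₀ - 1) a ∧ ∀ z ∈ A,
      (x₀ - 1 ≤ z.1 ∧ z.1 ≤ x₁ ∧ y₀ - 1 ≤ z.2 ∧ z.2 ≤ y₁) ∧ (z ∈ rect x₀ x₁ y₀ y₁ → z = a) ∧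
        (z ∈ E → a = p) := by
    rcases ha with ha | ha
    · refine ⟨rect (x₀ - 1) a.1 (y₀ - 1) (y₀ - 1) ∪ rect a.1 a.1 (y₀ - 1) y₀, ?_, ?_⟩
      · refine JoinedIn.trans (y := (a.1, y₀ - 1)) ((joinedIn_rect ?_ ?_).mono subset_union_left)
          ((joinedIn_rect ?_ ?_).mono subset_union_right) <;> simp [mem_rect, ha] <;> linarith
      · intro z hz
        rcases hz with hz | hz <;> rw [mem_rect] at hz
        · refine ⟨⟨?_, ?_, ?_, ?_⟩, fun h => ?_, fun h => ?_⟩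
          any_goals linarith
          · rw [mem_rect] at h; exfalso; linarith
          · rw [mem_rect] at h; exfalso; linarith
        · refine ⟨⟨?_, ?_, ?_, ?_⟩, fun h => ?_, fun h => ?_⟩
          any_goals linarith
          · rw [mem_rect] at h; exact Prod.ext (by linarith) (by linarith)
          · rw [mem_rect] at h; exact Prod.ext (by linarith) (by linarith)
    · refine ⟨rect (x₀ - 1) (x₀ - 1) (y₀ - 1) a.2 ∪ rect (x₀ - 1) x₀ a.2 a.2, ?_, ?_⟩
      · refine JoinedIn.trans (y := (x₀ - 1, a.2)) ((joinedIn_rect ?_ ?_).mono subset_union_left)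
          ((joinedIn_rect ?_ ?_).mono subset_union_right) <;> simp [mem_rect, ha] <;> linarith
      · intro z hz
        rcases hz with hz | hz <;> rw [mem_rect] at hz
        · refine ⟨⟨?_, ?_, ?_, ?_⟩, fun h => ?_, fun h => ?_⟩
          any_goals linarith
          · rw [mem_rect] at h; exfalso; linarith
          · rw [mem_rect] at h; exact Prod.ext (by linarith) (by linarith)
        · refine ⟨⟨?_, ?_, ?_, ?_⟩, fun h => ?_, fun h => ?_⟩
          any_goals linarith
          · rw [mem_rect] at h; exact Prod.ext (by linarith) (by linarith)
          · rw [mem_rect] at h; exact Prod.ext (by linarith) (by linarith)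
  obtain ⟨B, hB, hB1⟩ : ∃ B : Set (ℝ × ℝ), JoinedIn B (x₀ - 1, y₁ + 1) b ∧ ∀ z ∈ B,
      (x₀ - 1 ≤ z.1 ∧ z.1 ≤ x₁ ∧ y₀ ≤ z.2 ∧ z.2 ≤ y₁ + 1) ∧ (z ∈ rect x₀ x₁ y₀ y₁ → z = b) ∧
        (z ∈ E → b = p) := by
    rcases hb with hb | hb
    · refine ⟨rect (x₀ - 1) b.1 (y₁ + 1) (y₁ + 1) ∪ rect b.1 b.1 y₁ (y₁ + 1), ?_, ?_⟩
      · refine JoinedIn.trans (y := (b.1, y₁ + 1)) ((joinedIn_rect ?_ ?_).mono subset_union_left)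
          ((joinedIn_rect ?_ ?_).mono subset_union_right) <;> simp [mem_rect, hb] <;> linarith
      · intro z hz
        rcases hz with hz | hz <;> rw [mem_rect] at hz
        · refine ⟨⟨?_, ?_, ?_, ?_⟩, fun h => ?_, fun h => ?_⟩
          any_goals linarith
          · rw [mem_rect] at h; exfalso; linarith
          · rw [mem_rect] at h; exfalso; linarith
        · refine ⟨⟨?_, ?_, ?_, ?_⟩, fun h => ?_, fun h => ?_⟩
          any_goals linarith
          · rw [mem_rect] at h; exact Prod.ext (by linarith) (by linarith)
          · rw [mem_rect] at h; exact Prod.ext (by linarith) (by linarith)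
    · refine ⟨rect (x₀ - 1) (x₀ - 1) b.2 (y₁ + 1) ∪ rect (x₀ - 1) x₀ b.2 b.2, ?_, ?_⟩
      · refine JoinedIn.trans (y := (x₀ - 1, b.2)) ((joinedIn_rect ?_ ?_).mono subset_union_left)
          ((joinedIn_rect ?_ ?_).mono subset_union_right) <;> simp [mem_rect, hb] <;> linarith
      · intro z hz
        rcases hz with hz | hz <;> rw [mem_rect] at hz
        · refine ⟨⟨?_, ?_, ?_, ?_⟩, fun h => ?_, fun h => ?_⟩
          any_goals linarith
          · rw [mem_rect] at h; exfalso; linarith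
          · rw [mem_rect] at h; exact Prod.ext (by linarith) (by linarith)
        · refine ⟨⟨?_, ?_, ?_, ?_⟩, fun h => ?_, fun h => ?_⟩
          any_goals linarith
          · rw [mem_rect] at h; exact Prod.ext (by linarith) (by linarith)
          · rw [mem_rect] at h; exact Prod.ext (by linarith) (by linarith)
  have hV : JoinedIn (A ∪ G ∪ B) (x₀ - 1, y₀ - 1) (x₀ - 1, y₁ + 1) :=
    ((hA.mono (subset_union_left.trans subset_union_left)).trans
      (hG.mono (subset_union_right.trans subset_union_left))).trans
      (hB.symm.mono subset_union_right)
  obtain ⟨z, hz1, hz2⟩ := joinedIn_cross hE hV (by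
      rintro z ((hz | hz) | hz)
      · have := hA1 z hz; constructor <;> linarith [this.1.1, this.1.2.1]
      · have := mem_rect.1 (hGD hz); constructor <;> linarith
      · have := hB1 z hz; constructor <;> linarith [this.1.1, this.1.2.1])
    (by
      rintro z (hz | hz)
      · have := mem_rect.1 hz; constructor <;> simp only [] <;> linarith
      · have := mem_rect.1 (hFD hz); constructor <;> simp only [] <;> linarith)
  rcases hz1 with h1 | h1 <;> rcases hz2 with (h2 | h2) | h2
  · exact disj p pF ((hA1 z h2).2.2 h1 ▸ aG)
  · have e1 := mem_rect.1 h1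
    have e2 := mem_rect.1 (hGD h2)
    have : z = p := Prod.ext (by linarith) (by linarith)
    exact disj z (this ▸ pF) h2
  · exact disj p pF ((hB1 z h2).2.2 h1 ▸ bG)
  · exact disj z h1 ((hA1 z h2).2.1 (hFD h1) ▸ aG)
  · exact disj z h1 h2
  · exact disj z h1 ((hB1 z h2).2.1 (hFD h1) ▸ bG)

section Pieces

variable {ι : Type*} [Finite ι]

/-- The intersection graph of a family of sets. -/
def Meets (K : ι → Set (ℝ × ℝ)) (i j : ι) : Prop := (K i ∩ K j).Nonempty

lemma joinedIn_of_chain {ι : Type*} {K : ι → Set (ℝ × ℝ)} (hc : ∀ i, Convex ℝ (K i)) {i j : ι}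
    (h : Relation.ReflTransGen (Meets K) i j) {x y : ℝ × ℝ} (hx : x ∈ K i) (hy : y ∈ K j) :
    JoinedIn (⋃ i, K i) x y := by
  induction h generalizing y with
  | refl =>
    exact (JoinedIn.of_segment_subset ((hc i).segment_subset hx hy)).mono (subset_iUnion K i)
  | @tail b c _ hbc ih =>
    obtain ⟨w, hw1, hw2⟩ := hbc
    exact (ih hw1).trans
      ((JoinedIn.of_segment_subset ((hc c).segment_subset hw2 hy)).mono (subset_iUnion K c))

lemma chain_of_joinedIn {K : ι → Set (ℝ × ℝ)} (hcl : ∀ i, IsClosed (K i)) {x y : ℝ × ℝ}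
    (h : JoinedIn (⋃ i, K i) x y) :
    ∃ i j, x ∈ K i ∧ y ∈ K j ∧ Relation.ReflTransGen (Meets K) i j := by
  obtain ⟨i, hi⟩ := mem_iUnion.1 h.source_mem
  obtain ⟨γ, hγ⟩ := h
  let C1 := ⋃ j ∈ {j | Relation.ReflTransGen (Meets K) i j}, K j
  let C2 := ⋃ j ∈ {j | ¬ Relation.ReflTransGen (Meets K) i j}, K j
  have hC1 : IsClosed C1 := (Set.toFinite _).isClosed_biUnion fun j _ => hcl j
  have hC2 : IsClosed C2 := (Set.toFinite _).isClosed_biUnion fun j _ => hcl j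
  have hpre : IsPreconnected (range γ) := isPreconnected_range γ.continuous
  have hcov : range γ ⊆ C1 ∪ C2 := by
    rintro _ ⟨t, rfl⟩
    obtain ⟨j, hj⟩ := mem_iUnion.1 (hγ t)
    by_cases hr : Relation.ReflTransGen (Meets K) i j
    · exact Or.inl (mem_biUnion (show j ∈ {j | _} from hr) hj)
    · exact Or.inr (mem_biUnion (show j ∈ {j | _} from hr) hj)
  have hdis : ¬ (range γ ∩ (C1 ∩ C2)).Nonempty := by
    rintro ⟨z, -, h1, h2⟩
    simp only [C1, C2, mem_iUnion, mem_ofPred_eq] at h1 h2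
    obtain ⟨j, hj, hzj⟩ := h1
    obtain ⟨k, hk, hzk⟩ := h2
    exact hk (hj.tail ⟨z, hzj, hzk⟩)
  have h1 : (range γ ∩ C1).Nonempty :=
    ⟨x, ⟨0, γ.source⟩, mem_biUnion (show i ∈ {j | _} from Relation.ReflTransGen.refl) hi⟩
  have hy1 : y ∈ C1 := by
    by_contra hy
    have hy2 : y ∈ C2 := (hcov ⟨1, γ.target⟩).resolve_left hy
    exact hdis (isPreconnected_closed_iff.1 hpre C1 C2 hC1 hC2 hcov h1 ⟨y, ⟨1, γ.target⟩, hy2⟩)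
  simp only [C1, mem_iUnion, mem_ofPred_eq] at hy1
  obtain ⟨j, hj, hyj⟩ := hy1
  exact ⟨i, j, hi, hyj, hj⟩

/-- A separating function for a closed set which does not connect two opposite sides. -/
lemma exists_separator {K : ι → Set (ℝ × ℝ)} (hcl : ∀ i, IsClosed (K i))
    (hc : ∀ i, Convex ℝ (K i)) {φ : ℝ × ℝ → ℝ × ℝ} (hφ : Continuous φ)
    {L R Q : Set (ℝ × ℝ)} (hL : IsClosed L) (hR : IsClosed R) (hQ : IsClosed Q)
    (hLn : L.Nonempty) (hRn : R.Nonempty) (hLR : Disjoint L R)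
    (hno : ∀ l ∈ L, ∀ r ∈ R, ¬ JoinedIn (⋃ i, K i) (φ l) (φ r)) :
    ∃ f : ℝ × ℝ → ℝ, Continuous f ∧ (∀ l ∈ L, f l ≤ 0) ∧ (∀ r ∈ R, 0 ≤ f r) ∧
      ∀ q ∈ Q, f q = 0 → φ q ∉ ⋃ i, K i := by
  let S : Set ι := {j | ∃ i, (∃ l ∈ L, φ l ∈ K i) ∧ Relation.ReflTransGen (Meets K) i j}
  let C1 := ⋃ j ∈ S, K j
  let C2 := ⋃ j ∈ Sᶜ, K j
  have hC1 : IsClosed C1 := (Set.toFinite _).isClosed_biUnion fun j _ => hcl j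
  have hC2 : IsClosed C2 := (Set.toFinite _).isClosed_biUnion fun j _ => hcl j
  let P1 := L ∪ (Q ∩ φ ⁻¹' C1)
  let P2 := R ∪ (Q ∩ φ ⁻¹' C2)
  have hP1 : IsClosed P1 := hL.union (hQ.inter (hC1.preimage hφ))
  have hP2 : IsClosed P2 := hR.union (hQ.inter (hC2.preimage hφ))
  have n1 : P1.Nonempty := hLn.mono subset_union_left
  have n2 : P2.Nonempty := hRn.mono subset_union_left
  have hdisj : ∀ q, q ∈ P1 → q ∈ P2 → False := by
    rintro q (h1 | ⟨-, h1⟩) (h2 | ⟨-, h2⟩)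
    · exact Set.disjoint_left.1 hLR h1 h2
    · simp only [C2, mem_preimage, mem_iUnion] at h2
      obtain ⟨j, hj, hq⟩ := h2
      exact hj ⟨j, ⟨q, h1, hq⟩, Relation.ReflTransGen.refl⟩
    · simp only [C1, mem_preimage, mem_iUnion] at h1
      obtain ⟨j, ⟨i, ⟨l, hl, hli⟩, hij⟩, hq⟩ := h1
      exact hno l hl q h2 (joinedIn_of_chain hc hij hli hq)
    · simp only [C1, C2, mem_preimage, mem_iUnion] at h1 h2
      obtain ⟨j, ⟨i, hi, hij⟩, hq⟩ := h1
      obtain ⟨k, hk, hqk⟩ := h2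
      exact hk ⟨i, hi, hij.tail ⟨_, hq, hqk⟩⟩
  have z1 : ∀ q ∈ P1, Metric.infDist q P1 = 0 := fun q hq => Metric.infDist_zero_of_mem hq
  have z2 : ∀ q ∈ P2, Metric.infDist q P2 = 0 := fun q hq => Metric.infDist_zero_of_mem hq
  refine ⟨fun q => Metric.infDist q P1 - Metric.infDist q P2, by fun_prop, ?_, ?_, ?_⟩
  · intro l hl
    simp only [z1 l (Or.inl hl)]
    linarith [Metric.infDist_nonneg (x := l) (s := P2)]
  · intro r hr
    simp only [z2 r (Or.inl hr)]
    linarith [Metric.infDist_nonneg (x := r) (s := P1)]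
  · intro q hq h0 hmem
    have h0' : Metric.infDist q P1 = Metric.infDist q P2 := by linarith
    obtain ⟨j, hj⟩ := mem_iUnion.1 hmem
    by_cases hjS : j ∈ S
    · have q1 : q ∈ P1 := Or.inr ⟨hq, mem_biUnion hjS hj⟩
      have : q ∈ P2 := (hP2.mem_iff_infDist_zero n2).2 (by rw [← h0', z1 q q1])
      exact hdisj q q1 this
    · have q2 : q ∈ P2 := Or.inr ⟨hq, mem_biUnion (show j ∈ Sᶜ from hjS) hj⟩
      have : q ∈ P1 := (hP1.mem_iff_infDist_zero n1).2 (by rw [h0', z2 q q2])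
      exact hdisj q this q2

/-- Planar duality for two families of closed convex sets covering a topological square. -/
theorem exists_crossing {κ : Type*} [Finite κ] {K : ι → Set (ℝ × ℝ)} {M : κ → Set (ℝ × ℝ)}
    (hK : ∀ i, IsClosed (K i)) (hKc : ∀ i, Convex ℝ (K i))
    (hM : ∀ i, IsClosed (M i)) (hMc : ∀ i, Convex ℝ (M i))
    {φ : ℝ × ℝ → ℝ × ℝ} (hφ : Continuous φ)
    (hcov : ∀ s ∈ Icc (0 : ℝ) 1, ∀ t ∈ Icc (0 : ℝ) 1, φ (s, t) ∈ (⋃ i, K i) ∪ ⋃ j, M j) :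
    (∃ t ∈ Icc (0 : ℝ) 1, ∃ t' ∈ Icc (0 : ℝ) 1,
      JoinedIn (⋃ i, K i) (φ (0, t)) (φ (1, t'))) ∨
    (∃ s ∈ Icc (0 : ℝ) 1, ∃ s' ∈ Icc (0 : ℝ) 1,
      JoinedIn (⋃ j, M j) (φ (s, 0)) (φ (s', 1))) := by
  by_contra! hcon
  obtain ⟨h1, h2⟩ := hcon
  have i01 : IsClosed (rect 0 1 0 1) := isClosed_Icc.prod isClosed_Icc
  obtain ⟨f, hf, fl, fr, fz⟩ := exists_separator hK hKc hφ (L := rect 0 0 0 1)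
    (R := rect 1 1 0 1) (Q := rect 0 1 0 1) (isClosed_Icc.prod isClosed_Icc)
    (isClosed_Icc.prod isClosed_Icc) i01 ⟨(0, 0), by simp [mem_rect]⟩ ⟨(1, 0), by simp [mem_rect]⟩
    (Set.disjoint_left.2 fun z hz hz' => by rw [mem_rect] at hz hz'; linarith)
    (by
      rintro ⟨l1, l2⟩ hl ⟨r1, r2⟩ hr
      rw [mem_rect] at hl hr
      obtain rfl : l1 = 0 := le_antisymm hl.1.2 hl.1.1
      obtain rfl : r1 = 1 := le_antisymm hr.1.2 hr.1.1
      exact h1 _ hl.2 _ hr.2)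
  obtain ⟨g, hg, gl, gr, gz⟩ := exists_separator hM hMc hφ (L := rect 0 1 0 0)
    (R := rect 0 1 1 1) (Q := rect 0 1 0 1) (isClosed_Icc.prod isClosed_Icc)
    (isClosed_Icc.prod isClosed_Icc) i01 ⟨(0, 0), by simp [mem_rect]⟩ ⟨(1, 1), by simp [mem_rect]⟩
    (Set.disjoint_left.2 fun z hz hz' => by rw [mem_rect] at hz hz'; linarith)
    (by
      rintro ⟨l1, l2⟩ hl ⟨r1, r2⟩ hr
      rw [mem_rect] at hl hr
      obtain rfl : l2 = 0 := le_antisymm hl.2.2 hl.2.1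
      obtain rfl : r2 = 1 := le_antisymm hr.2.2 hr.2.1
      exact h2 _ hl.1 _ hr.1)
  obtain ⟨s, hs, t, ht, e1, e2⟩ := poincare_miranda hf hg
    (fun t ht => fl _ ⟨by simp, ht⟩) (fun t ht => fr _ ⟨by simp, ht⟩)
    (fun s hs => gl _ ⟨hs, by simp⟩) (fun s hs => gr _ ⟨hs, by simp⟩)
  rcases hcov s hs t ht with h | h
  · exact fz _ ⟨hs, ht⟩ e1 h
  · exact gz _ ⟨hs, ht⟩ e2 h

end Pieces

section Poisson

variable {X : Type*} [MeasurableSpace X]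

/-- A finite family of points, seen as a tuple of arbitrary length. -/
abbrev Conf (X : Type*) := Σ k : ℕ, (Fin k → X)

/-- The set of points of a finite family. -/
def pset (ω : Conf X) : Set X := range ω.2

/-- The law of the Poisson point process with finite intensity measure `Λ`. -/
noncomputable def poisson (Λ : Measure X) : Measure (Conf X) :=
  ENNReal.ofReal (Real.exp (-Λ.real univ)) • Measure.sum fun k : ℕ =>
    ((k.factorial : ℝ≥0∞)⁻¹) • (Measure.pi fun _ : Fin k => Λ).map (Sigma.mk k)

/-- Events that are observable, i.e. measurable for families of each given size. -/
def Obs (A : Set (Set X)) : Prop := ∀ k, MeasurableSet {z : Fin k → X | range z ∈ A}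

/-- The measure of `k`-tuples whose set of points satisfies `A`. -/
noncomputable def cnt (Λ : Measure X) (A : Set (Set X)) (k : ℕ) : ℝ≥0∞ :=
  Measure.pi (fun _ : Fin k => Λ) {z | range z ∈ A}

/-- The exponential generating series of `cnt`. -/
noncomputable def egf (Λ : Measure X) (A : Set (Set X)) : ℝ≥0∞ :=
  ∑' k : ℕ, ((k.factorial : ℝ≥0∞)⁻¹) * cnt Λ A k

lemma Obs.measurableSet {A : Set (Set X)} (hA : Obs A) : MeasurableSet (pset ⁻¹' A) := by
  refine MeasurableSpace.measurableSet_iInf.2 fun k => ?_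
  exact hA k

lemma measurable_sigma_mk (k : ℕ) : Measurable fun z : Fin k → X => (⟨k, z⟩ : Conf X) :=
  fun _ hs => MeasurableSpace.measurableSet_iInf.1 hs k

lemma Obs.inter {A B : Set (Set X)} (hA : Obs A) (hB : Obs B) : Obs (A ∩ B) :=
  fun k => (hA k).inter (hB k)

lemma Obs.union {A B : Set (Set X)} (hA : Obs A) (hB : Obs B) : Obs (A ∪ B) :=
  fun k => (hA k).union (hB k)

lemma Obs.compl {A : Set (Set X)} (hA : Obs A) : Obs Aᶜ :=
  fun k => (hA k).compl

lemma obs_univ : Obs (univ : Set (Set X)) := fun k => by simp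

lemma Obs.iUnion {ι : Type*} [Countable ι] {A : ι → Set (Set X)} (hA : ∀ i, Obs (A i)) :
    Obs (⋃ i, A i) := fun k => by
  have : {z : Fin k → X | range z ∈ ⋃ i, A i} = ⋃ i, {z : Fin k → X | range z ∈ A i} := by
    ext z; simp
  rw [this]
  exact MeasurableSet.iUnion fun i => hA i k

lemma obs_subset {W : Set X} (hW : MeasurableSet W) : Obs {S : Set X | S ⊆ W} := fun k => by
  have : {z : Fin k → X | range z ∈ {S : Set X | S ⊆ W}} = ⋂ i, (fun z => z i) ⁻¹' W := by
    ext z; simp [range_subset_iff]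
  rw [this]
  exact MeasurableSet.iInter fun i => (measurable_pi_apply i) hW

lemma poisson_apply (Λ : Measure X) {A : Set (Set X)} (hA : Obs A) :
    poisson Λ (pset ⁻¹' A) = ENNReal.ofReal (Real.exp (-Λ.real univ)) * egf Λ A := by
  rw [poisson, Measure.smul_apply, smul_eq_mul, Measure.sum_apply _ hA.measurableSet, egf]
  congr 2
  funext k
  rw [Measure.smul_apply, smul_eq_mul, Measure.map_apply _ hA.measurableSet]
  · rfl
  · exact measurable_sigma_mk k

variable (Λ : Measure X) [IsFiniteMeasure Λ]

lemma egf_univ : egf Λ univ = ENNReal.ofReal (Real.exp (Λ.real univ)) := by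
  have h1 : ∀ k : ℕ, ((k.factorial : ℝ≥0∞)⁻¹) * cnt Λ univ k =
      ENNReal.ofReal (Λ.real univ ^ k / k.factorial) := by
    intro k
    have : cnt Λ univ k = Λ univ ^ k := by
      simp [cnt, Measure.pi_univ]
    rw [this, ENNReal.ofReal_div_of_pos (by positivity), ENNReal.ofReal_pow measureReal_nonneg,
      Measure.real, ENNReal.ofReal_toReal (measure_ne_top _ _), ENNReal.ofReal_natCast,
      ENNReal.div_eq_inv_mul]
  rw [egf, tsum_congr h1, ← ENNReal.ofReal_tsum_of_nonneg (fun k => by positivity)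
    (Real.summable_pow_div_factorial _), Real.exp_eq_exp_ℝ]
  rw [NormedSpace.exp_eq_tsum_div]

instance : IsProbabilityMeasure (poisson Λ) := ⟨by
  have := poisson_apply Λ obs_univ
  rw [preimage_univ] at this
  rw [this, egf_univ, ← ENNReal.ofReal_mul (Real.exp_pos _).le, ← Real.exp_add]
  simp⟩

lemma cnt_fintype {ι : Type*} [Fintype ι] (A : Set (Set X)) :
    Measure.pi (fun _ : ι => Λ) {z | range z ∈ A} = cnt Λ A (Fintype.card ι) := by
  let e := Fintype.equivFin ι
  have h := measurePreserving_piCongrLeft (fun _ : Fin (Fintype.card ι) => Λ) e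
  rw [cnt, ← h.measure_preimage_equiv]
  congr 1
  ext z
  have : range ((MeasurableEquiv.piCongrLeft (fun _ : Fin (Fintype.card ι) => X) e) z) = range
      z := by
    ext x
    constructor
    · rintro ⟨i, rfl⟩
      exact ⟨e.symm i, by
        obtain ⟨j, rfl⟩ := e.surjective i
        rw [MeasurableEquiv.coe_piCongrLeft]
        rw [Equiv.piCongrLeft_apply_apply]; simp⟩
    · rintro ⟨i, rfl⟩
      exact ⟨e i, by
        rw [MeasurableEquiv.coe_piCongrLeft]
        rw [Equiv.piCongrLeft_apply_apply]⟩
  simp only [mem_preimage, mem_ofPred_eq, this]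

lemma Obs.measurable_fintype {A : Set (Set X)} (hA : Obs A) {ι : Type*} [Fintype ι] :
    MeasurableSet {z : ι → X | range z ∈ A} := by
  let e := Fintype.equivFin ι
  have hm : Measurable fun (z : ι → X) => fun i => z (e.symm i) := by fun_prop
  have := hm (hA (Fintype.card ι))
  convert this using 1
  ext z
  simp only [mem_preimage, mem_ofPred_eq]
  rw [show (fun i => z (e.symm i)) = z ∘ e.symm from rfl, e.symm.surjective.range_comp]

lemma cnt_split {k : ℕ} (T : Finset (Fin k)) (A B : Set (Set X)) :
    Measure.pi (fun _ : Fin k => Λ) {z | z '' (T : Set (Fin k)) ∈ A ∧ z '' (T : Set (Fin k))ᶜ ∈ B} =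
      cnt Λ A T.card * cnt Λ B (k - T.card) := by
  have h := measurePreserving_piEquivPiSubtypeProd (fun _ : Fin k => Λ) (fun i => i ∈ T)
  have hset : {z : Fin k → X | z '' (T : Set (Fin k)) ∈ A ∧ z '' (T : Set (Fin k))ᶜ ∈ B} =
      (MeasurableEquiv.piEquivPiSubtypeProd (fun _ : Fin k => X) (fun i => i ∈ T)) ⁻¹'
        ({z | range z ∈ A} ×ˢ {z | range z ∈ B}) := by
    ext z
    have e1 : range (fun x : {i // i ∈ T} => z x) = z '' (T : Set (Fin k)) := by
      ext; simp
    have e2 : range (fun x : {i // i ∉ T} => z x) = z '' (T : Set (Fin k))ᶜ := by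
      ext; simp
    simp only [mem_ofPred_eq, mem_preimage, mem_prod, MeasurableEquiv.piEquivPiSubtypeProd,
      MeasurableEquiv.coe_mk, Equiv.piEquivPiSubtypeProd_apply]
    rw [e1, e2]
  rw [hset, h.measure_preimage_equiv, Measure.prod_prod]
  have c1 := cnt_fintype Λ (ι := {i // i ∈ T}) A
  have c2 := cnt_fintype Λ (ι := {i // i ∉ T}) B
  rw [Fintype.card_coe] at c1
  rw [Fintype.card_subtype_compl, Fintype.card_coe, Fintype.card_fin] at c2
  rw [← c1, ← c2]
  congr!

lemma Obs.measurable_split {A B : Set (Set X)} (hA : Obs A) (hB : Obs B) {k : ℕ}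
    (T : Finset (Fin k)) : MeasurableSet
      {z : Fin k → X | z '' (T : Set (Fin k)) ∈ A ∧ z '' (T : Set (Fin k))ᶜ ∈ B} := by
  have m1 : Measurable fun (z : Fin k → X) => fun (i : {i // i ∈ T}) => z i := by fun_prop
  have m2 : Measurable fun (z : Fin k → X) => fun (i : {i // i ∉ T}) => z i := by fun_prop
  convert (m1 hA.measurable_fintype).inter (m2 hB.measurable_fintype) using 1
  ext z
  have e1 : range (fun x : {i // i ∈ T} => z x) = z '' (T : Set (Fin k)) := by
    ext; simp
  have e2 : range (fun x : {i // i ∉ T} => z x) = z '' (T : Set (Fin k))ᶜ := by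
    ext; simp
  simp only [mem_inter_iff, mem_preimage, mem_ofPred_eq, e1, e2]

/-- Superposition: splitting a family in two in all possible ways. -/
lemma tsum_split (A B : Set (Set X)) :
    ∑' k : ℕ, ((k.factorial : ℝ≥0∞)⁻¹) * ∑ T : Finset (Fin k), Measure.pi (fun _ : Fin k => Λ)
      {z | z '' (T : Set (Fin k)) ∈ A ∧ z '' (T : Set (Fin k))ᶜ ∈ B} = egf Λ A * egf Λ B := by
  have h1 : ∀ k : ℕ, ((k.factorial : ℝ≥0∞)⁻¹) * ∑ T : Finset (Fin k),
      Measure.pi (fun _ : Fin k => Λ)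
        {z | z '' (T : Set (Fin k)) ∈ A ∧ z '' (T : Set (Fin k))ᶜ ∈ B} =
      ∑ p ∈ Finset.HasAntidiagonal.antidiagonal k, (((p.1.factorial : ℝ≥0∞)⁻¹) * cnt Λ A p.1) *
        (((p.2.factorial : ℝ≥0∞)⁻¹) * cnt Λ B p.2) := by
    intro k
    simp_rw [cnt_split]
    have := Finset.sum_powerset_apply_card (x := (Finset.univ : Finset (Fin k)))
      (fun j => cnt Λ A j * cnt Λ B (k - j))
    rw [Finset.powerset_univ, Finset.card_univ, Fintype.card_fin] at this
    rw [this, Finset.Nat.sum_antidiagonal_eq_sum_range_succ_mk, Finset.mul_sum]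
    refine Finset.sum_congr rfl fun j hj => ?_
    have hj : j ≤ k := Nat.lt_succ_iff.1 (Finset.mem_range.1 hj)
    have hc : ((k.factorial : ℝ≥0∞)⁻¹) * (k.choose j : ℝ≥0∞) =
        ((j.factorial : ℝ≥0∞)⁻¹) * (((k - j).factorial : ℝ≥0∞)⁻¹) := by
      have e := Nat.choose_mul_factorial_mul_factorial hj
      have n1 : ((k.factorial : ℕ) : ℝ≥0∞) ≠ 0 := by exact_mod_cast k.factorial_ne_zero
      have n2 : ((j.factorial : ℕ) : ℝ≥0∞) ≠ 0 := by exact_mod_cast j.factorial_ne_zero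
      have n3 : (((k - j).factorial : ℕ) : ℝ≥0∞) ≠ 0 := by
        exact_mod_cast (k - j).factorial_ne_zero
      have n4 : ((k.choose j : ℕ) : ℝ≥0∞) ≠ 0 := by exact_mod_cast (Nat.choose_pos hj).ne'
      rw [← e]
      push_cast
      rw [ENNReal.mul_inv (Or.inr (by simp)) (Or.inr n3),
        ENNReal.mul_inv (by simp) (by simp)]
      calc _ = ((k.choose j : ℝ≥0∞)⁻¹ * (k.choose j : ℝ≥0∞)) *
            (((j.factorial : ℝ≥0∞)⁻¹) * (((k - j).factorial : ℝ≥0∞)⁻¹)) := by ring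
        _ = _ := by rw [ENNReal.inv_mul_cancel n4 (by simp), one_mul]
    rw [nsmul_eq_mul, ← mul_assoc, hc]
    ring
  rw [tsum_congr h1]
  have h2 : egf Λ A * egf Λ B = ∑' p : ℕ × ℕ, (((p.1.factorial : ℝ≥0∞)⁻¹) * cnt Λ A p.1) *
        (((p.2.factorial : ℝ≥0∞)⁻¹) * cnt Λ B p.2) := by
    rw [ENNReal.tsum_prod', egf, egf, ← ENNReal.tsum_mul_right]
    refine tsum_congr fun j => ?_
    exact ENNReal.tsum_mul_left.symm
  rw [h2, ← Finset.HasAntidiagonal.sigmaAntidiagonalEquivProd.tsum_eq, ENNReal.tsum_sigma']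
  refine tsum_congr fun k => ?_
  rw [tsum_fintype]
  exact (Finset.sum_coe_sort (Finset.HasAntidiagonal.antidiagonal k) (fun p =>
    (((p.1.factorial : ℝ≥0∞)⁻¹) * cnt Λ A p.1) *
        (((p.2.factorial : ℝ≥0∞)⁻¹) * cnt Λ B p.2))).symm

/-- The event only depends on the points in `W`. -/
def Dep (W : Set X) (A : Set (Set X)) : Prop := ∀ S, S ∈ A ↔ S ∩ W ∈ A

lemma cnt_restrict {W : Set X} (A : Set (Set X)) (hA : Obs A) (k : ℕ) :
    cnt (Λ.restrict W) A k = cnt Λ (A ∩ {S | S ⊆ W}) k := by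
  rw [cnt, ← Measure.restrict_pi_pi, Measure.restrict_apply (hA k), cnt]
  congr 1
  ext z
  simp [range_subset_iff]

lemma sum_measure_eq_lintegral {k : ℕ} {A B : Set (Set X)} (hA : Obs A) (hB : Obs B) :
    ∑ T : Finset (Fin k), Measure.pi (fun _ : Fin k => Λ)
      {z | z '' (T : Set (Fin k)) ∈ A ∧ z '' (T : Set (Fin k))ᶜ ∈ B} =
    ∫⁻ z, ∑ T : Finset (Fin k),
      (if z '' (T : Set (Fin k)) ∈ A ∧ z '' (T : Set (Fin k))ᶜ ∈ B then 1 else 0)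
      ∂(Measure.pi (fun _ : Fin k => Λ)) := by
  rw [lintegral_finsetSum']
  · refine Finset.sum_congr rfl fun T _ => ?_
    rw [← lintegral_indicator_one (hA.measurable_split hB T)]
    refine lintegral_congr fun z => ?_
    simp [indicator_apply]
  · intro T _
    exact (Measurable.ite (hA.measurable_split hB T) measurable_const measurable_const).aemeasurable

/-- Families of points split into the points in a set and the points outside. -/
lemma cnt_inter_eq_sum {W : Set X} (hW : MeasurableSet W) {A B : Set (Set X)} (hA : Obs A)
    (hB : Obs B) (hAW : Dep W A) (hBW : Dep Wᶜ B) (k : ℕ) :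
    cnt Λ (A ∩ B) k = ∑ T : Finset (Fin k), Measure.pi (fun _ : Fin k => Λ)
      {z | z '' (T : Set (Fin k)) ∈ A ∩ {S | S ⊆ W} ∧
        z '' (T : Set (Fin k))ᶜ ∈ B ∩ {S | S ⊆ Wᶜ}} := by
  rw [sum_measure_eq_lintegral Λ (hA.inter (obs_subset hW)) (hB.inter (obs_subset hW.compl)), cnt,
      ← lintegral_indicator_one ((hA.inter hB) k)]
  refine lintegral_congr fun z => ?_
  have hT0 : ((Finset.univ.filter fun i => z i ∈ W : Finset (Fin k)) : Set (Fin k)) =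
      z ⁻¹' W := by ext; simp
  rw [Finset.sum_eq_single (Finset.univ.filter fun i => z i ∈ W)]
  · rw [hT0, indicator_apply, image_preimage_eq_range_inter, ← preimage_compl,
      image_preimage_eq_range_inter]
    simp only [mem_ofPred_eq, mem_inter_iff, inter_subset_right, and_true, ← hAW (range z),
      ← hBW (range z), Pi.one_apply]
  · intro T _ hT
    rw [if_neg]
    rintro ⟨⟨-, h1⟩, ⟨-, h2⟩⟩
    apply hT
    ext i
    simp only [Finset.mem_filter, Finset.mem_univ, true_and]
    constructor
    · intro hi
      exact h1 ⟨i, hi, rfl⟩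
    · intro hi
      by_contra hn
      exact h2 ⟨i, hn, rfl⟩ hi
  · simp

/-- Independence of the restrictions of the process to complementary regions. -/
theorem poisson_inter {W : Set X} (hW : MeasurableSet W) {A B : Set (Set X)} (hA : Obs A)
    (hB : Obs B) (hAW : Dep W A) (hBW : Dep Wᶜ B) :
    poisson Λ (pset ⁻¹' (A ∩ B)) =
      poisson (Λ.restrict W) (pset ⁻¹' A) * poisson (Λ.restrict Wᶜ) (pset ⁻¹' B) := by
  rw [poisson_apply _ (hA.inter hB), poisson_apply _ hA, poisson_apply _ hB]
  have e1 : egf (Λ.restrict W) A = egf Λ (A ∩ {S | S ⊆ W}) :=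
    tsum_congr fun k => by rw [cnt_restrict Λ A hA]
  have e2 : egf (Λ.restrict Wᶜ) B = egf Λ (B ∩ {S | S ⊆ Wᶜ}) :=
    tsum_congr fun k => by rw [cnt_restrict Λ B hB]
  have e3 : egf Λ (A ∩ B) = egf Λ (A ∩ {S | S ⊆ W}) * egf Λ (B ∩ {S | S ⊆ Wᶜ}) := by
    rw [← tsum_split, egf]
    exact tsum_congr fun k => by rw [cnt_inter_eq_sum Λ hW hA hB hAW hBW]
  rw [e1, e2, e3]
  have e4 : Λ.real univ = (Λ.restrict W).real univ + (Λ.restrict Wᶜ).real univ := by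
    simp only [measureReal_restrict_apply_univ]
    exact (measureReal_add_measureReal_compl hW).symm
  rw [e4, neg_add, Real.exp_add, ENNReal.ofReal_mul (Real.exp_pos _).le]
  ring

lemma dep_univ (W : Set X) : Dep W (univ : Set (Set X)) := fun S => by simp

theorem poisson_restrict {W : Set X} (hW : MeasurableSet W) {A : Set (Set X)} (hA : Obs A)
    (hAW : Dep W A) :
    poisson Λ (pset ⁻¹' A) = poisson (Λ.restrict W) (pset ⁻¹' A) := by
  have := poisson_inter Λ hW hA obs_univ hAW (dep_univ _)
  rw [inter_univ, preimage_univ, measure_univ, mul_one] at this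
  exact this

theorem poisson_indep {W : Set X} (hW : MeasurableSet W) {A B : Set (Set X)} (hA : Obs A)
    (hB : Obs B) (hAW : Dep W A) (hBW : Dep Wᶜ B) :
    poisson Λ (pset ⁻¹' (A ∩ B)) = poisson Λ (pset ⁻¹' A) * poisson Λ (pset ⁻¹' B) := by
  rw [poisson_inter Λ hW hA hB hAW hBW, ← poisson_restrict Λ hW hA hAW,
    ← poisson_restrict Λ hW.compl hB hBW]

/-- Equivariance of the Poisson process under measurable bijections. -/
theorem poisson_map {Y : Type*} [MeasurableSpace Y] (g : X → Y) (hg : Measurable g)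
    {A : Set (Set Y)} (hA : Obs A) :
    poisson (Λ.map g) (pset ⁻¹' A) = poisson Λ (pset ⁻¹' {S | g '' S ∈ A}) := by
  have hm : ∀ k, Measurable fun (z : Fin k → X) => fun i => g (z i) := fun k =>
    measurable_pi_lambda _ fun i => hg.comp (measurable_pi_apply i)
  have hr : ∀ k (z : Fin k → X), range (fun i => g (z i)) = g '' range z := fun k z =>
    range_comp g z
  have hA' : Obs {S | g '' S ∈ A} := fun k => by
    have := hm k (hA k)
    convert this using 1
    ext z
    simp [hr]
  rw [poisson_apply _ hA, poisson_apply _ hA']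
  have e : (Λ.map g).real univ = Λ.real univ := by
    rw [Measure.real, Measure.map_apply hg MeasurableSet.univ, preimage_univ]; rfl
  rw [e, egf, egf]
  congr 1
  refine tsum_congr fun k => ?_
  congr 1
  rw [cnt, cnt]
  rw [Measure.pi_map_pi (fun _ => hg.aemeasurable) |>.symm, Measure.map_apply (hm k) (hA k)]
  congr 1
  ext z
  simp [hr]

lemma poisson_null {A : Set (Set X)} (hA : Obs A)
    (h : ∀ k, Measure.pi (fun _ : Fin k => Λ) {z | range z ∈ A} = 0) :
    poisson Λ (pset ⁻¹' A) = 0 := by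
  rw [poisson_apply _ hA, egf]
  simp [cnt, h]

lemma poisson_void {W : Set X} (hW : MeasurableSet W) :
    poisson Λ (pset ⁻¹' {S | S ∩ W = ∅}) = ENNReal.ofReal (Real.exp (-Λ.real W)) := by
  have hs : {S : Set X | S ∩ W = ∅} = {S | S ⊆ Wᶜ} := by
    ext S
    simp [subset_compl_iff_disjoint_right, disjoint_iff_inter_eq_empty]
  rw [hs, poisson_apply _ (obs_subset hW.compl)]
  have h1 : egf Λ {S | S ⊆ Wᶜ} = egf (Λ.restrict Wᶜ) univ :=
    tsum_congr fun k => by rw [cnt_restrict Λ univ obs_univ, univ_inter]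
  rw [h1, egf_univ, ← ENNReal.ofReal_mul (Real.exp_pos _).le, ← Real.exp_add,
    measureReal_restrict_apply_univ, ← measureReal_add_measureReal_compl hW (μ := Λ)]
  congr 2
  ring

end Poisson

section Harris

variable {Y : Type*}

/-- Events that are favoured by adding red (`true`) points and removing blue points. -/
def Incr (A : Set (Set (Y × Bool))) : Prop :=
  ∀ S S', S ∈ A → (∀ y, (y, true) ∈ S → (y, true) ∈ S') →
    (∀ y, (y, false) ∈ S' → (y, false) ∈ S) → S' ∈ A

lemma harris_pointwise {k : ℕ} (z : Fin k → Y × Bool) {A B : Set (Set (Y × Bool))} (hA : Incr A)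
    (hB : Incr B) :
    (Finset.univ.filter fun T : Finset (Fin k) =>
      z '' (T : Set (Fin k)) ∈ A ∧ z '' (T : Set (Fin k))ᶜ ∈ B).card ≤
    (Finset.univ.filter fun T : Finset (Fin k) => z '' (T : Set (Fin k)) ∈ A ∩ B).card := by
  set Bl : Finset (Fin k) := Finset.univ.filter fun i => (z i).2 = false with hBl
  have memBl : ∀ i, i ∈ Bl ↔ (z i).2 = false := fun i => by simp [hBl]
  let σ : Finset (Fin k) → Finset (Fin k) := fun U => symmDiff U Bl
  have σσ : ∀ U, σ (σ U) = U := fun U => symmDiff_symmDiff_cancel_right Bl U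
  let e : Finset (Fin k) ≃ Finset (Fin k) := ⟨σ, σ, σσ, σσ⟩
  let c : Finset (Fin k) ≃ Finset (Fin k) := ⟨compl, compl, compl_compl, compl_compl⟩
  have key : ∀ (C : Set (Set (Y × Bool))), Incr C → ∀ U U' : Finset (Fin k), U ⊆ U' →
      z '' (σ U : Set (Fin k)) ∈ C → z '' (σ U' : Set (Fin k)) ∈ C := by
    intro C hC U U' hU h
    refine hC _ _ h ?_ ?_
    · rintro y ⟨i, hi, hy⟩
      refine ⟨i, ?_, hy⟩
      have hb : i ∉ Bl := by rw [memBl, hy]; simp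
      simp only [σ, Finset.mem_coe, Finset.mem_symmDiff] at hi ⊢
      exact Or.inl ⟨hU (by tauto), hb⟩
    · rintro y ⟨i, hi, hy⟩
      refine ⟨i, ?_, hy⟩
      have hb : i ∈ Bl := by rw [memBl, hy]
      simp only [σ, Finset.mem_coe, Finset.mem_symmDiff] at hi ⊢
      exact Or.inr ⟨hb, fun h => by have := hU h; tauto⟩
  set 𝒜 := Finset.univ.filter fun U : Finset (Fin k) => z '' (σ U : Set (Fin k)) ∈ A with h𝒜
  set ℬ := Finset.univ.filter fun U : Finset (Fin k) => z '' (σ U : Set (Fin k)) ∈ B with hℬ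
  set ℬ' := Finset.univ.filter fun U : Finset (Fin k) => z '' (σ U : Set (Fin k))ᶜ ∈ B with hℬ'
  have σc : ∀ U, ((σ U : Finset (Fin k)) : Set (Fin k))ᶜ = (σ Uᶜ : Finset (Fin k)) := by
    intro U
    ext i
    simp only [σ, mem_compl_iff, Finset.mem_coe, Finset.mem_symmDiff, Finset.mem_compl]
    tauto
  have u1 : IsUpperSet (𝒜 : Set (Finset (Fin k))) := fun U U' hU h => by
    simp only [h𝒜, Finset.coe_filter, Finset.mem_univ, true_and, mem_ofPred_eq] at h ⊢
    exact key A hA U U' hU h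
  have u2 : IsUpperSet (ℬ : Set (Finset (Fin k))) := fun U U' hU h => by
    simp only [hℬ, Finset.coe_filter, Finset.mem_univ, true_and, mem_ofPred_eq] at h ⊢
    exact key B hB U U' hU h
  have u3 : IsLowerSet (ℬ' : Set (Finset (Fin k))) := fun U U' hU h => by
    simp only [hℬ', Finset.coe_filter, Finset.mem_univ, true_and, mem_ofPred_eq, σc] at h ⊢
    exact key B hB _ _ (Finset.compl_subset_compl.2 hU) h
  have hc : ℬ'.card = ℬ.card := by
    refine Finset.card_equiv c fun U => ?_
    simp [hℬ, hℬ', σc, c]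
  have i1 := u1.card_inter_le_finset u3
  have i2 := u1.le_card_inter_finset u2
  have e1 : (Finset.univ.filter fun T : Finset (Fin k) =>
      z '' (T : Set (Fin k)) ∈ A ∧ z '' (T : Set (Fin k))ᶜ ∈ B).card = (𝒜 ∩ ℬ').card := by
    refine Finset.card_equiv e fun U => ?_
    simp [h𝒜, hℬ', e, σσ]
  have e2 : (Finset.univ.filter fun T : Finset (Fin k) =>
      z '' (T : Set (Fin k)) ∈ A ∩ B).card = (𝒜 ∩ ℬ).card := by
    refine Finset.card_equiv e fun U => ?_
    simp [h𝒜, hℬ, e, σσ]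
  rw [e1, e2]
  rw [hc] at i1
  exact Nat.le_of_mul_le_mul_left (i1.trans i2) (by positivity)

variable [MeasurableSpace Y] (Λ : Measure (Y × Bool)) [IsFiniteMeasure Λ]

theorem poisson_harris {A B : Set (Set (Y × Bool))} (hA : Obs A) (hB : Obs B) (iA : Incr A)
    (iB : Incr B) :
    poisson Λ (pset ⁻¹' A) * poisson Λ (pset ⁻¹' B) ≤ poisson Λ (pset ⁻¹' (A ∩ B)) := by
  have h1 : egf Λ A * egf Λ B ≤ egf Λ (A ∩ B) * egf Λ univ := by
    rw [← tsum_split, ← tsum_split]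
    refine ENNReal.tsum_le_tsum fun k => ?_
    refine mul_le_mul' le_rfl ?_
    rw [sum_measure_eq_lintegral Λ hA hB, sum_measure_eq_lintegral Λ (hA.inter hB) obs_univ]
    refine lintegral_mono fun z => ?_
    have := harris_pointwise z iA iB
    simp only [mem_univ, and_true, Finset.sum_boole]
    exact_mod_cast this
  rw [poisson_apply _ hA, poisson_apply _ hB, poisson_apply _ (hA.inter hB)]
  set E := ENNReal.ofReal (Real.exp (-Λ.real univ)) with hE
  have h2 : E * egf Λ univ = 1 := by
    rw [egf_univ, hE, ← ENNReal.ofReal_mul (Real.exp_pos _).le, ← Real.exp_add]; simp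
  calc E * egf Λ A * (E * egf Λ B) = E * E * (egf Λ A * egf Λ B) := by ring
    _ ≤ E * E * (egf Λ (A ∩ B) * egf Λ univ) := by gcongr
    _ = E * egf Λ (A ∩ B) * (E * egf Λ univ) := by ring
    _ = _ := by rw [h2, mul_one]

/-- Observable events that are increasing in the red points. -/
structure RedEv (A : Set (Set (Y × Bool))) : Prop where
  obs : Obs A
  incr : Incr A

lemma Incr.inter {Y : Type*} {A B : Set (Set (Y × Bool))} (hA : Incr A) (hB : Incr B) : Incr
    (A ∩ B) :=
  fun S S' h h1 h2 => ⟨hA S S' h.1 h1 h2, hB S S' h.2 h1 h2⟩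

lemma Incr.union {Y : Type*} {A B : Set (Set (Y × Bool))} (hA : Incr A) (hB : Incr B) : Incr
    (A ∪ B) :=
  fun S S' h h1 h2 => h.imp (fun h => hA S S' h h1 h2) (fun h => hB S S' h h1 h2)

lemma RedEv.inter {A B : Set (Set (Y × Bool))} (hA : RedEv A) (hB : RedEv B) : RedEv (A ∩ B) :=
  ⟨hA.obs.inter hB.obs, hA.incr.inter hB.incr⟩

lemma RedEv.union {A B : Set (Set (Y × Bool))} (hA : RedEv A) (hB : RedEv B) : RedEv (A ∪ B) :=
  ⟨hA.obs.union hB.obs, hA.incr.union hB.incr⟩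

end Harris

section Pr

variable {X : Type*} [MeasurableSpace X] (Λ : Measure X)

/-- The probability of an event for the Poisson process. -/
noncomputable def pr (A : Set (Set X)) : ℝ := (poisson Λ).real (pset ⁻¹' A)

lemma pr_nonneg (A : Set (Set X)) : 0 ≤ pr Λ A := measureReal_nonneg

variable [IsFiniteMeasure Λ]

lemma pr_le_one (A : Set (Set X)) : pr Λ A ≤ 1 := measureReal_le_one

lemma pr_mono {A B : Set (Set X)} (h : A ⊆ B) : pr Λ A ≤ pr Λ B :=
  measureReal_mono (preimage_mono h)

lemma pr_univ : pr Λ univ = 1 := by simp [pr]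

lemma pr_union_le (A B : Set (Set X)) : pr Λ (A ∪ B) ≤ pr Λ A + pr Λ B := by
  rw [pr, preimage_union]
  exact measureReal_union_le _ _

lemma pr_le_add {A B C : Set (Set X)} (h : A ⊆ B ∪ C) : pr Λ A ≤ pr Λ B + pr Λ C :=
  (pr_mono Λ h).trans (pr_union_le Λ B C)

lemma pr_compl {A : Set (Set X)} (hA : Obs A) : pr Λ Aᶜ = 1 - pr Λ A := by
  rw [pr, preimage_compl, probReal_compl_eq_one_sub hA.measurableSet]; rfl

lemma pr_inter_add_diff {A B : Set (Set X)} (hB : Obs B) :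
    pr Λ (A ∩ B) + pr Λ (A \ B) = pr Λ A := by
  rw [pr, pr, pr, preimage_inter, preimage_sdiff]
  exact measureReal_inter_add_sdiff hB.measurableSet

lemma pr_add_disjoint {A B : Set (Set X)} (hB : Obs B) (h : Disjoint A B) :
    pr Λ (A ∪ B) = pr Λ A + pr Λ B := by
  rw [pr, preimage_union]
  exact measureReal_union (h.preimage _) hB.measurableSet

lemma pr_biUnion_le {ι : Type*} (s : Finset ι) (A : ι → Set (Set X)) :
    pr Λ (⋃ i ∈ s, A i) ≤ ∑ i ∈ s, pr Λ (A i) := by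
  rw [pr]
  simp only [preimage_iUnion]
  exact measureReal_biUnion_finset_le _ _

lemma pr_indep {W : Set X} (hW : MeasurableSet W) {A B : Set (Set X)} (hA : Obs A)
    (hB : Obs B) (hAW : Dep W A) (hBW : Dep Wᶜ B) : pr Λ (A ∩ B) = pr Λ A * pr Λ B := by
  simp only [pr, Measure.real]
  rw [poisson_indep Λ hW hA hB hAW hBW, ENNReal.toReal_mul]

lemma pr_restrict {W : Set X} (hW : MeasurableSet W) {A : Set (Set X)} (hA : Obs A)
    (hAW : Dep W A) : pr Λ A = pr (Λ.restrict W) A := by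
  simp only [pr, Measure.real]
  rw [poisson_restrict Λ hW hA hAW]

lemma pr_map {Y : Type*} [MeasurableSpace Y] (g : X → Y) (hg : Measurable g)
    {A : Set (Set Y)} (hA : Obs A) : pr (Λ.map g) A = pr Λ {S | g '' S ∈ A} := by
  simp only [pr, Measure.real]
  rw [poisson_map Λ g hg hA]

lemma pr_void {W : Set X} (hW : MeasurableSet W) :
    pr Λ {S | S ∩ W = ∅} = Real.exp (-Λ.real W) := by
  rw [pr, Measure.real, poisson_void Λ hW, ENNReal.toReal_ofReal (Real.exp_pos _).le]

end Pr

section Harris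

variable {Y : Type*} [MeasurableSpace Y] (Λ : Measure (Y × Bool)) [IsFiniteMeasure Λ]

theorem RedEv.mul_le {A B : Set (Set (Y × Bool))} (hA : RedEv A) (hB : RedEv B) :
    pr Λ A * pr Λ B ≤ pr Λ (A ∩ B) := by
  simp only [pr, Measure.real]
  rw [← ENNReal.toReal_mul]
  exact ENNReal.toReal_mono (measure_ne_top _ _)
    (poisson_harris Λ hA.obs hB.obs hA.incr hB.incr)

theorem RedEv.inter_le {A B : Set (Set (Y × Bool))} (hA : RedEv A) (hB : RedEv Bᶜ)
    (hB' : Obs B) : pr Λ (A ∩ B) ≤ pr Λ A * pr Λ B := by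
  have h1 := hA.mul_le Λ hB
  have h2 := pr_inter_add_diff Λ (A := A) hB'
  rw [pr_compl Λ hB'] at h1
  rw [sdiff_eq] at h2
  linarith

lemma RedEv.le_inter {A B : Set (Set (Y × Bool))} (hA : RedEv A) (hB : RedEv B) {a b : ℝ}
    (ha : a ≤ pr Λ A) (hb : b ≤ pr Λ B) (hb' : 0 ≤ b) :
    a * b ≤ pr Λ (A ∩ B) :=
  (mul_le_mul ha hb hb' (pr_nonneg _ _)).trans (hA.mul_le Λ hB)

end Harris

/-- Coloured points of the plane. -/
abbrev CPt := (ℝ × ℝ) × Bool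

/-- The points of the closed region of colour `b` of the Voronoi tiling of the coloured set `S`
that are within distance `m` of a point of that colour. -/
def Reg (m : ℝ) (S : Set CPt) (b : Bool) : Set (ℝ × ℝ) :=
  {p | ∃ x, (x, b) ∈ S ∧ sqDist p x ≤ m ^ 2 ∧ ∀ y, (y, !b) ∈ S → sqDist p x ≤ sqDist p y}

/-- Some path of colour `b` inside `D` connects `X` to `Y`. -/
def Conn (m : ℝ) (S : Set CPt) (b : Bool) (D X Y : Set (ℝ × ℝ)) : Prop :=
  ∃ x ∈ X, ∃ y ∈ Y, JoinedIn (Reg m S b ∩ D) x y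

/-- The connection event. -/
def Ev (m : ℝ) (b : Bool) (D X Y : Set (ℝ × ℝ)) : Set (Set CPt) := {S | Conn m S b D X Y}

lemma mem_Ev {m : ℝ} {b : Bool} {D X Y : Set (ℝ × ℝ)} {S : Set CPt} :
    S ∈ Ev m b D X Y ↔ Conn m S b D X Y := Iff.rfl

lemma continuous_sqDist : Continuous fun z : (ℝ × ℝ) × (ℝ × ℝ) => sqDist z.1 z.2 := by
  unfold sqDist; fun_prop

lemma sqDist_comm (p q : ℝ × ℝ) : sqDist p q = sqDist q p := by
  unfold sqDist; ring

lemma sqDist_nonneg (p q : ℝ × ℝ) : 0 ≤ sqDist p q := by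
  unfold sqDist; positivity

lemma Reg.mono {m m' : ℝ} (hm : 0 ≤ m) (hmm : m ≤ m') {S S' : Set CPt} {b : Bool}
    (h1 : ∀ x, (x, b) ∈ S → (x, b) ∈ S') (h2 : ∀ x, (x, !b) ∈ S' → (x, !b) ∈ S) :
    Reg m S b ⊆ Reg m' S' b := fun _ ⟨x, hx, hxm, h⟩ =>
  ⟨x, h1 x hx, hxm.trans (pow_le_pow_left₀ hm hmm 2), fun y hy => h y (h2 y hy)⟩

lemma Reg.mono_set {m : ℝ} {S S' : Set CPt} {b : Bool}
    (h1 : ∀ x, (x, b) ∈ S → (x, b) ∈ S') (h2 : ∀ x, (x, !b) ∈ S' → (x, !b) ∈ S) :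
    Reg m S b ⊆ Reg m S' b := fun _ ⟨x, hx, hxm, h⟩ =>
  ⟨x, h1 x hx, hxm, fun y hy => h y (h2 y hy)⟩

lemma Conn.mono {m m' : ℝ} {S S' : Set CPt} {b b' : Bool} {D D' X X' Y Y' : Set (ℝ × ℝ)}
    (h : Conn m S b D X Y) (hD : Reg m S b ∩ D ⊆ Reg m' S' b' ∩ D') (hX : X ⊆ X') (hY : Y ⊆ Y') :
    Conn m' S' b' D' X' Y' := by
  obtain ⟨x, hx, y, hy, hj⟩ := h
  exact ⟨x, hX hx, y, hY hy, hj.mono hD⟩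

lemma Conn.mono_set {m m' : ℝ} (hm : 0 ≤ m) (hmm : m ≤ m') {S : Set CPt} {b : Bool}
    {D D' X X' Y Y' : Set (ℝ × ℝ)} (h : Conn m S b D X Y) (hD : D ⊆ D') (hX : X ⊆ X')
    (hY : Y ⊆ Y') : Conn m' S b D' X' Y' :=
  h.mono (inter_subset_inter (Reg.mono hm hmm (fun _ h => h) fun _ h => h) hD) hX hY

lemma Conn.symm {m : ℝ} {S : Set CPt} {b : Bool} {D X Y : Set (ℝ × ℝ)} (h : Conn m S b D X Y) :
    Conn m S b D Y X := by
  obtain ⟨x, hx, y, hy, hj⟩ := h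
  exact ⟨y, hy, x, hx, hj.symm⟩

lemma incr_Ev (m : ℝ) (D X Y : Set (ℝ × ℝ)) : Incr (Ev m true D X Y) := fun _ _ h h1 h2 =>
  Conn.mono h (inter_subset_inter_left _ (Reg.mono_set h1 h2)) Subset.rfl Subset.rfl

lemma incr_Ev_compl (m : ℝ) (D X Y : Set (ℝ × ℝ)) : Incr (Ev m false D X Y)ᶜ :=
  fun _ _ h h1 h2 h' =>
    h (Conn.mono h' (inter_subset_inter_left _ (Reg.mono_set h2 h1)) Subset.rfl Subset.rfl)

/-- The convex pieces of the region of colour `b`. -/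
def piece (m : ℝ) {k : ℕ} (z : Fin k → CPt) (b : Bool) (i : Fin k) : Set (ℝ × ℝ) :=
  {p | (z i).2 = b ∧ sqDist p (z i).1 ≤ m ^ 2 ∧
    ∀ j, (z j).2 ≠ (!b) ∨ sqDist p (z i).1 ≤ sqDist p (z j).1}

lemma Reg_eq_piece (m : ℝ) {k : ℕ} (z : Fin k → CPt) (b : Bool) :
    Reg m (range z) b = ⋃ i, piece m z b i := by
  ext p
  rw [mem_iUnion]
  constructor
  · rintro ⟨x, ⟨i, hi⟩, hxm, h⟩
    refine ⟨i, by rw [hi], by rwa [hi], fun j => ?_⟩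
    by_cases hj : (z j).2 = !b
    · right
      rw [hi]
      exact h _ ⟨j, Prod.ext rfl hj⟩
    · exact Or.inl hj
  · rintro ⟨i, hb, hm, h⟩
    refine ⟨(z i).1, ⟨i, Prod.ext rfl hb⟩, hm, ?_⟩
    rintro y ⟨j, hj⟩
    rcases h j with h | h
    · exact absurd (by rw [hj]) h
    · rwa [hj] at h

lemma sqDist_le_iff (p x y : ℝ × ℝ) : sqDist p x ≤ sqDist p y ↔
    2 * (y.1 - x.1) * p.1 + 2 * (y.2 - x.2) * p.2 ≤ y.1 ^ 2 + y.2 ^ 2 - x.1 ^ 2 - x.2 ^ 2 := by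
  unfold sqDist
  constructor <;> intro h <;> nlinarith

lemma isClosed_piece_graph (m : ℝ) (k : ℕ) (b : Bool) (i : Fin k) :
    IsClosed {w : (Fin k → CPt) × (ℝ × ℝ) | w.2 ∈ piece m w.1 b i} := by
  have hc : ∀ (i : Fin k) (T : Set Bool),
      IsClosed {w : (Fin k → CPt) × (ℝ × ℝ) | (w.1 i).2 ∈ T} := fun i T =>
    (isClosed_discrete T).preimage (by fun_prop)
  have hf : ∀ j : Fin k, Continuous fun w : (Fin k → CPt) × (ℝ × ℝ) =>
      sqDist w.2 (w.1 j).1 := fun j =>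
    continuous_sqDist.comp (f := fun w : (Fin k → CPt) × (ℝ × ℝ) => (w.2, (w.1 j).1))
      (by fun_prop)
  have : {w : (Fin k → CPt) × (ℝ × ℝ) | w.2 ∈ piece m w.1 b i} =
      {w | (w.1 i).2 ∈ ({b} : Set Bool)} ∩ ({w | sqDist w.2 (w.1 i).1 ≤ m ^ 2} ∩
        ⋂ j, ({w | (w.1 j).2 ∈ ({!b}ᶜ : Set Bool)} ∪
          {w | sqDist w.2 (w.1 i).1 ≤ sqDist w.2 (w.1 j).1})) := by
    ext w; simp [piece]
  rw [this]
  exact (hc i _).inter ((isClosed_le (hf i) continuous_const).inter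
    (isClosed_iInter fun j => (hc j _).union (isClosed_le (hf i) (hf j))))

lemma isClosed_piece (m : ℝ) {k : ℕ} (z : Fin k → CPt) (b : Bool) (i : Fin k) :
    IsClosed (piece m z b i) :=
  (isClosed_piece_graph m k b i).preimage (f := fun p : ℝ × ℝ => (z, p)) (by fun_prop)

lemma convex_piece (m : ℝ) {k : ℕ} (z : Fin k → CPt) (b : Bool) (i : Fin k) :
    Convex ℝ (piece m z b i) := by
  intro x hx y hy a c ha hc hac
  have e : c = 1 - a := by linarith
  subst e
  refine ⟨hx.1, ?_, fun j => ?_⟩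
  · have h1 := hx.2.1
    have h2 := hy.2.1
    unfold sqDist at h1 h2 ⊢
    simp only [Prod.fst_add, Prod.smul_fst, smul_eq_mul, Prod.snd_add, Prod.smul_snd]
    nlinarith [mul_le_mul_of_nonneg_left h1 ha, mul_le_mul_of_nonneg_left h2 hc,
      mul_nonneg (mul_nonneg ha hc) (sq_nonneg (x.1 - y.1)),
      mul_nonneg (mul_nonneg ha hc) (sq_nonneg (x.2 - y.2))]
  · rcases hx.2.2 j with h | h
    · exact Or.inl h
    rcases hy.2.2 j with h' | h'
    · exact Or.inl h'
    right
    rw [sqDist_le_iff] at h h' ⊢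
    simp only [Prod.fst_add, Prod.smul_fst, smul_eq_mul, Prod.snd_add, Prod.smul_snd]
    nlinarith [mul_le_mul_of_nonneg_left h ha, mul_le_mul_of_nonneg_left h' hc]

lemma conn_iff_chain (m : ℝ) {k : ℕ} (z : Fin k → CPt) (b : Bool) {D X Y : Set (ℝ × ℝ)}
    (hD : IsClosed D) (hDc : Convex ℝ D) :
    Conn m (range z) b D X Y ↔ ∃ i j, (piece m z b i ∩ D ∩ X).Nonempty ∧
      (piece m z b j ∩ D ∩ Y).Nonempty ∧
      Relation.ReflTransGen (Meets fun o => piece m z b o ∩ D) i j := by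
  have hU : Reg m (range z) b ∩ D = ⋃ o, piece m z b o ∩ D := by
    rw [Reg_eq_piece, iUnion_inter]
  rw [Conn, hU]
  constructor
  · rintro ⟨x, hx, y, hy, h⟩
    obtain ⟨i, j, hi, hj, hc⟩ := chain_of_joinedIn (fun o => (isClosed_piece m z b o).inter hD) h
    exact ⟨i, j, ⟨x, hi, hx⟩, ⟨y, hj, hy⟩, hc⟩
  · rintro ⟨i, j, ⟨x, hi, hx⟩, ⟨y, hj, hy⟩, hc⟩
    exact ⟨x, hx, y, hy, joinedIn_of_chain (fun o => (convex_piece m z b o).inter hDc) hc hi hj⟩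

lemma isClosed_exists_compact {A : Type*} [TopologicalSpace A] {D : Set (ℝ × ℝ)}
    (hD : IsCompact D) {C : Set (A × (ℝ × ℝ))} (hC : IsClosed C) :
    IsClosed {a | ∃ p ∈ D, (a, p) ∈ C} := by
  have : CompactSpace D := isCompact_iff_compactSpace.1 hD
  have h1 : IsClosed ((fun w : A × D => (w.1, (w.2 : ℝ × ℝ))) ⁻¹' C) :=
    hC.preimage (by fun_prop)
  have h2 := (isClosedMap_fst_of_compactSpace (X := A) (Y := D)) _ h1
  convert h2 using 1
  ext a
  simp

theorem obs_Ev (m : ℝ) (b : Bool) {D X Y : Set (ℝ × ℝ)} (hD : IsCompact D) (hDc : Convex ℝ D)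
    (hX : IsClosed X) (hY : IsClosed Y) : Obs (Ev m b D X Y) := fun k => by
  have e1 : ∀ (i : Fin k) (X : Set (ℝ × ℝ)), IsClosed X →
      MeasurableSet {z : Fin k → CPt | (piece m z b i ∩ D ∩ X).Nonempty} := by
    intro i X hX
    have := isClosed_exists_compact hD (A := Fin k → CPt)
      ((isClosed_piece_graph m k b i).inter (hX.preimage continuous_snd))
    convert this.measurableSet using 1
    ext z
    simp only [mem_ofPred_eq, Set.Nonempty, mem_inter_iff, mem_preimage]
    exact exists_congr fun p => by tauto
  have e2 : ∀ i j : Fin k,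
      MeasurableSet {z : Fin k → CPt | Meets (fun o => piece m z b o ∩ D) i j} := by
    intro i j
    have := isClosed_exists_compact hD (A := Fin k → CPt)
      ((isClosed_piece_graph m k b i).inter (isClosed_piece_graph m k b j))
    convert this.measurableSet using 1
    ext z
    simp only [mem_ofPred_eq, Meets, Set.Nonempty, mem_inter_iff]
    exact exists_congr fun p => by tauto
  have e3 : ∀ i j : Fin k, MeasurableSet {z : Fin k → CPt |
      Relation.ReflTransGen (Meets fun o => piece m z b o ∩ D) i j} := by
    intro i j
    have : {z : Fin k → CPt | Relation.ReflTransGen (Meets fun o => piece m z b o ∩ D) i j} =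
        ⋃ r ∈ {r : Fin k → Fin k → Prop | Relation.ReflTransGen r i j},
          ⋂ p : Fin k × Fin k,
            {z | r p.1 p.2 → Meets (fun o => piece m z b o ∩ D) p.1 p.2} := by
      ext z
      simp only [mem_ofPred_eq, mem_iUnion, mem_iInter, exists_prop]
      constructor
      · intro h
        exact ⟨_, h, fun _ h => h⟩
      · rintro ⟨r, hr, h⟩
        exact Relation.ReflTransGen.mono (fun a b hab => h (a, b) hab) _ _ hr
    rw [this]
    refine MeasurableSet.biUnion (Set.toFinite _).countable fun r _ => ?_
    refine MeasurableSet.iInter fun p => ?_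
    by_cases hr : r p.1 p.2
    · simpa [hr] using e2 p.1 p.2
    · simp [hr]
  have : {z : Fin k → CPt | range z ∈ Ev m b D X Y} =
      ⋃ i, ⋃ j, {z : Fin k → CPt | (piece m z b i ∩ D ∩ X).Nonempty} ∩
        ({z : Fin k → CPt | (piece m z b j ∩ D ∩ Y).Nonempty} ∩
        {z : Fin k → CPt | Relation.ReflTransGen (Meets fun o => piece m z b o ∩ D) i j}) := by
    ext z
    simp only [mem_ofPred_eq, mem_Ev, conn_iff_chain m z b hD.isClosed hDc, mem_iUnion,
        mem_inter_iff]
  rw [this]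
  exact MeasurableSet.iUnion fun i => MeasurableSet.iUnion fun j =>
    (e1 i X hX).inter ((e1 j Y hY).inter (e3 i j))

/-- The closed neighbourhood of radius `m`. -/
def nb (m : ℝ) (D : Set (ℝ × ℝ)) : Set (ℝ × ℝ) := {p | ∃ q ∈ D, sqDist p q ≤ m ^ 2}

/-- Every point of `D` has a point of `S` within distance `m`. -/
def Cov (m : ℝ) (D : Set (ℝ × ℝ)) : Set (Set CPt) :=
  {S | ∀ p ∈ D, ∃ s ∈ S, sqDist p s.1 ≤ m ^ 2}

lemma Reg_local (m : ℝ) (S : Set CPt) (D : Set (ℝ × ℝ)) (b : Bool) :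
    Reg m S b ∩ D = Reg m (S ∩ nb m D ×ˢ univ) b ∩ D := by
  ext p
  refine ⟨fun ⟨⟨x, hx, hm, h⟩, hp⟩ => ⟨⟨x, ⟨hx, mk_mem_prod ⟨p, hp, ?_⟩ (mem_univ _)⟩, hm,
    fun y hy => h y hy.1⟩, hp⟩, fun ⟨⟨x, hx, hm, h⟩, hp⟩ => ⟨⟨x, hx.1, hm, fun y hy => ?_⟩, hp⟩⟩
  · rwa [sqDist_comm]
  · by_cases hy' : sqDist p y ≤ m ^ 2
    · exact h y ⟨hy, mk_mem_prod ⟨p, hp, by rwa [sqDist_comm]⟩ (mem_univ _)⟩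
    · exact hm.trans (not_le.1 hy').le

lemma dep_Ev (m : ℝ) (b : Bool) (D X Y : Set (ℝ × ℝ)) :
    Dep (nb m D ×ˢ univ) (Ev m b D X Y) := fun S => by
  rw [mem_Ev, mem_Ev, Conn, Conn, Reg_local]

lemma Reg_cover {S : Set CPt} (hS : S.Finite) {m : ℝ} {D : Set (ℝ × ℝ)} (hC : S ∈ Cov m D)
    {p : ℝ × ℝ} (hp : p ∈ D) (b : Bool) : p ∈ Reg m S b ∪ Reg m S (!b) := by
  obtain ⟨s', hs', hps'⟩ := hC p hp
  obtain ⟨⟨x, c⟩, hs, hmin⟩ := hS.exists_minimalFor (fun s : CPt => sqDist p s.1) _ ⟨s', hs'⟩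
  have hmin' : ∀ s ∈ S, sqDist p x ≤ sqDist p s.1 := fun s hs => by
    by_contra h
    push Not at h
    exact absurd (hmin hs h.le) (not_le.2 h)
  have : p ∈ Reg m S c := ⟨x, hs, (hmin' _ hs').trans hps', fun y hy => hmin' _ hy⟩
  cases b <;> cases c <;> simp [this]

lemma exists_range_of_finite {X : Type*} {S : Set X} (hS : S.Finite) :
    ∃ (k : ℕ) (z : Fin k → X), range z = S := by
  obtain ⟨k, z, hz⟩ := hS.fin_embedding
  exact ⟨k, z, hz⟩

/-- In a continuously parametrized quadrilateral either the left side is connected to the right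
side by a path of one colour or the top side to the bottom side by a path of the other colour. -/
theorem conn_or_conn {S : Set CPt} (hS : S.Finite) {φ : ℝ × ℝ → ℝ × ℝ} (hφ : Continuous φ)
    {m : ℝ} {D : Set (ℝ × ℝ)} (hD : IsClosed D) (hDc : Convex ℝ D) (hC : S ∈ Cov m D)
    (hφD : ∀ s ∈ Icc (0 : ℝ) 1, ∀ t ∈ Icc (0 : ℝ) 1, φ (s, t) ∈ D) (b : Bool) :
    (∃ t ∈ Icc (0 : ℝ) 1, ∃ t' ∈ Icc (0 : ℝ) 1,
      JoinedIn (Reg m S b ∩ D) (φ (0, t)) (φ (1, t'))) ∨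
    (∃ s ∈ Icc (0 : ℝ) 1, ∃ s' ∈ Icc (0 : ℝ) 1,
      JoinedIn (Reg m S (!b) ∩ D) (φ (s, 0)) (φ (s', 1))) := by
  obtain ⟨k, z, rfl⟩ := exists_range_of_finite hS
  have hU : ∀ b, Reg m (range z) b ∩ D = ⋃ o, piece m z b o ∩ D := fun b => by
    rw [Reg_eq_piece, iUnion_inter]
  rw [hU, hU]
  refine exists_crossing (fun o => (isClosed_piece m z _ o).inter hD)
    (fun o => (convex_piece m z _ o).inter hDc) (fun o => (isClosed_piece m z _ o).inter hD)
    (fun o => (convex_piece m z _ o).inter hDc) hφ ?_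
  intro s hs t ht
  rw [← hU, ← hU, ← union_inter_distrib_right]
  exact ⟨Reg_cover (finite_range z) hC (hφD s hs t ht) b, hφD s hs t ht⟩

lemma isCompact_rect (a b c d : ℝ) : IsCompact (rect a b c d) := isCompact_Icc.prod isCompact_Icc

lemma convex_rect (a b c d : ℝ) : Convex ℝ (rect a b c d) := (convex_Icc a b).prod (convex_Icc c d)

lemma isClosed_rect (a b c d : ℝ) : IsClosed (rect a b c d) := (isCompact_rect a b c d).isClosed

theorem conn_rect_or {S : Set CPt} (hS : S.Finite) {m a b c d : ℝ} (hab : a ≤ b) (hcd : c ≤ d)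
    (hC : S ∈ Cov m (rect a b c d)) (col : Bool) :
    Conn m S col (rect a b c d) (rect a a c d) (rect b b c d) ∨
      Conn m S (!col) (rect a b c d) (rect a b c c) (rect a b d d) := by
  have h1 : ∀ s ∈ Icc (0 : ℝ) 1, a ≤ a + s * (b - a) ∧ a + s * (b - a) ≤ b := fun s hs =>
    ⟨by nlinarith [hs.1], by nlinarith [hs.2]⟩
  have h2 : ∀ s ∈ Icc (0 : ℝ) 1, c ≤ c + s * (d - c) ∧ c + s * (d - c) ≤ d := fun s hs =>
    ⟨by nlinarith [hs.1], by nlinarith [hs.2]⟩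
  rcases conn_or_conn hS (φ := fun w => (a + w.1 * (b - a), c + w.2 * (d - c))) (by fun_prop)
    (isClosed_rect a b c d) (convex_rect a b c d) hC (fun s hs t ht => ⟨h1 s hs, h2 t ht⟩) col with
    ⟨t, ht, t', ht', h⟩ | ⟨t, ht, t', ht', h⟩
  · left
    exact ⟨_, mem_rect.2 ⟨by simp, h2 t ht⟩, _, mem_rect.2 ⟨by simp, h2 t' ht'⟩, h⟩
  · right
    exact ⟨_, mem_rect.2 ⟨h1 t ht, by simp⟩, _, mem_rect.2 ⟨h1 t' ht', by simp⟩, h⟩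

lemma conn_iff {m : ℝ} {S : Set CPt} {b : Bool} {D X Y : Set (ℝ × ℝ)} : Conn m S b D X Y ↔
    ∃ K, IsPathConnected K ∧ K ⊆ Reg m S b ∧ K ⊆ D ∧ (K ∩ X).Nonempty ∧ (K ∩ Y).Nonempty := by
  constructor
  · rintro ⟨x, hx, y, hy, h⟩
    exact ⟨pathComponentIn (Reg m S b ∩ D) x, isPathConnected_pathComponentIn h.source_mem,
      fun p hp => hp.target_mem.1, fun p hp => hp.target_mem.2,
      ⟨x, JoinedIn.refl h.source_mem, hx⟩, ⟨y, h, hy⟩⟩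
  · rintro ⟨K, hK, h1, h2, ⟨x, hx, hxX⟩, ⟨y, hy, hyY⟩⟩
    exact ⟨x, hxX, y, hyY, (hK.joinedIn x hx y hy).mono (subset_inter h1 h2)⟩

lemma isPathConnected_image_Icc {γ : ℝ → ℝ × ℝ} (hγ : Continuous γ) {s t : ℝ} (hst : s ≤ t) :
    IsPathConnected (γ '' Icc s t) :=
  ((convex_Icc s t).isPathConnected ⟨s, left_mem_Icc.2 hst⟩).image hγ

/-- A path between two levels of a continuous function has a subpath that stays between these
levels. -/
lemma exists_strip {K : Set (ℝ × ℝ)} (hK : IsPathConnected K) {f : ℝ × ℝ → ℝ} (hf : Continuous f)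
    {a b : ℝ} (hab : a ≤ b) {x y : ℝ × ℝ} (hx : x ∈ K) (hy : y ∈ K) (hxa : f x ≤ a)
    (hby : b ≤ f y) :
    ∃ K' ⊆ K, IsPathConnected K' ∧ (∀ p ∈ K', a ≤ f p ∧ f p ≤ b) ∧ (∃ p ∈ K', f p = a) ∧
      ∃ p ∈ K', f p = b := by
  obtain ⟨γ, hγ⟩ := hK.joinedIn x hx y hy
  set g : ℝ → ℝ × ℝ := ⇑γ.extend with hg
  have hgc : Continuous g := γ.extend.continuous
  have hgK : ∀ t ∈ Icc (0 : ℝ) 1, g t ∈ K := fun t ht => by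
    rw [hg, γ.extend_apply ht]; exact hγ _
  have g0 : g 0 = x := γ.extend_zero
  have g1 : g 1 = y := γ.extend_one
  have hfg : Continuous fun t => f (g t) := hf.comp hgc
  obtain ⟨t, ⟨⟨ht0, htb⟩, htmin⟩⟩ := (isCompact_Icc.inter_right
    (isClosed_le continuous_const hfg : IsClosed {t | b ≤ f (g t)}) :
      IsCompact (Icc (0 : ℝ) 1 ∩ {t | b ≤ f (g t)})).exists_isLeast
      ⟨1, right_mem_Icc.2 zero_le_one, by simpa [g1] using hby⟩
  have hlt : ∀ u ∈ Ico 0 t, f (g u) < b := fun u hu => by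
    by_contra h
    push Not at h
    exact absurd (htmin ⟨⟨hu.1, hu.2.le.trans ht0.2⟩, h⟩) (not_le.2 hu.2)
  have hle : ∀ u ∈ Icc 0 t, f (g u) ≤ b := by
    have hcl : IsClosed {u | f (g u) ≤ b} := isClosed_le hfg continuous_const
    rcases eq_or_lt_of_le ht0.1 with h | h
    · intro u hu
      have hu0 : u = 0 := by linarith [hu.1, hu.2]
      rw [hu0, g0]; linarith
    · rw [← closure_Ico h.ne]
      exact hcl.closure_subset_iff.2 fun u hu => (hlt u hu).le
  obtain ⟨s, ⟨⟨hs0, hsa⟩, hsmax⟩⟩ := (isCompact_Icc.inter_right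
    (isClosed_le hfg continuous_const : IsClosed {t | f (g t) ≤ a}) :
      IsCompact (Icc (0 : ℝ) t ∩ {t | f (g t) ≤ a})).exists_isGreatest
      ⟨0, left_mem_Icc.2 ht0.1, by simpa [g0] using hxa⟩
  have hgt : ∀ u ∈ Ioc s t, a < f (g u) := fun u hu => by
    by_contra h
    push Not at h
    exact absurd (hsmax ⟨⟨hs0.1.trans hu.1.le, hu.2⟩, h⟩) (not_le.2 hu.1)
  have hge : ∀ u ∈ Icc s t, a ≤ f (g u) := by
    have hcl : IsClosed {u | a ≤ f (g u)} := isClosed_le continuous_const hfg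
    rcases eq_or_lt_of_le hs0.2 with h | h
    · intro u hu
      have hu0 : u = t := by linarith [hu.1, hu.2]
      rw [hu0]
      exact hab.trans htb
    · rw [← closure_Ioc h.ne]
      exact hcl.closure_subset_iff.2 fun u hu => (hgt u hu).le
  refine ⟨g '' Icc s t, ?_, isPathConnected_image_Icc hgc hs0.2, ?_, ?_, ?_⟩
  · rintro _ ⟨u, hu, rfl⟩
    exact hgK u ⟨hs0.1.trans hu.1, hu.2.trans ht0.2⟩
  · rintro _ ⟨u, hu, rfl⟩
    exact ⟨hge u hu, hle u ⟨hs0.1.trans hu.1, hu.2⟩⟩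
  · exact ⟨g s, ⟨s, left_mem_Icc.2 hs0.2, rfl⟩, le_antisymm hsa (hge s (left_mem_Icc.2 hs0.2))⟩
  · exact ⟨g t, ⟨t, right_mem_Icc.2 hs0.2, rfl⟩, le_antisymm (hle t (right_mem_Icc.2 ht0.1)) htb⟩

/-- A path that leaves a rectangle has an initial part that stops on its boundary. -/
lemma exists_exit {K : Set (ℝ × ℝ)} (hK : IsPathConnected K) {A₁ A₂ B₁ B₂ : ℝ} {x y : ℝ × ℝ}
    (hx : x ∈ K) (hy : y ∈ K) (hxD : x ∈ rect A₁ A₂ B₁ B₂)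
    (hyD : y.1 ≤ A₁ ∨ A₂ ≤ y.1 ∨ y.2 ≤ B₁ ∨ B₂ ≤ y.2) :
    ∃ K' ⊆ K, IsPathConnected K' ∧ K' ⊆ rect A₁ A₂ B₁ B₂ ∧ x ∈ K' ∧
      ∃ p ∈ K', p.1 = A₁ ∨ p.1 = A₂ ∨ p.2 = B₁ ∨ p.2 = B₂ := by
  let f : ℝ × ℝ → ℝ := fun p => max (max (A₁ - p.1) (p.1 - A₂)) (max (B₁ - p.2) (p.2 - B₂))
  have hf : Continuous f := by fun_prop
  have hle : ∀ p, f p ≤ 0 ↔ p ∈ rect A₁ A₂ B₁ B₂ := fun p => by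
    simp only [f, max_le_iff, mem_rect, sub_nonpos]
  have hge : ∀ p, 0 ≤ f p ↔ p.1 ≤ A₁ ∨ A₂ ≤ p.1 ∨ p.2 ≤ B₁ ∨ B₂ ≤ p.2 := fun p => by
    simp only [f, le_max_iff, sub_nonneg, or_assoc]
  have hx0 := (hle x).2 hxD
  obtain ⟨K₀, hK₀, hp₀, h₀, hx₀, w', hw', hwE⟩ : ∃ K₀ ⊆ K, IsPathConnected K₀ ∧
      (∀ p ∈ K₀, f p ≤ 0) ∧ x ∈ K₀ ∧ ∃ p ∈ K₀, f p = 0 := by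
    obtain ⟨γ, hγ⟩ := hK.joinedIn x hx y hy
    set g : ℝ → ℝ × ℝ := ⇑γ.extend with hg
    have hgc : Continuous g := γ.extend.continuous
    have hfg : Continuous fun t => f (g t) := hf.comp hgc
    obtain ⟨t, ⟨⟨ht0, htb⟩, htmin⟩⟩ := (isCompact_Icc.inter_right
      (isClosed_le continuous_const hfg : IsClosed {t | 0 ≤ f (g t)}) :
        IsCompact (Icc (0 : ℝ) 1 ∩ {t | 0 ≤ f (g t)})).exists_isLeast
        ⟨1, right_mem_Icc.2 zero_le_one, by
          rw [mem_ofPred_eq, hg, γ.extend_one]; exact (hge y).2 hyD⟩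
    have hlt : ∀ u ∈ Icc 0 t, f (g u) ≤ 0 := by
      have hcl : IsClosed {u | f (g u) ≤ 0} := isClosed_le hfg continuous_const
      rcases eq_or_lt_of_le ht0.1 with h | h
      · intro u hu
        have hu0 : u = 0 := by linarith [hu.1, hu.2]
        rw [hu0, hg, γ.extend_zero]; exact hx0
      · rw [← closure_Ico h.ne]
        refine hcl.closure_subset_iff.2 fun u hu => ?_
        by_contra h
        simp only [mem_ofPred_eq, not_le] at h
        exact absurd (htmin ⟨⟨hu.1, hu.2.le.trans ht0.2⟩, h.le⟩) (not_le.2 hu.2)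
    refine ⟨g '' Icc 0 t, ?_, isPathConnected_image_Icc hgc ht0.1, ?_, ?_, ?_⟩
    · rintro _ ⟨u, hu, rfl⟩
      rw [hg, γ.extend_apply ⟨hu.1, hu.2.trans ht0.2⟩]; exact hγ _
    · rintro _ ⟨u, hu, rfl⟩
      exact hlt u hu
    · exact ⟨0, left_mem_Icc.2 ht0.1, γ.extend_zero⟩
    · exact ⟨g t, ⟨t, right_mem_Icc.2 ht0.1, rfl⟩, le_antisymm (hlt t (right_mem_Icc.2 ht0.1)) htb⟩
  refine ⟨K₀, hK₀, hp₀, fun p hp => (hle p).1 (h₀ p hp), hx₀, w', hw', ?_⟩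
  have h1 := mem_rect.1 ((hle w').1 (h₀ w' hw'))
  rcases (hge w').1 hwE.ge with h | h | h | h
  · exact Or.inl (le_antisymm h h1.1.1)
  · exact Or.inr (Or.inl (le_antisymm h1.1.2 h))
  · exact Or.inr (Or.inr (Or.inl (le_antisymm h h1.2.1)))
  · exact Or.inr (Or.inr (Or.inr (le_antisymm h1.2.2 h)))

/-- A measurable domain of finite area. -/
structure Dom where
  s : Set (ℝ × ℝ)
  meas : MeasurableSet s
  fin : volume s ≠ ∞

/-- The intensity of the coloured process on a domain: `lam` points of each colour per unit area. -/
noncomputable def Lam (lam : ℝ≥0) (R : Dom) : Measure CPt :=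
  ((lam : ℝ≥0∞) • volume.restrict R.s).prod Measure.count

instance (lam : ℝ≥0) (R : Dom) : IsFiniteMeasure ((lam : ℝ≥0∞) • volume.restrict R.s) := ⟨by
  rw [Measure.smul_apply, smul_eq_mul, Measure.restrict_apply_univ]
  exact ENNReal.mul_lt_top ENNReal.coe_lt_top (lt_top_iff_ne_top.2 R.fin)⟩

instance (lam : ℝ≥0) (R : Dom) : IsFiniteMeasure (Lam lam R) := by
  unfold Lam; infer_instance

/-- The part of a domain inside a measurable set. -/
def Dom.inter (R : Dom) (W : Set (ℝ × ℝ)) (hW : MeasurableSet W) : Dom :=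
  ⟨R.s ∩ W, R.meas.inter hW, ne_top_of_le_ne_top R.fin (measure_mono inter_subset_left)⟩

lemma Lam_restrict (lam : ℝ≥0) (R : Dom) {W : Set (ℝ × ℝ)} (hW : MeasurableSet W) :
    (Lam lam R).restrict (W ×ˢ univ) = Lam lam (R.inter W hW) := by
  rw [Lam, Lam, ← Measure.prod_restrict, Measure.restrict_univ, Measure.restrict_smul,
    Measure.restrict_restrict hW, inter_comm]
  rfl

lemma Lam_real (lam : ℝ≥0) (R : Dom) {W : Set (ℝ × ℝ)} (hW : MeasurableSet W) (hWR : W ⊆ R.s)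
    (b : Bool) : (Lam lam R).real (W ×ˢ {b}) = lam * volume.real W := by
  have h2 : Measure.count ({b} : Set Bool) = 1 := Measure.count_singleton b
  rw [Measure.real, Lam, Measure.prod_prod, Measure.smul_apply, smul_eq_mul,
    Measure.restrict_apply hW, inter_eq_left.2 hWR, h2]
  simp only [ENNReal.toReal_mul, ENNReal.coe_toReal, ENNReal.toReal_one, Measure.real]
  ring

lemma volume_rect {a b c d : ℝ} (hab : a ≤ b) (hcd : c ≤ d) :
    volume.real (rect a b c d) = (b - a) * (d - c) := by
  rw [Measure.real, rect, Measure.volume_eq_prod, Measure.prod_prod, Real.volume_Icc,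
    Real.volume_Icc, ENNReal.toReal_mul, ENNReal.toReal_ofReal (by linarith),
    ENNReal.toReal_ofReal (by linarith)]

lemma measurableSet_rect (a b c d : ℝ) : MeasurableSet (rect a b c d) :=
  (isClosed_rect a b c d).measurableSet

/-! ### Neighbourhoods -/

lemma nb_rect_subset {m a b c d : ℝ} (hm : 0 ≤ m) :
    nb m (rect a b c d) ⊆ rect (a - m) (b + m) (c - m) (d + m) := fun p ⟨q, hq, hpq⟩ => by
  rw [mem_rect] at hq ⊢
  unfold sqDist at hpq
  have h1 := abs_le_of_sq_le_sq' (a := p.1 - q.1) (b := m) (by nlinarith [sq_nonneg (p.2 - q.2)]) hm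
  have h2 := abs_le_of_sq_le_sq' (a := p.2 - q.2) (b := m) (by nlinarith [sq_nonneg (p.1 - q.1)]) hm
  refine ⟨⟨?_, ?_⟩, ?_, ?_⟩ <;> linarith [h1.1, h1.2, h2.1, h2.2]

lemma dep_mono {W W' : Set CPt} (h : W ⊆ W') {A : Set (Set CPt)} (hA : Dep W A) : Dep W' A :=
  fun S => by rw [hA S, hA (S ∩ W'), inter_assoc, inter_eq_right.2 h]

/-! ### Covering -/

lemma exists_tiles {w m : ℝ} (hm : 0 < m) (hw : m ≤ w) : ∃ (N : ℕ) (u : ℝ), m / 3 ≤ u ∧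
    u ≤ m / 2 ∧ N * u = w ∧ (N : ℝ) ≤ 3 * w / m ∧
    ∀ x, 0 ≤ x → x ≤ w → ∃ i < N, (i : ℝ) * u ≤ x ∧ x ≤ (i + 1) * u := by
  set N := ⌈2 * w / m⌉₊ with hN
  have h1 : 2 * w / m ≤ N := Nat.le_ceil _
  have hw0 : 0 < w := by linarith
  have h2 : (N : ℝ) < 2 * w / m + 1 := Nat.ceil_lt_add_one (by positivity)
  have hwm : 1 ≤ w / m := by rwa [le_div_iff₀ hm, one_mul]
  have e1 : 2 * w / m = 2 * (w / m) := by ring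
  have e3 : 3 * w / m = 3 * (w / m) := by ring
  have hN0 : (0 : ℝ) < N := by linarith
  have hw' : w = (w / m) * m := by field_simp
  have hu : (N : ℝ) * (w / N) = w := by field_simp
  have hu0 : 0 < w / N := by positivity
  refine ⟨N, w / N, ?_, ?_, hu, by linarith, ?_⟩
  · rw [le_div_iff₀ hN0]; nlinarith
  · rw [div_le_iff₀ hN0]; nlinarith
  · intro x hx0 hxw
    set u := w / N
    have hN1 : 1 ≤ N := Nat.one_le_iff_ne_zero.2 (by rintro h; simp [h] at hN0)
    by_cases hxx : x = w
    · refine ⟨N - 1, by omega, ?_, ?_⟩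
      · push_cast [Nat.cast_sub hN1]; nlinarith
      · push_cast [Nat.cast_sub hN1]; rw [hxx]; nlinarith
    · have hx : x / u < N := by
        rw [div_lt_iff₀ hu0, hu]; exact lt_of_le_of_ne hxw hxx
      refine ⟨⌊x / u⌋₊, (Nat.floor_lt (by positivity)).2 hx, ?_, ?_⟩
      · rw [← le_div_iff₀ hu0]; exact Nat.floor_le (by positivity)
      · rw [← div_le_iff₀ hu0]; exact (Nat.lt_floor_add_one _).le

/-- Every point of `D` has a red point of `S` within distance `m`. -/
def RedCov (m : ℝ) (D : Set (ℝ × ℝ)) : Set (Set CPt) :=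
  {S | ∀ p ∈ D, ∃ x, (x, true) ∈ S ∧ sqDist p x ≤ m ^ 2}

/-- The bound for the probability that a `w × h` rectangle is not covered at scale `m`. -/
noncomputable def err (lam : ℝ≥0) (m w h : ℝ) : ℝ :=
  9 * w * h / m ^ 2 * Real.exp (-(lam * m ^ 2 / 9))

lemma pr_not_redCov_le (lam : ℝ≥0) (R : Dom) {m a b c d : ℝ} (hm : 0 < m) (hab : m ≤ b - a)
    (hcd : m ≤ d - c) (hR : rect a b c d ⊆ R.s) :
    pr (Lam lam R) (RedCov m (rect a b c d))ᶜ ≤ err lam m (b - a) (d - c) := by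
  obtain ⟨N, u, hu1, hu2, hNu, hNw, hN⟩ := exists_tiles hm hab
  obtain ⟨M, v, hv1, hv2, hMv, hMw, hM⟩ := exists_tiles hm hcd
  let T : ℕ × ℕ → Set (ℝ × ℝ) := fun p =>
    rect (a + p.1 * u) (a + (p.1 + 1) * u) (c + p.2 * v) (c + (p.2 + 1) * v)
  have hsub : (RedCov m (rect a b c d))ᶜ ⊆ ⋃ p ∈ Finset.range N ×ˢ Finset.range M,
      {S | S ∩ T p ×ˢ {true} = ∅} := by
    intro S hS
    by_contra hcon
    simp only [mem_iUnion, not_exists, Finset.mem_product, Finset.mem_range] at hcon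
    apply hS
    intro p hp
    rw [mem_rect] at hp
    obtain ⟨i, hi, hi1, hi2⟩ := hN (p.1 - a) (by linarith) (by linarith)
    obtain ⟨j, hj, hj1, hj2⟩ := hM (p.2 - c) (by linarith) (by linarith)
    obtain ⟨⟨s, t⟩, hsS, hsT, ht⟩ := nonempty_iff_ne_empty.2 (hcon (i, j) ⟨hi, hj⟩)
    obtain rfl : t = true := ht
    refine ⟨s, hsS, ?_⟩
    simp only [T, mem_rect] at hsT
    unfold sqDist
    have h1 : |p.1 - s.1| ≤ m / 2 := by rw [abs_le]; constructor <;> linarith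
    have h2 : |p.2 - s.2| ≤ m / 2 := by rw [abs_le]; constructor <;> linarith
    have h3 := sq_le_sq' (abs_le.1 h1).1 (abs_le.1 h1).2
    have h4 := sq_le_sq' (abs_le.1 h2).1 (abs_le.1 h2).2
    nlinarith
  refine (pr_mono _ hsub).trans ((pr_biUnion_le _ _ _).trans ?_)
  have hT : ∀ p ∈ Finset.range N ×ˢ Finset.range M,
      pr (Lam lam R) {S | S ∩ T p ×ˢ {true} = ∅} ≤ Real.exp (-(lam * m ^ 2 / 9)) := by
    rintro ⟨i, j⟩ hp
    simp only [Finset.mem_product, Finset.mem_range] at hp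
    have hi : (i : ℝ) + 1 ≤ N := by exact_mod_cast hp.1
    have hj : (j : ℝ) + 1 ≤ M := by exact_mod_cast hp.2
    have hu0 : 0 < u := by linarith
    have hv0 : 0 < v := by linarith
    have hTR : T (i, j) ⊆ R.s := by
      refine Subset.trans ?_ hR
      intro q hq
      simp only [T, mem_rect] at hq ⊢
      have h1 := mul_le_mul_of_nonneg_right hi hu0.le
      have h2 := mul_le_mul_of_nonneg_right hj hv0.le
      have h3 : 0 ≤ (i : ℝ) * u := by positivity
      have h4 : 0 ≤ (j : ℝ) * v := by positivity
      refine ⟨⟨?_, ?_⟩, ?_, ?_⟩ <;> linarith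
    rw [pr_void _ ((measurableSet_rect _ _ _ _).prod (measurableSet_singleton _)),
      Lam_real _ _ (measurableSet_rect _ _ _ _) hTR, Real.exp_le_exp, neg_le_neg_iff]
    rw [volume_rect (by linarith) (by linarith)]
    have : m ^ 2 / 9 ≤ u * v := by
      have := mul_le_mul hu1 hv1 (by positivity) hu0.le
      nlinarith
    have h5 : (a + (↑i + 1) * u - (a + ↑i * u)) * (c + (↑j + 1) * v - (c + ↑j * v)) = u * v := by
      ring
    rw [h5]
    have hl : (0 : ℝ) ≤ lam := lam.2
    nlinarith [mul_le_mul_of_nonneg_left this hl]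
  refine (Finset.sum_le_card_nsmul _ _ _ hT).trans ?_
  rw [Finset.card_product, Finset.card_range, Finset.card_range, nsmul_eq_mul, err]
  refine mul_le_mul_of_nonneg_right ?_ (Real.exp_pos _).le
  push_cast
  have hb0 : 0 < b - a := by linarith
  have hd0 : 0 < d - c := by linarith
  calc (N : ℝ) * M ≤ (3 * (b - a) / m) * (3 * (d - c) / m) :=
        mul_le_mul hNw hMw (by positivity) (by positivity)
    _ = _ := by field_simp; ring

lemma redCov_subset_cov (m : ℝ) (D : Set (ℝ × ℝ)) : RedCov m D ⊆ Cov m D := fun _ h p hp => by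
  obtain ⟨x, hx, hpx⟩ := h p hp
  exact ⟨_, hx, hpx⟩

lemma pr_not_cov_le (lam : ℝ≥0) (R : Dom) {m a b c d : ℝ} (hm : 0 < m) (hab : m ≤ b - a)
    (hcd : m ≤ d - c) (hR : rect a b c d ⊆ R.s) :
    pr (Lam lam R) (Cov m (rect a b c d))ᶜ ≤ err lam m (b - a) (d - c) :=
  (pr_mono _ (compl_subset_compl.2 (redCov_subset_cov _ _))).trans
    (pr_not_redCov_le lam R hm hab hcd hR)

/-! ### Local increasing events -/

lemma pr_mono_finite {X : Type*} [MeasurableSpace X] (Λ : Measure X) [IsFiniteMeasure Λ]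
    {A B : Set (Set X)} (h : ∀ S, S.Finite → S ∈ A → S ∈ B) : pr Λ A ≤ pr Λ B :=
  measureReal_mono fun ω hω => h _ (finite_range ω.2) hω

lemma pr_congr_dom (lam : ℝ≥0) {R R' : Dom} {W : Set (ℝ × ℝ)} (hW : MeasurableSet W)
    {A : Set (Set CPt)} (hA : Obs A) (hd : Dep (W ×ˢ univ) A) (h : R.s ∩ W = R'.s ∩ W) :
    pr (Lam lam R) A = pr (Lam lam R') A := by
  rw [pr_restrict _ (hW.prod MeasurableSet.univ) hA hd, Lam_restrict _ _ hW,
    pr_restrict (Lam lam R') (hW.prod MeasurableSet.univ) hA hd, Lam_restrict _ _ hW]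
  congr 2
  simp only [Dom.inter, h]

/-- The increasing event `A` depends on the points in `W` only and has probability at least `c`
for the process on every domain that agrees with `H` in `W`. -/
structure Bd (H : Set (ℝ × ℝ)) (lam : ℝ≥0) (W : Set (ℝ × ℝ)) (A : Set (Set CPt)) (c : ℝ) :
    Prop where
  red : RedEv A
  dep : Dep (W ×ˢ univ) A
  le : ∀ R : Dom, R.s ∩ W = H ∩ W → c ≤ pr (Lam lam R) A

section Bd

variable {H W W' : Set (ℝ × ℝ)} {lam : ℝ≥0} {A B : Set (Set CPt)} {c c' : ℝ}

lemma Bd.mono (h : Bd H lam W A c) (hW : W ⊆ W') (hc : c' ≤ c) : Bd H lam W' A c' :=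
  ⟨h.red, dep_mono (prod_mono hW Subset.rfl) h.dep, fun R hR => hc.trans (h.le R (by
    rw [← inter_eq_right.2 hW, ← inter_assoc, hR, inter_assoc]))⟩

lemma dep_inter {X : Type*} {V : Set X} {A B : Set (Set X)} (hA : Dep V A) (hB : Dep V B) :
    Dep V (A ∩ B) := fun S => and_congr (hA S) (hB S)

lemma Bd.inter (hA : Bd H lam W A c) (hB : Bd H lam W B c') (hc' : 0 ≤ c') :
    Bd H lam W (A ∩ B) (c * c') :=
  ⟨hA.red.inter hB.red, dep_inter hA.dep hB.dep, fun R hR =>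
    hA.red.le_inter _ hB.red (hA.le R hR) (hB.le R hR) hc'⟩

lemma Bd.imp (hA : Bd H lam W A c) (hB : RedEv B) (hd : Dep (W ×ˢ univ) B)
    (h : ∀ S, S.Finite → S ∈ A → S ∈ B) : Bd H lam W B c :=
  ⟨hB, hd, fun R hR => (hA.le R hR).trans (pr_mono_finite _ h)⟩

lemma Bd.of_dom (hW : MeasurableSet W) (hA : RedEv A) (hd : Dep (W ×ˢ univ) A) {R : Dom}
    (hR : R.s ∩ W = H ∩ W) (hc : c ≤ pr (Lam lam R) A) : Bd H lam W A c :=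
  ⟨hA, hd, fun _ hR' => hc.trans (pr_congr_dom lam hW hA.obs hd (hR.trans hR'.symm)).le⟩

end Bd

/-! ### Isometries -/

/-- An isometry of the plane. -/
structure Iso where
  g : (ℝ × ℝ) ≃ₜ (ℝ × ℝ)
  dist : ∀ p q, sqDist (g p) (g q) = sqDist p q
  vol : MeasurePreserving g volume volume

/-- The action of an isometry on coloured points. -/
def Iso.act (φ : Iso) : CPt → CPt := Prod.map φ.g id

lemma Iso.measurable_act (φ : Iso) : Measurable φ.act :=
  (φ.g.continuous.measurable.comp measurable_fst).prodMk measurable_snd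

lemma Iso.mem_act (φ : Iso) (S : Set CPt) (x : ℝ × ℝ) (b : Bool) :
    (φ.g x, b) ∈ φ.act '' S ↔ (x, b) ∈ S := by
  constructor
  · rintro ⟨⟨y, c⟩, hy, h⟩
    simp only [Iso.act, Prod.map_apply, id, Prod.mk.injEq, EmbeddingLike.apply_eq_iff_eq] at h
    rwa [← h.1, ← h.2]
  · intro h
    exact ⟨_, h, rfl⟩

lemma Iso.reg (φ : Iso) {m : ℝ} {S : Set CPt} {b : Bool} {p : ℝ × ℝ} (hp : p ∈ Reg m S b) :
    φ.g p ∈ Reg m (φ.act '' S) b := by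
  obtain ⟨x, hx, hm, h⟩ := hp
  refine ⟨φ.g x, (φ.mem_act _ _ _).2 hx, by rwa [φ.dist], fun y hy => ?_⟩
  obtain ⟨y, rfl⟩ := φ.g.surjective y
  rw [φ.dist, φ.dist]
  exact h y ((φ.mem_act _ _ _).1 hy)

lemma Iso.conn (φ : Iso) {m : ℝ} {S : Set CPt} {b : Bool} {D X Y D' X' Y' : Set (ℝ × ℝ)}
    (hD : MapsTo φ.g D D') (hX : MapsTo φ.g X X') (hY : MapsTo φ.g Y Y') (h : Conn m S b D X Y) :
    Conn m (φ.act '' S) b D' X' Y' := by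
  obtain ⟨x, hx, y, hy, hj⟩ := h
  obtain ⟨γ, hγ⟩ := hj
  exact ⟨_, hX hx, _, hY hy, γ.map φ.g.continuous, fun t => ⟨φ.reg (hγ t).1, hD (hγ t).2⟩⟩

/-- The preimage of a domain. -/
def Dom.pull (R : Dom) (φ : Iso) : Dom := ⟨φ.g ⁻¹' R.s, φ.vol.measurable R.meas, by
  rw [φ.vol.measure_preimage R.meas.nullMeasurableSet]; exact R.fin⟩

lemma Lam_map (lam : ℝ≥0) (R : Dom) (φ : Iso) :
    (Lam lam (R.pull φ)).map φ.act = Lam lam R := by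
  rw [Lam, Iso.act, ← Measure.map_prod_map _ _ φ.vol.measurable measurable_id, Measure.map_id,
    Measure.map_smul, Lam]
  congr 2
  exact (φ.vol.restrict_preimage R.meas).map_eq

lemma redEv_Ev (m : ℝ) {D X Y : Set (ℝ × ℝ)} (hD : IsCompact D) (hDc : Convex ℝ D)
    (hX : IsClosed X) (hY : IsClosed Y) : RedEv (Ev m true D X Y) :=
  ⟨obs_Ev m true hD hDc hX hY, incr_Ev m D X Y⟩

lemma Bd.image (φ : Iso) {H H' : Set (ℝ × ℝ)} {lam : ℝ≥0} {W W' : Set (ℝ × ℝ)} {m : ℝ}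
    {D X Y D' X' Y' : Set (ℝ × ℝ)} {c : ℝ} (h : Bd H lam W (Ev m true D X Y) c)
    (hE : RedEv (Ev m true D' X' Y')) (hd : nb m D' ⊆ W')
    (hH : φ.g ⁻¹' H' = H) (hW : MapsTo φ.g W W')
    (hD : MapsTo φ.g D D') (hX : MapsTo φ.g X X') (hY : MapsTo φ.g Y Y') :
    Bd H' lam W' (Ev m true D' X' Y') c := by
  refine ⟨hE, dep_mono (prod_mono hd Subset.rfl) (dep_Ev _ _ _ _ _), fun R hR => ?_⟩
  have e1 : (R.pull φ).s ∩ W = H ∩ W := by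
    ext p
    have := Set.ext_iff.1 hR (φ.g p)
    simp only [mem_inter_iff, Dom.pull, mem_preimage, ← hH] at this ⊢
    constructor
    · rintro ⟨h1, h2⟩
      exact ⟨(this.1 ⟨h1, hW h2⟩).1, h2⟩
    · rintro ⟨h1, h2⟩
      exact ⟨(this.2 ⟨h1, hW h2⟩).1, h2⟩
  refine (h.le _ e1).trans ?_
  rw [← Lam_map lam R φ, pr_map _ φ.act φ.measurable_act hE.obs]
  exact pr_mono _ fun S hS => φ.conn hD hX hY hS

lemma pr_false_eq (lam : ℝ≥0) (R : Dom) (m : ℝ) {D X Y : Set (ℝ × ℝ)} (hD : IsCompact D)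
    (hDc : Convex ℝ D) (hX : IsClosed X) (hY : IsClosed Y) :
    pr (Lam lam R) (Ev m false D X Y) = pr (Lam lam R) (Ev m true D X Y) := by
  have hm : Measurable (Prod.map id not : CPt → CPt) := measurable_id.prodMap (by fun_prop)
  have e : (Lam lam R).map (Prod.map id not) = Lam lam R := by
    rw [Lam, ← Measure.map_prod_map _ _ measurable_id (by fun_prop), Measure.map_id]
    congr 1
    refine Measure.ext_of_singleton fun b => ?_
    rw [Measure.map_apply (by fun_prop) (measurableSet_singleton _)]
    have : not ⁻¹' {b} = {!b} := by ext c; cases b <;> cases c <;> simp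
    rw [this, Measure.count_singleton, Measure.count_singleton]
  have hr : ∀ S : Set CPt, Reg m (Prod.map id not '' S) true = Reg m S false := by
    intro S
    have key : ∀ x b, (x, b) ∈ (Prod.map id not '' S : Set CPt) ↔ (x, !b) ∈ S := by
      intro x b
      constructor
      · rintro ⟨⟨y, c⟩, hy, h⟩
        simp only [Prod.map_apply, id, Prod.mk.injEq] at h
        rw [← h.1, ← h.2, Bool.not_not]
        exact hy
      · intro h
        exact ⟨_, h, by simp⟩
    ext p
    simp only [Reg, mem_ofPred_eq, key]
    rfl
  rw [← e, pr_map _ _ hm (obs_Ev m true hD hDc hX hY), e]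
  congr 1
  ext S
  simp only [mem_ofPred_eq, mem_Ev, Conn, hr]

/-! ### Strict and closed connections -/

/-- The points of `D` that are strictly closer to `x` and `x'` than to the points of `T`. -/
def strictC (D : Set (ℝ × ℝ)) (x x' : ℝ × ℝ) (T : Set (ℝ × ℝ)) : Set (ℝ × ℝ) :=
  {p ∈ D | ∀ y ∈ T, sqDist p x < sqDist p y ∧ sqDist p x' < sqDist p y}

/-- The points of `D` that are at least as close to `x` and `x'` as to the points of `T`. -/
def weakC (D : Set (ℝ × ℝ)) (x x' : ℝ × ℝ) (T : Set (ℝ × ℝ)) : Set (ℝ × ℝ) :=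
  {p ∈ D | ∀ y ∈ T, sqDist p x ≤ sqDist p y ∧ sqDist p x' ≤ sqDist p y}

/-- The points that do not cut off any part of `C` from the common cell of `x` and `x'`. -/
def farC (C : Set (ℝ × ℝ)) (x x' : ℝ × ℝ) : Set (ℝ × ℝ) :=
  {y | ∀ p ∈ C, sqDist p y ≤ max (sqDist p x) (sqDist p x')}

lemma sqDist_mix (p q y : ℝ × ℝ) (a b : ℝ) (h : a + b = 1) :
    sqDist (a • p + b • q) y = a * sqDist p y + b * sqDist q y - a * b * sqDist p q := by
  obtain rfl : b = 1 - a := by linarith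
  unfold sqDist
  simp only [Prod.fst_add, Prod.smul_fst, smul_eq_mul, Prod.snd_add, Prod.smul_snd]
  ring

lemma convex_farC (C : Set (ℝ × ℝ)) (x x' : ℝ × ℝ) : Convex ℝ (farC C x x') := by
  intro y hy z hz a b ha hb hab p hp
  have h1 := hy p hp
  have h2 := hz p hp
  rw [sqDist_comm, sqDist_mix y z p a b hab, sqDist_comm y, sqDist_comm z]
  have h3 := mul_nonneg (mul_nonneg ha hb) (sqDist_nonneg y z)
  obtain rfl : b = 1 - a := by linarith
  nlinarith [mul_le_mul_of_nonneg_left h1 ha, mul_le_mul_of_nonneg_left h2 hb]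

lemma convex_strictC {D : Set (ℝ × ℝ)} (hD : Convex ℝ D) (x x' : ℝ × ℝ) (T : Set (ℝ × ℝ)) :
    Convex ℝ (strictC D x x' T) := by
  intro p hp q hq a b ha hb hab
  refine ⟨hD hp.1 hq.1 ha hb hab, fun y hy => ?_⟩
  obtain ⟨h1, h2⟩ := hp.2 y hy
  obtain ⟨h3, h4⟩ := hq.2 y hy
  simp only [sqDist_mix p q _ a b hab, sub_lt_sub_iff_right]
  rcases eq_or_lt_of_le ha with rfl | ha'
  · obtain rfl : b = 1 := by linarith
    simpa using ⟨h3, h4⟩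
  · exact ⟨by nlinarith [mul_lt_mul_of_pos_left h1 ha', mul_le_mul_of_nonneg_left h3.le hb],
      by nlinarith [mul_lt_mul_of_pos_left h2 ha', mul_le_mul_of_nonneg_left h4.le hb]⟩

lemma mem_frontier_farC {D : Set (ℝ × ℝ)} (hD : Convex ℝ D) {x x' y : ℝ × ℝ} {T : Set (ℝ × ℝ)}
    (h1 : (strictC D x x' T).Nonempty) (h2 : (weakC D x x' (insert y T)).Nonempty)
    (h3 : strictC D x x' (insert y T) = ∅) :
    y ∈ frontier (farC (strictC D x x' T) x x') ∪ {x} := by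
  obtain ⟨q, hq⟩ := h1
  obtain ⟨p, hp⟩ := h2
  have hyB : y ∈ farC (strictC D x x' T) x x' := by
    intro w hw
    by_contra hlt
    rw [not_le, max_lt_iff] at hlt
    have : w ∈ strictC D x x' (insert y T) := ⟨hw.1, fun v hv => by
      rcases hv with rfl | hv
      · exact hlt
      · exact hw.2 v hv⟩
    rw [h3] at this
    exact this
  have hpB : ∀ w ∈ farC (strictC D x x' T) x x', sqDist p w ≤ max (sqDist p x) (sqDist p x') := by
    intro w hw
    have hc : Continuous fun t : ℝ => (1 - t) • q + t • p := by fun_prop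
    have hcl : IsClosed {t : ℝ | sqDist ((1 - t) • q + t • p) w ≤
        max (sqDist ((1 - t) • q + t • p) x) (sqDist ((1 - t) • q + t • p) x')} :=
      isClosed_le (continuous_sqDist.comp (hc.prodMk continuous_const))
        ((continuous_sqDist.comp (hc.prodMk continuous_const)).max
          (continuous_sqDist.comp (hc.prodMk continuous_const)))
    have hsub : Ico (0 : ℝ) 1 ⊆ {t : ℝ | sqDist ((1 - t) • q + t • p) w ≤
        max (sqDist ((1 - t) • q + t • p) x) (sqDist ((1 - t) • q + t • p) x')} := by
      intro t ht
      refine hw _ ⟨hD hq.1 hp.1 (by linarith [ht.2]) ht.1 (by ring), fun v hv => ?_⟩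
      obtain ⟨a1, a2⟩ := hq.2 v hv
      obtain ⟨a3, a4⟩ := hp.2 v (mem_insert_of_mem _ hv)
      simp only [sqDist_mix q p _ (1 - t) t (by ring), sub_lt_sub_iff_right]
      have ht' : 0 < 1 - t := by linarith [ht.2]
      exact ⟨by nlinarith [mul_lt_mul_of_pos_left a1 ht', mul_le_mul_of_nonneg_left a3 ht.1],
        by nlinarith [mul_lt_mul_of_pos_left a2 ht', mul_le_mul_of_nonneg_left a4 ht.1]⟩
    have := closure_minimal hsub hcl
    rw [closure_Ico (zero_ne_one' ℝ)] at this
    simpa using this (right_mem_Icc.2 zero_le_one)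
  by_cases hyi : y ∈ interior (farC (strictC D x x' T) x x')
  · right
    have hmax := max_le_iff.2 (hp.2 y (mem_insert _ _))
    have hcont : Continuous fun t : ℝ => y + t • (y - p) := by fun_prop
    have h0 : (fun t : ℝ => y + t • (y - p)) 0 ∈ interior (farC (strictC D x x' T) x x') := by
      simpa using hyi
    obtain ⟨ε, hε, hb⟩ := Metric.isOpen_iff.1 (isOpen_interior.preimage hcont) 0 h0
    have h4 := hpB _ (interior_subset (hb (show ε / 2 ∈ Metric.ball 0 ε by
      rw [Metric.mem_ball, Real.dist_eq, sub_zero, abs_of_pos (half_pos hε)]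
      exact half_lt_self hε)))
    have h5 : sqDist p (y + (ε / 2) • (y - p)) = (1 + ε / 2) ^ 2 * sqDist p y := by
      unfold sqDist
      simp only [Prod.fst_add, Prod.smul_fst, smul_eq_mul, Prod.snd_add, Prod.smul_snd,
        Prod.fst_sub, Prod.snd_sub]
      ring
    rw [h5] at h4
    have h6 : sqDist p y ≤ 0 := by
      by_contra! hpos
      have h8 := h4.trans hmax
      nlinarith [mul_pos hε hpos, mul_pos (pow_pos hε 2) hpos]
    have h7 : sqDist p x ≤ 0 := (le_max_left _ _).trans (hmax.trans h6)
    unfold sqDist at h6 h7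
    have e1 : p.1 - y.1 = 0 := by nlinarith [sq_nonneg (p.1 - y.1), sq_nonneg (p.2 - y.2)]
    have e2 : p.2 - y.2 = 0 := by nlinarith [sq_nonneg (p.1 - y.1), sq_nonneg (p.2 - y.2)]
    have e3 : p.1 - x.1 = 0 := by nlinarith [sq_nonneg (p.1 - x.1), sq_nonneg (p.2 - x.2)]
    have e4 : p.2 - x.2 = 0 := by nlinarith [sq_nonneg (p.1 - x.1), sq_nonneg (p.2 - x.2)]
    exact Prod.ext (by linarith) (by linarith)
  · left
    exact ⟨subset_closure hyB, hyi⟩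

lemma volume_frontier_farC (C : Set (ℝ × ℝ)) (x x' : ℝ × ℝ) :
    volume (frontier (farC C x x') ∪ {x}) = 0 := by
  rw [measure_union_null_iff]
  exact ⟨(convex_farC C x x').addHaar_frontier volume, measure_singleton x⟩

lemma pi_null_of_slices {X : Type*} [MeasurableSpace X] (μ : Measure X) [IsFiniteMeasure μ] {k : ℕ}
    (j : Fin k) {E : Set (Fin k → X)} (hE : MeasurableSet E)
    (h : ∀ w, μ {x | Function.update w j x ∈ E} = 0) : Measure.pi (fun _ => μ) E = 0 := by
  obtain ⟨k, rfl⟩ : ∃ k', k = k' + 1 := ⟨k - 1, by have := j.pos; omega⟩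
  have hp := (measurePreserving_piFinSuccAbove (fun _ : Fin (k + 1) => μ) j).symm
  rw [← hp.measure_preimage hE.nullMeasurableSet, Measure.prod_apply_symm (hp.measurable hE)]
  refine (lintegral_congr fun y => ?_).trans lintegral_zero
  rcases isEmpty_or_nonempty X with hX | ⟨⟨x₀⟩⟩
  · have : ∀ s : Set X, μ s = 0 := fun s => by rw [Subsingleton.elim s ∅, measure_empty]
    exact this _
  · convert h (j.insertNth x₀ y) using 2
    ext x
    simp only [mem_preimage, mem_ofPred_eq, Fin.update_insertNth]
    rfl

lemma lam_fst_null (lam : ℝ≥0) (R : Dom) {N : Set (ℝ × ℝ)} (hN : volume N = 0) :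
    Lam lam R (Prod.fst ⁻¹' N) = 0 := by
  have : Prod.fst ⁻¹' N = N ×ˢ (univ : Set Bool) := by ext; simp
  rw [this, Lam, Measure.prod_prod, Measure.smul_apply, Measure.absolutelyContinuous_of_le
    Measure.restrict_le_self hN, smul_zero, zero_mul]

/-- The configurations for which the strict and the weak version of adjacency differ. -/
def degen {k : ℕ} (D : Set (ℝ × ℝ)) (i i' j : Fin k) (J : Finset (Fin k)) : Set (Fin k → CPt) :=
  {w | (strictC D (w i).1 (w i').1 ((fun l => (w l).1) '' J)).Nonempty ∧
    (weakC D (w i).1 (w i').1 (insert (w j).1 ((fun l => (w l).1) '' J))).Nonempty ∧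
    strictC D (w i).1 (w i').1 (insert (w j).1 ((fun l => (w l).1) '' J)) = ∅}

lemma pi_degen (lam : ℝ≥0) (R : Dom) {k : ℕ} {D : Set (ℝ × ℝ)} (hD : IsCompact D)
    (hDc : Convex ℝ D) {i i' j : Fin k} {J : Finset (Fin k)} (hi : i ≠ j) (hi' : i' ≠ j)
    (hJ : j ∉ J) : Measure.pi (fun _ => Lam lam R) (degen D i i' j J) = 0 := by
  have hd : ∀ l, Continuous fun w : (Fin k → CPt) × (ℝ × ℝ) => sqDist w.2 (w.1 l).1 := fun l =>
    continuous_sqDist.comp (f := fun w : (Fin k → CPt) × (ℝ × ℝ) => (w.2, (w.1 l).1)) (by fun_prop)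
  have ho : ∀ J : Finset (Fin k), IsOpen {w : Fin k → CPt |
      (strictC D (w i).1 (w i').1 ((fun l => (w l).1) '' J)).Nonempty} := by
    intro J
    have : {w : Fin k → CPt | (strictC D (w i).1 (w i').1 ((fun l => (w l).1) '' J)).Nonempty} =
        ⋃ p ∈ D, ⋂ l ∈ J, {w : Fin k → CPt | sqDist p (w i).1 < sqDist p (w l).1 ∧
          sqDist p (w i').1 < sqDist p (w l).1} := by
      ext w; simp [strictC, Set.Nonempty]
    rw [this]
    refine isOpen_biUnion fun p _ => isOpen_biInter_finset fun l _ => ?_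
    have hc : ∀ l, Continuous fun w : Fin k → CPt => sqDist p (w l).1 := fun l =>
      (hd l).comp (f := fun w => (w, p)) (by fun_prop)
    exact (isOpen_lt (hc i) (hc l)).inter (isOpen_lt (hc i') (hc l))
  have hcl : ∀ J : Finset (Fin k), IsClosed {w : Fin k → CPt |
      (weakC D (w i).1 (w i').1 ((fun l => (w l).1) '' J)).Nonempty} := by
    intro J
    have := isClosed_exists_compact hD (A := Fin k → CPt)
      (C := ⋂ l ∈ J, {w | sqDist w.2 (w.1 i).1 ≤ sqDist w.2 (w.1 l).1 ∧
          sqDist w.2 (w.1 i').1 ≤ sqDist w.2 (w.1 l).1})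
      (isClosed_biInter fun l _ => (isClosed_le (hd i) (hd l)).inter (isClosed_le (hd i') (hd l)))
    convert this using 1
    ext w; simp [weakC, Set.Nonempty]
  have hins : ∀ w : Fin k → CPt, insert (w j).1 ((fun l => (w l).1) '' J) =
      (fun l => (w l).1) '' (insert j J : Finset (Fin k)) := fun w => by
    rw [Finset.coe_insert, image_insert_eq]
  have hm : MeasurableSet (degen D i i' j J) := by
    have : degen D i i' j J = {w : Fin k → CPt |
        (strictC D (w i).1 (w i').1 ((fun l => (w l).1) '' J)).Nonempty} ∩ ({w : Fin k → CPt |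
        (weakC D (w i).1 (w i').1 ((fun l => (w l).1) '' (insert j J : Finset (Fin k)))).Nonempty} \
        {w : Fin k → CPt | (strictC D (w i).1 (w i').1
          ((fun l => (w l).1) '' (insert j J : Finset (Fin k)))).Nonempty}) := by
      ext w
      simp only [degen, hins, mem_ofPred_eq, mem_inter_iff, mem_sdiff, not_nonempty_iff_eq_empty]
    rw [this]
    exact (ho J).measurableSet.inter ((hcl _).measurableSet.diff (ho _).measurableSet)
  refine pi_null_of_slices _ j hm fun w => ?_
  refine measure_mono_null (t := Prod.fst ⁻¹' (frontier (farC (strictC D (w i).1 (w i').1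
    ((fun l => (w l).1) '' J)) (w i).1 (w i').1) ∪ {(w i).1})) ?_
    (lam_fst_null lam R (volume_frontier_farC _ _ _))
  intro x hx
  have hJ' : (fun l => (Function.update w j x l).1) '' (J : Set (Fin k)) =
      (fun l => (w l).1) '' J := by
    refine image_congr fun l hl => ?_
    rw [Function.update_of_ne]
    rintro rfl
    exact hJ hl
  simp only [degen, mem_ofPred_eq, Function.update_of_ne hi, Function.update_of_ne hi',
    Function.update_self, hJ'] at hx
  exact mem_frontier_farC hDc hx.1 hx.2.1 hx.2.2

/-- Almost surely, weak adjacency implies strict adjacency. -/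
lemma ae_strictC (lam : ℝ≥0) (R : Dom) (k : ℕ) {D : Set (ℝ × ℝ)} (hD : IsCompact D)
    (hDc : Convex ℝ D) : ∀ᵐ w ∂Measure.pi (fun _ : Fin k => Lam lam R), ∀ (i i' : Fin k)
      (J : Finset (Fin k)), i ∉ J → i' ∉ J →
      (weakC D (w i).1 (w i').1 ((fun l => (w l).1) '' J)).Nonempty →
      (strictC D (w i).1 (w i').1 ((fun l => (w l).1) '' J)).Nonempty := by
  have h : ∀ᵐ w ∂Measure.pi (fun _ : Fin k => Lam lam R), ∀ (i i' j : Fin k)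
      (J : Finset (Fin k)), i ≠ j → i' ≠ j → j ∉ J → w ∉ degen D i i' j J := by
    simp only [ae_all_iff]
    intro i i' j J h1 h2 h3
    exact measure_eq_zero_iff_ae_notMem.1 (pi_degen lam R hD hDc h1 h2 h3)
  filter_upwards [h] with w hw i i' J
  induction J using Finset.induction_on with
  | empty =>
    rintro - - ⟨p, hp⟩
    exact ⟨p, hp.1, by simp⟩
  | insert j J hj ih =>
    intro h1 h2 hne
    rw [Finset.mem_insert, not_or] at h1 h2
    rw [Finset.coe_insert, image_insert_eq] at hne ⊢
    by_contra hcon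
    refine hw i i' j J h1.1 h2.1 hj ⟨ih h1.2 h2.2 ?_, hne, not_nonempty_iff_eq_empty.1 hcon⟩
    obtain ⟨p, hp⟩ := hne
    exact ⟨p, hp.1, fun y hy => hp.2 y (mem_insert_of_mem _ hy)⟩

/-- Connections of different colours that are forced to cross do not occur simultaneously. -/
theorem pr_exclusive (lam : ℝ≥0) (R : Dom) {m m' : ℝ} {D X Y D' X' Y' : Set (ℝ × ℝ)}
    (hD : IsCompact D) (hDc : Convex ℝ D) (hX : IsClosed X) (hXc : Convex ℝ X) (hY : IsClosed Y)
    (hYc : Convex ℝ Y) (hD' : IsCompact D') (hDc' : Convex ℝ D') (hX' : IsClosed X')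
    (hY' : IsClosed Y')
    (hcross : ∀ x ∈ X, ∀ y ∈ Y, ∀ x' ∈ X', ∀ y' ∈ Y', ∀ F ⊆ D, ∀ G ⊆ D', JoinedIn F x y →
      JoinedIn G x' y' → (F ∩ G).Nonempty) :
    pr (Lam lam R) (Ev m true D X Y ∩ Ev m' false D' X' Y') = 0 := by
  have hobs := (obs_Ev m true hD hDc hX hY).inter (obs_Ev m' false hD' hDc' hX' hY')
  rw [pr, Measure.real, poisson_null _ hobs, ENNReal.toReal_zero]
  intro k
  refine measure_eq_zero_iff_ae_notMem.2 ?_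
  filter_upwards [ae_strictC lam R k hD hDc, ae_strictC lam R k (hD.inter_right hX) (hDc.inter hXc),
    ae_strictC lam R k (hD.inter_right hY) (hDc.inter hYc)] with w h1 h2 h3
  rintro ⟨hr, hb⟩
  rw [mem_Ev, conn_iff_chain m w true hD.isClosed hDc] at hr
  obtain ⟨i, j, ⟨x, ⟨hxi, hxD⟩, hxX⟩, ⟨y, ⟨hyj, hyD⟩, hyY⟩, hch⟩ := hr
  set J : Finset (Fin k) := Finset.univ.filter fun l => (w l).2 = false with hJ
  have hnJ : ∀ {l p}, p ∈ piece m w true l → l ∉ J := fun {l p} h => by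
    simp [hJ, h.1]
  have hw : ∀ {l l' p} {D : Set (ℝ × ℝ)}, p ∈ piece m w true l → p ∈ piece m w true l' → p ∈ D →
      p ∈ weakC D (w l).1 (w l').1 ((fun l => (w l).1) '' J) := fun {l l' p D} h h' hp => by
    refine ⟨hp, ?_⟩
    rintro _ ⟨a, ha, rfl⟩
    have ha' : (w a).2 = !true := by simpa [hJ] using ha
    exact ⟨(h.2.2 a).resolve_left (not_not_intro ha'), (h'.2.2 a).resolve_left (not_not_intro ha')⟩
  obtain ⟨x', hx'⟩ := h2 i i J (hnJ hxi) (hnJ hxi) ⟨x, hw hxi hxi ⟨hxD, hxX⟩⟩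
  obtain ⟨y', hy'⟩ := h3 j j J (hnJ hyj) (hnJ hyj) ⟨y, hw hyj hyj ⟨hyD, hyY⟩⟩
  let K : Fin k → Set (ℝ × ℝ) := fun l =>
    {p ∈ strictC D (w l).1 (w l).1 ((fun l => (w l).1) '' J) | (w l).2 = true}
  have hK : ∀ l, Convex ℝ (K l) := fun l p hp q hq a b ha hb hab =>
    ⟨convex_strictC hDc _ _ _ hp.1 hq.1 ha hb hab, hp.2⟩
  have hmeet : ∀ a b, Meets (fun o => piece m w true o ∩ D) a b → Meets K a b := by
    rintro a b ⟨p, ⟨hpa, hpD⟩, hpb, -⟩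
    obtain ⟨q, hq⟩ := h1 a b J (hnJ hpa) (hnJ hpb) ⟨p, hw hpa hpb hpD⟩
    exact ⟨q, ⟨⟨hq.1, fun v hv => ⟨(hq.2 v hv).1, (hq.2 v hv).1⟩⟩, hpa.1⟩,
      ⟨hq.1, fun v hv => ⟨(hq.2 v hv).2, (hq.2 v hv).2⟩⟩, hpb.1⟩
  have hj := joinedIn_of_chain hK (Relation.ReflTransGen.mono hmeet _ _ hch)
    (x := x') (y := y') ⟨⟨hx'.1.1, hx'.2⟩, hxi.1⟩ ⟨⟨hy'.1.1, hy'.2⟩, hyj.1⟩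
  obtain ⟨a, ha, b, hb, hG⟩ := hb
  obtain ⟨p, hp, hpG⟩ := hcross x' hx'.1.2 y' hy'.1.2 a ha b hb _
    (iUnion_subset fun l p hp => hp.1.1) _ inter_subset_right hj hG
  obtain ⟨l, hl⟩ := mem_iUnion.1 hp
  obtain ⟨v, ⟨c, hc⟩, -, hv⟩ := hpG.1
  have hcJ : c ∈ (J : Set (Fin k)) := by simp [hJ, hc]
  have e1 := (hl.1.2 _ ⟨c, hcJ, rfl⟩).1
  have e2 := hv (w l).1 ⟨l, Prod.ext rfl (by simpa using hl.2)⟩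
  simp only [hc] at e1
  linarith

/-! ### Bounds for connections in rectangles -/

/-- The translation by `(u, v)`. -/
noncomputable def Iso.trans (u v : ℝ) : Iso where
  g := Homeomorph.addRight (u, v)
  dist p q := by simp [sqDist]
  vol := measurePreserving_add_right volume (u, v)

/-- The reflection in the vertical axis. -/
noncomputable def Iso.refX : Iso where
  g := (Homeomorph.neg ℝ).prodCongr (Homeomorph.refl ℝ)
  dist p q := by simp [sqDist]; ring
  vol := (Measure.measurePreserving_neg volume).prod (MeasurePreserving.id volume)

/-- The reflection in the diagonal. -/
noncomputable def Iso.swap : Iso where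
  g := Homeomorph.prodComm ℝ ℝ
  dist p q := by simp [sqDist]; ring
  vol := Measure.measurePreserving_swap

/-- The reflection in the horizontal axis. -/
noncomputable def Iso.refY : Iso where
  g := (Homeomorph.refl ℝ).prodCongr (Homeomorph.neg ℝ)
  dist p q := by simp [sqDist]; ring
  vol := (MeasurePreserving.id volume).prod (Measure.measurePreserving_neg volume)

/-- The right half-plane. -/
def HP : Set (ℝ × ℝ) := {p | 0 ≤ p.1}

/-- The lower bound `q` for the probability of a red connection inside `[a, b] × [c, d]` between two
rectangles, for the process on every domain that agrees with `H` near `[a, b] × [c, d]`. -/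
def BR (H : Set (ℝ × ℝ)) (lam : ℝ≥0) (m a b c d x₁ x₂ x₃ x₄ y₁ y₂ y₃ y₄ q : ℝ) : Prop :=
  Bd H lam (rect (a - m) (b + m) (c - m) (d + m))
    (Ev m true (rect a b c d) (rect x₁ x₂ x₃ x₄) (rect y₁ y₂ y₃ y₄)) q

/-- The bound for left-right crossings of a rectangle in the plane. -/
abbrev LR (lam : ℝ≥0) (m a b c d q : ℝ) : Prop := BR univ lam m a b c d a a c d b b c d q

/-- The bound for bottom-top crossings of a rectangle in the plane. -/
abbrev TB (lam : ℝ≥0) (m a b c d q : ℝ) : Prop := BR univ lam m a b c d a b c c a b d d q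

lemma rect_subset {a b c d a' b' c' d' : ℝ} (h1 : a' ≤ a) (h2 : b ≤ b') (h3 : c' ≤ c)
    (h4 : d ≤ d') : rect a b c d ⊆ rect a' b' c' d' :=
  prod_mono (Icc_subset_Icc h1 h2) (Icc_subset_Icc h3 h4)

lemma redEv_rect (m a b c d x₁ x₂ x₃ x₄ y₁ y₂ y₃ y₄ : ℝ) :
    RedEv (Ev m true (rect a b c d) (rect x₁ x₂ x₃ x₄) (rect y₁ y₂ y₃ y₄)) :=
  redEv_Ev m (isCompact_rect _ _ _ _) (convex_rect _ _ _ _) (isClosed_rect _ _ _ _)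
    (isClosed_rect _ _ _ _)

lemma dep_rect (m : ℝ) {a b c d : ℝ} (col : Bool) {X Y : Set (ℝ × ℝ)} {A B C E : ℝ} (hm : 0 ≤ m)
    (h1 : A ≤ a - m) (h2 : b + m ≤ B) (h3 : C ≤ c - m) (h4 : d + m ≤ E) :
    Dep (rect A B C E ×ˢ univ) (Ev m col (rect a b c d) X Y) :=
  dep_mono (prod_mono ((nb_rect_subset hm).trans (rect_subset h1 h2 h3 h4)) Subset.rfl)
    (dep_Ev m col _ X Y)

section BR

variable {H H' : Set (ℝ × ℝ)} {lam : ℝ≥0} {m a b c d x₁ x₂ x₃ x₄ y₁ y₂ y₃ y₄ q : ℝ}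

lemma BR.mono (h : BR H lam m a b c d x₁ x₂ x₃ x₄ y₁ y₂ y₃ y₄ q) (hm : 0 ≤ m)
    {m' a' b' c' d' x₁' x₂' x₃' x₄' y₁' y₂' y₃' y₄' q' : ℝ}
    (hm' : m ≤ m' := by linarith) (ha : a' ≤ a := by linarith) (hb : b ≤ b' := by linarith)
    (hc : c' ≤ c := by linarith) (hd : d ≤ d' := by linarith) (hx₁ : x₁' ≤ x₁ := by linarith)
    (hx₂ : x₂ ≤ x₂' := by linarith) (hx₃ : x₃' ≤ x₃ := by linarith)
    (hx₄ : x₄ ≤ x₄' := by linarith) (hy₁ : y₁' ≤ y₁ := by linarith)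
    (hy₂ : y₂ ≤ y₂' := by linarith) (hy₃ : y₃' ≤ y₃ := by linarith)
    (hy₄ : y₄ ≤ y₄' := by linarith) (hq : q' ≤ q := by linarith) :
    BR H lam m' a' b' c' d' x₁' x₂' x₃' x₄' y₁' y₂' y₃' y₄' q' := by
  refine (Bd.mono h (rect_subset (by linarith) (by linarith) (by linarith) (by linarith)) hq).imp
    (redEv_rect _ _ _ _ _ _ _ _ _ _ _ _ _) (dep_rect _ _ (by linarith) le_rfl le_rfl le_rfl le_rfl)
    fun S _ hS => ?_
  exact Conn.mono_set hm hm' hS (rect_subset ha hb hc hd) (rect_subset hx₁ hx₂ hx₃ hx₄)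
    (rect_subset hy₁ hy₂ hy₃ hy₄)

lemma BR.trans (h : BR H lam m a b c d x₁ x₂ x₃ x₄ y₁ y₂ y₃ y₄ q) (hm : 0 ≤ m) (u v : ℝ)
    (hH : (fun p : ℝ × ℝ => (p.1 + u, p.2 + v)) ⁻¹' H' = H := by rfl) :
    BR H' lam m (a + u) (b + u) (c + v) (d + v) (x₁ + u) (x₂ + u) (x₃ + v) (x₄ + v)
      (y₁ + u) (y₂ + u) (y₃ + v) (y₄ + v) q := by
  have key : ∀ a b c d a' b' c' d', a' ≤ a + u → b + u ≤ b' → c' ≤ c + v → d + v ≤ d' →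
      MapsTo (Iso.trans u v).g (rect a b c d) (rect a' b' c' d') := by
    intro a b c d a' b' c' d' h1 h2 h3 h4 p hp
    rw [mem_rect] at hp
    exact mem_rect.2 (show (a' ≤ p.1 + u ∧ p.1 + u ≤ b') ∧ c' ≤ p.2 + v ∧ p.2 + v ≤ d' by
      refine ⟨⟨?_, ?_⟩, ?_, ?_⟩ <;> linarith)
  exact Bd.image (Iso.trans u v) h (redEv_rect _ _ _ _ _ _ _ _ _ _ _ _ _)
    (nb_rect_subset hm) hH (key _ _ _ _ _ _ _ _ (by linarith) (by linarith) (by linarith)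
      (by linarith)) (key _ _ _ _ _ _ _ _ le_rfl le_rfl le_rfl le_rfl)
    (key _ _ _ _ _ _ _ _ le_rfl le_rfl le_rfl le_rfl)
    (key _ _ _ _ _ _ _ _ le_rfl le_rfl le_rfl le_rfl)

lemma BR.refX (h : BR H lam m a b c d x₁ x₂ x₃ x₄ y₁ y₂ y₃ y₄ q) (hm : 0 ≤ m)
    (hH : (fun p : ℝ × ℝ => (-p.1, p.2)) ⁻¹' H' = H := by rfl) :
    BR H' lam m (-b) (-a) c d (-x₂) (-x₁) x₃ x₄ (-y₂) (-y₁) y₃ y₄ q := by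
  have key : ∀ a b c d a' b' c' d', a' ≤ -b → -a ≤ b' → c' ≤ c → d ≤ d' →
      MapsTo Iso.refX.g (rect a b c d) (rect a' b' c' d') := by
    intro a b c d a' b' c' d' h1 h2 h3 h4 p hp
    rw [mem_rect] at hp
    exact mem_rect.2 (show (a' ≤ -p.1 ∧ -p.1 ≤ b') ∧ c' ≤ p.2 ∧ p.2 ≤ d' by
      refine ⟨⟨?_, ?_⟩, ?_, ?_⟩ <;> linarith)
  exact Bd.image Iso.refX h (redEv_rect _ _ _ _ _ _ _ _ _ _ _ _ _)
    (nb_rect_subset hm) hH (key _ _ _ _ _ _ _ _ (by linarith) (by linarith) (by linarith)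
      (by linarith)) (key _ _ _ _ _ _ _ _ le_rfl le_rfl le_rfl le_rfl)
    (key _ _ _ _ _ _ _ _ le_rfl le_rfl le_rfl le_rfl)
    (key _ _ _ _ _ _ _ _ le_rfl le_rfl le_rfl le_rfl)

lemma BR.swap (h : BR H lam m a b c d x₁ x₂ x₃ x₄ y₁ y₂ y₃ y₄ q) (hm : 0 ≤ m)
    (hH : (fun p : ℝ × ℝ => (p.2, p.1)) ⁻¹' H' = H := by rfl) :
    BR H' lam m c d a b x₃ x₄ x₁ x₂ y₃ y₄ y₁ y₂ q := by
  have key : ∀ a b c d, MapsTo Iso.swap.g (rect a b c d) (rect c d a b) :=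
    fun a b c d p hp => ⟨hp.2, hp.1⟩
  exact Bd.image Iso.swap h (redEv_rect _ _ _ _ _ _ _ _ _ _ _ _ _)
    (nb_rect_subset hm) hH (key _ _ _ _) (key _ _ _ _) (key _ _ _ _) (key _ _ _ _)

lemma BR.refY (h : BR H lam m a b c d x₁ x₂ x₃ x₄ y₁ y₂ y₃ y₄ q) (hm : 0 ≤ m)
    (hH : (fun p : ℝ × ℝ => (p.1, -p.2)) ⁻¹' H' = H := by rfl) :
    BR H' lam m a b (-d) (-c) x₁ x₂ (-x₄) (-x₃) y₁ y₂ (-y₄) (-y₃) q := by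
  have key : ∀ a b c d a' b' c' d', a' ≤ a → b ≤ b' → c' ≤ -d → -c ≤ d' →
      MapsTo Iso.refY.g (rect a b c d) (rect a' b' c' d') := by
    intro a b c d a' b' c' d' h1 h2 h3 h4 p hp
    rw [mem_rect] at hp
    exact mem_rect.2 (show (a' ≤ p.1 ∧ p.1 ≤ b') ∧ c' ≤ -p.2 ∧ -p.2 ≤ d' by
      refine ⟨⟨?_, ?_⟩, ?_, ?_⟩ <;> linarith)
  exact Bd.image Iso.refY h (redEv_rect _ _ _ _ _ _ _ _ _ _ _ _ _)
    (nb_rect_subset hm) hH (key _ _ _ _ _ _ _ _ (by linarith) (by linarith) (by linarith)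
      (by linarith)) (key _ _ _ _ _ _ _ _ le_rfl le_rfl le_rfl le_rfl)
    (key _ _ _ _ _ _ _ _ le_rfl le_rfl le_rfl le_rfl)
    (key _ _ _ _ _ _ _ _ le_rfl le_rfl le_rfl le_rfl)

lemma BR.toBd (h : BR H lam m a b c d x₁ x₂ x₃ x₄ y₁ y₂ y₃ y₄ q) {A B C E : ℝ}
    (h1 : A ≤ a - m := by linarith) (h2 : b + m ≤ B := by linarith)
    (h3 : C ≤ c - m := by linarith) (h4 : d + m ≤ E := by linarith) :
    Bd H lam (rect A B C E)
      (Ev m true (rect a b c d) (rect x₁ x₂ x₃ x₄) (rect y₁ y₂ y₃ y₄)) q :=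
  Bd.mono h (rect_subset h1 h2 h3 h4) le_rfl

lemma Bd.toBR {A : Set (Set CPt)}
    (h : Bd H lam (rect (a - m) (b + m) (c - m) (d + m)) A q) (hm : 0 ≤ m)
    (himp : ∀ S : Set CPt, S.Finite → S ∈ A →
      Conn m S true (rect a b c d) (rect x₁ x₂ x₃ x₄) (rect y₁ y₂ y₃ y₄)) :
    BR H lam m a b c d x₁ x₂ x₃ x₄ y₁ y₂ y₃ y₄ q :=
  h.imp (redEv_rect _ _ _ _ _ _ _ _ _ _ _ _ _) (dep_rect _ _ hm le_rfl le_rfl le_rfl le_rfl) himp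

end BR

/-- A path-connected set that realizes a connection. -/
lemma Conn.exists_set {m m' : ℝ} {S : Set CPt} {b : Bool} {D X Y : Set (ℝ × ℝ)}
    (h : Conn m S b D X Y) (hm : 0 ≤ m) (hm' : m ≤ m') :
    ∃ K, IsPathConnected K ∧ K ⊆ Reg m' S b ∧ K ⊆ D ∧ (∃ p ∈ K, p ∈ X) ∧ ∃ p ∈ K, p ∈ Y := by
  obtain ⟨K, h1, h2, h3, ⟨x, h4⟩, y, h5⟩ := conn_iff.1 h
  exact ⟨K, h1, h2.trans (Reg.mono hm hm' (fun _ h => h) fun _ h => h), h3, ⟨x, h4⟩, y, h5⟩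

lemma Conn.of_set {m : ℝ} {S : Set CPt} {b : Bool} {D X Y K : Set (ℝ × ℝ)} (hK : IsPathConnected K)
    (h1 : K ⊆ Reg m S b) (h2 : K ⊆ D) (hX : ∃ p ∈ K, p ∈ X) (hY : ∃ p ∈ K, p ∈ Y) :
    Conn m S b D X Y := conn_iff.2 ⟨K, hK, h1, h2, hX, hY⟩

lemma meet {K K' : Set (ℝ × ℝ)} (hK : IsPathConnected K) (hK' : IsPathConnected K')
    {p q a b : ℝ × ℝ} (hp : p ∈ K) (hq : q ∈ K) (ha : a ∈ K') (hb : b ∈ K')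
    (hx : ∀ z ∈ K', p.1 ≤ z.1 ∧ z.1 ≤ q.1) (hy : ∀ z ∈ K, a.2 ≤ z.2 ∧ z.2 ≤ b.2) :
    (K ∩ K').Nonempty :=
  joinedIn_cross (hK.joinedIn p hp q hq) (hK'.joinedIn a ha b hb) hx hy

section Extend

variable {lam : ℝ≥0}

/-- Overlapping crossings are joined by a transversal crossing. -/
lemma LR.join {m₁ m₂ m₃ m a b c d a' b' q₁ q₂ q₃ : ℝ} (h1 : LR lam m₁ a b c d q₁)
    (h2 : LR lam m₂ a' b' c d q₂) (h3 : TB lam m₃ a' b c d q₃) (hm₁ : 0 ≤ m₁) (hm₂ : 0 ≤ m₂)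
    (hm₃ : 0 ≤ m₃) (k₁ : m₁ ≤ m) (k₂ : m₂ ≤ m) (k₃ : m₃ ≤ m) (haa : a ≤ a') (hbb : b ≤ b')
    (hq₂ : 0 ≤ q₂) (hq₃ : 0 ≤ q₃) : LR lam m a b' c d (q₁ * q₂ * q₃) := by
  have e1 : Bd univ lam (rect (a - m) (b' + m) (c - m) (d + m)) _ _ := BR.toBd h1
  have e2 : Bd univ lam (rect (a - m) (b' + m) (c - m) (d + m)) _ _ := BR.toBd h2
  have e3 : Bd univ lam (rect (a - m) (b' + m) (c - m) (d + m)) _ _ := BR.toBd h3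
  refine ((e1.inter e2 hq₂).inter e3 hq₃).toBR (hm₁.trans k₁) ?_
  rintro S - ⟨⟨g1, g2⟩, g3⟩
  obtain ⟨K, hK, hKr, hKD, ⟨p, hp, hpX⟩, p', hp', hpX'⟩ := Conn.exists_set g1 hm₁ k₁
  obtain ⟨L, hL, hLr, hLD, ⟨q, hq, hqX⟩, q', hq', hqX'⟩ := Conn.exists_set g2 hm₂ k₂
  obtain ⟨M, hM, hMr, hMD, ⟨r, hr, hrX⟩, r', hr', hrX'⟩ := Conn.exists_set g3 hm₃ k₃
  simp only [mem_rect] at hpX hpX' hqX hqX' hrX hrX'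
  have f1 : (K ∩ M).Nonempty := meet hK hM hp hp' hr hr'
    (fun z hz => by have := mem_rect.1 (hMD hz); constructor <;> linarith)
    (fun z hz => by have := mem_rect.1 (hKD hz); constructor <;> linarith)
  have f2 : (M ∩ L).Nonempty := by
    rw [inter_comm]
    exact meet hL hM hq hq' hr hr'
      (fun z hz => by have := mem_rect.1 (hMD hz); constructor <;> linarith)
      (fun z hz => by have := mem_rect.1 (hLD hz); constructor <;> linarith)
  have g := (hK.union hM f1).union hL (f2.mono (inter_subset_inter_left _ subset_union_right))
  refine Conn.of_set g (union_subset (union_subset hKr hMr) hLr) (union_subset (union_subset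
    (hKD.trans (rect_subset le_rfl hbb le_rfl le_rfl))
    (hMD.trans (rect_subset haa hbb le_rfl le_rfl)))
    (hLD.trans (rect_subset haa le_rfl le_rfl le_rfl)))
    ⟨p, Or.inl (Or.inl hp), mem_rect.2 hpX⟩ ⟨q', Or.inr hq', mem_rect.2 hqX'⟩

end Extend

/-! ### Squares -/

/-- A domain given by a rectangle. -/
def rectDom (a b c d : ℝ) : Dom := ⟨rect a b c d, measurableSet_rect a b c d,
  (isCompact_rect a b c d).measure_lt_top.ne⟩

lemma redEv_false_compl (m : ℝ) {D X Y : Set (ℝ × ℝ)} (hD : IsCompact D) (hDc : Convex ℝ D)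
    (hX : IsClosed X) (hY : IsClosed Y) : RedEv (Ev m false D X Y)ᶜ :=
  ⟨(obs_Ev m false hD hDc hX hY).compl, incr_Ev_compl m D X Y⟩

/-- The value of `lam * s ^ 2` above which the process is well spread at scale `s / 16`. -/
def C₀ : ℝ := 73728

lemma exp_neg_le {x : ℝ} (hx : 32 ≤ x) : Real.exp (-x) ≤ 1 / 2 ^ 32 := by
  have h1 : (2 : ℝ) ≤ Real.exp 1 := by have := Real.add_one_le_exp (1 : ℝ); linarith
  have h2 : (2 : ℝ) ^ 32 ≤ Real.exp 32 := by
    calc (2 : ℝ) ^ 32 ≤ Real.exp 1 ^ 32 := by gcongr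
      _ = Real.exp 32 := by rw [← Real.exp_nat_mul]; norm_num
  rw [Real.exp_neg, ← one_div]
  exact one_div_le_one_div_of_le (by positivity) (h2.trans (Real.exp_le_exp.2 hx))

section Seeds

variable {lam : ℝ≥0} {s : ℝ}

/-- A bound in a rectangle from the probability for one process. -/
lemma BR.of_pr {m a b c d x₁ x₂ x₃ x₄ y₁ y₂ y₃ y₄ q A B C E : ℝ} (hm : 0 ≤ m)
    (hq : q ≤ pr (Lam lam (rectDom A B C E))
      (Ev m true (rect a b c d) (rect x₁ x₂ x₃ x₄) (rect y₁ y₂ y₃ y₄)))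
    (h1 : A ≤ a - m := by linarith) (h2 : b + m ≤ B := by linarith)
    (h3 : C ≤ c - m := by linarith) (h4 : d + m ≤ E := by linarith) :
    BR univ lam m a b c d x₁ x₂ x₃ x₄ y₁ y₂ y₃ y₄ q :=
  Bd.of_dom (measurableSet_rect _ _ _ _) (redEv_rect _ _ _ _ _ _ _ _ _ _ _ _ _)
    (dep_rect m true hm le_rfl le_rfl le_rfl le_rfl) (R := rectDom A B C E)
    (by rw [univ_inter]; exact inter_eq_right.2 (rect_subset h1 h2 h3 h4)) hq

lemma BR.le_pr {m a b c d x₁ x₂ x₃ x₄ y₁ y₂ y₃ y₄ q A B C E : ℝ}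
    (h : BR univ lam m a b c d x₁ x₂ x₃ x₄ y₁ y₂ y₃ y₄ q)
    (h1 : A ≤ a - m := by linarith) (h2 : b + m ≤ B := by linarith)
    (h3 : C ≤ c - m := by linarith) (h4 : d + m ≤ E := by linarith) :
    q ≤ pr (Lam lam (rectDom A B C E))
      (Ev m true (rect a b c d) (rect x₁ x₂ x₃ x₄) (rect y₁ y₂ y₃ y₄)) :=
  h.le _ (by rw [univ_inter]; exact inter_eq_right.2 (rect_subset h1 h2 h3 h4))

/-- Squares are crossed with probability almost one half. -/
lemma LR.square (hs : 0 < s) (hC : C₀ ≤ lam * s ^ 2) : LR lam (s / 16) 0 s 0 s (49 / 100) := by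
  have hm : 0 < s / 16 := by positivity
  set R := rectDom (-s) (2 * s) (-s) (2 * s) with hR
  have e1 : pr (Lam lam R) (Cov (s / 16) (rect 0 s 0 s))ᶜ ≤ 1 / 100 := by
    refine (pr_not_cov_le lam R hm (by linarith) (by linarith)
      (rect_subset (by linarith) (by linarith) (by linarith) (by linarith))).trans ?_
    have h1 : err lam (s / 16) (s - 0) (s - 0) = 2304 * Real.exp (-(lam * s ^ 2 / 2304)) := by
      rw [err]; field_simp; ring_nf
    have h2 := exp_neg_le (x := lam * s ^ 2 / 2304) (by rw [C₀] at hC; linarith)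
    rw [h1]; norm_num at h2 ⊢; linarith
  have e2 : (univ : Set (Set CPt)) ⊆ univ := Subset.rfl
  have e3 : (1 : ℝ) ≤ pr (Lam lam R) (Cov (s / 16) (rect 0 s 0 s))ᶜ +
      (pr (Lam lam R) (Ev (s / 16) true (rect 0 s 0 s) (rect 0 0 0 s) (rect s s 0 s)) +
       pr (Lam lam R) (Ev (s / 16) false (rect 0 s 0 s) (rect 0 s 0 0) (rect 0 s s s))) := by
    rw [← pr_univ (Lam lam R)]
    refine (pr_mono_finite _ (B := _ ∪ (_ ∪ _)) fun S hS _ => ?_).trans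
      ((pr_union_le _ _ _).trans (add_le_add_right (pr_union_le _ _ _) _))
    by_cases h : S ∈ Cov (s / 16) (rect 0 s 0 s)
    · exact Or.inr (conn_rect_or hS hs.le hs.le h true)
    · exact Or.inl h
  rw [pr_false_eq _ _ _ (isCompact_rect _ _ _ _) (convex_rect _ _ _ _) (isClosed_rect _ _ _ _)
    (isClosed_rect _ _ _ _)] at e3
  have e4 : TB lam (s / 16) 0 s 0 s _ := BR.of_pr (A := -s) (B := 2 * s) (C := -s) (E := 2 * s)
    hm.le le_rfl
  have e5 := BR.le_pr (A := -s) (B := 2 * s) (C := -s) (E := 2 * s)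
      (e4.swap hm.le : LR lam _ _ _ _ _ _)
  exact BR.of_pr (A := -s) (B := 2 * s) (C := -s) (E := 2 * s) hm.le (by linarith)

lemma LR.square_trans (hs : 0 < s) (hC : C₀ ≤ lam * s ^ 2) (u v : ℝ) :
    LR lam (s / 16) u (u + s) v (v + s) (49 / 100) := by
  simpa only [zero_add, add_comm s] using (LR.square hs hC).trans (by positivity) u v

lemma TB.square_trans (hs : 0 < s) (hC : C₀ ≤ lam * s ^ 2) (u v : ℝ) :
    TB lam (s / 16) u (u + s) v (v + s) (49 / 100) :=
  (LR.square_trans hs hC v u).swap (by positivity)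

/-- Connections in `[0, s] × [-s / 2, s / 2]` from `{0} × [α, β]` to the right side. -/
abbrev Arm (lam : ℝ≥0) (s α β q : ℝ) : Prop :=
  BR univ lam (s / 16) 0 s (-(s / 2)) (s / 2) 0 0 α β s s (-(s / 2)) (s / 2) q

lemma Ev_union_left {m : ℝ} {b : Bool} {D X X' X'' Y : Set (ℝ × ℝ)} (h : X ⊆ X' ∪ X'') :
    Ev m b D X Y ⊆ Ev m b D X' Y ∪ Ev m b D X'' Y := by
  rintro S ⟨x, hx, y, hy, hxy⟩
  exact (h hx).imp (fun h => ⟨x, h, y, hy, hxy⟩) fun h => ⟨x, h, y, hy, hxy⟩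

lemma rect_split (x₁ x₂ : ℝ) (a b c : ℝ) : rect x₁ x₂ a c ⊆ rect x₁ x₂ a b ∪ rect x₁ x₂ b c := by
  intro p hp
  rw [mem_rect] at hp
  rcases le_total p.2 b with h | h
  · exact Or.inl (mem_rect.2 ⟨hp.1, hp.2.1, h⟩)
  · exact Or.inr (mem_rect.2 ⟨hp.1, h, hp.2.2⟩)

lemma Arm.half (hs : 0 < s) (hC : C₀ ≤ lam * s ^ 2) : Arm lam s 0 (s / 2) (49 / 200) := by
  have hm : 0 ≤ s / 16 := by positivity
  have e1 := (LR.square_trans hs hC 0 (-(s / 2))).le_pr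
    (A := -s) (B := 2 * s) (C := -s) (E := s)
  rw [zero_add, show -(s / 2) + s = s / 2 by ring] at e1
  have e2 := e1.trans ((pr_mono _ (Ev_union_left (rect_split 0 0 (-(s / 2)) 0 (s / 2)))).trans
    (pr_union_le _ _ _))
  have e3 : BR univ lam (s / 16) 0 s (-(s / 2)) (s / 2) 0 0 (-(s / 2)) 0 s s (-(s / 2)) (s / 2) _ :=
    BR.of_pr (A := -s) (B := 2 * s) (C := -s) (E := s) hm le_rfl
  have e4 := (e3.refY (H' := univ) hm).le_pr (A := -s) (B := 2 * s) (C := -s) (E := s)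
  simp only [neg_neg, neg_zero] at e4
  exact BR.of_pr (A := -s) (B := 2 * s) (C := -s) (E := s) hm (by linarith)

lemma Arm.or (hs : 0 < s) (hC : C₀ ≤ lam * s ^ 2) (β : ℝ) :
    Arm lam s 0 β (3 / 25) ∨ Arm lam s β (s / 2) (3 / 25) := by
  have hm : 0 ≤ s / 16 := by positivity
  have e1 := (Arm.half hs hC).le_pr (A := -s) (B := 2 * s) (C := -s) (E := s)
  have e2 := e1.trans ((pr_mono _ (Ev_union_left (rect_split 0 0 0 β (s / 2)))).trans
    (pr_union_le _ _ _))
  by_contra! h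
  have h1 := not_le.1 fun hq => h.1 (BR.of_pr (A := -s) (B := 2 * s) (C := -s) (E := s) hm hq)
  have h2 := not_le.1 fun hq => h.2 (BR.of_pr (A := -s) (B := 2 * s) (C := -s) (E := s) hm hq)
  linarith

end Seeds

section Extend

variable {lam : ℝ≥0} {s : ℝ}

/-- The bound after doubling the excess length of a crossing. -/
noncomputable def dbl (q : ℝ) : ℝ := q * q * (49 / 100)

lemma dbl_iter_pos {q : ℝ} (hq : 0 < q) (k : ℕ) : 0 < dbl^[k] q := by
  induction k with
  | zero => exact hq
  | succ k ih => rw [Function.iterate_succ_apply', dbl]; positivity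

lemma LR.double {m h e q : ℝ} (hl : LR lam m 0 (h + e) 0 h q) (hh : 0 < h) (he : 0 ≤ e)
    (hC : C₀ ≤ lam * h ^ 2) (hm : h / 16 ≤ m) (hq : 0 ≤ q) :
    LR lam m 0 (h + 2 * e) 0 h (dbl q) := by
  have hm0 : 0 ≤ m := by linarith
  have h2 := hl.trans (H' := univ) hm0 e 0
  have h3 := TB.square_trans hh hC e 0
  simp only [zero_add, add_zero] at h2 h3
  rw [add_comm e h] at h3
  have := LR.join hl h2 h3 hm0 hm0 (by positivity) le_rfl le_rfl hm he (by linarith) hq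
      (by norm_num)
  rwa [show h + e + e = h + 2 * e by ring] at this

lemma LR.iterate {m h e q : ℝ} (hl : LR lam m 0 (h + e) 0 h q) (hh : 0 < h) (he : 0 ≤ e)
    (hC : C₀ ≤ lam * h ^ 2) (hm : h / 16 ≤ m) (hq : 0 < q) (k : ℕ) :
    LR lam m 0 (h + 2 ^ k * e) 0 h (dbl^[k] q) := by
  induction k with
  | zero => simpa using hl
  | succ k ih =>
    rw [Function.iterate_succ_apply']
    have := ih.double hh (by positivity) hC hm (dbl_iter_pos hq k).le
    rwa [show h + 2 * (2 ^ k * e) = h + 2 ^ (k + 1) * e by ring] at this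

lemma LR.shorten {m a b b' c d q : ℝ} (h : LR lam m a b' c d q) (hm : 0 ≤ m) (hab : a ≤ b)
    (hb : b ≤ b') : LR lam m a b c d q := by
  refine BR.of_pr (A := a - m) (B := b' + m) (C := c - m) (E := d + m) hm ((h.le_pr).trans
    (pr_mono _ fun S hS => ?_))
  obtain ⟨K, hK, hKr, hKD, ⟨p, hp, hpX⟩, p', hp', hpX'⟩ := Conn.exists_set hS hm le_rfl
  rw [mem_rect] at hpX hpX'
  obtain ⟨L, hLK, hL, hLf, ⟨r, hr, hra⟩, r', hr', hra'⟩ := exists_strip hK continuous_fst hab hp hp'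
    hpX.1.2 (hb.trans hpX'.1.1)
  have hLD : L ⊆ rect a b c d := fun z hz =>
    mem_rect.2 ⟨hLf z hz, (mem_rect.1 (hKD (hLK hz))).2⟩
  exact Conn.of_set hL (hLK.trans hKr) hLD
    ⟨r, hr, mem_rect.2 ⟨⟨hra.ge, hra.le⟩, (mem_rect.1 (hLD hr)).2⟩⟩
    ⟨r', hr', mem_rect.2 ⟨⟨hra'.ge, hra'.le⟩, (mem_rect.1 (hLD hr')).2⟩⟩

/-- The bound for crossings of `3 s × s` rectangles in the long direction. -/
abbrev RSW (lam : ℝ≥0) (s c : ℝ) : Prop := LR lam (s / 4) 0 (3 * s) 0 s c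

/-- Crossings of elongated rectangles. -/
lemma RSW.long {c : ℝ} (h : RSW lam s c) (hs : 0 < s) (hC : C₀ ≤ lam * s ^ 2) (hc : 0 < c) {k : ℕ}
    {L : ℝ} (hL0 : 0 ≤ L) (hL : L ≤ 2 ^ k * s) : LR lam (s / 4) 0 L 0 s (dbl^[k] c) := by
  have h1 : LR lam (s / 4) 0 (s + 2 * s) 0 s c := by convert h using 1; ring
  have h2 := h1.iterate hs (by positivity) hC (by linarith) hc k
  refine h2.shorten (by positivity) hL0 ?_
  have : 0 ≤ 2 ^ k * s := by positivity
  linarith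

lemma RSW.grow {c s' : ℝ} (h : RSW lam s c) (hs : 0 < s) (hC : C₀ ≤ lam * s ^ 2) (hc : 0 < c)
    {k : ℕ} (hs' : s ≤ s') (hk : 3 * s' ≤ 2 ^ k * s) : RSW lam s' (dbl^[k] c) :=
  (h.long hs hC hc (by linarith) hk).mono (by positivity)

/-- The bound obtained at good scales. -/
noncomputable def cGood : ℝ := dbl^[5] ((3 / 25) ^ 6 * (49 / 100))

lemma cGood_pos : 0 < cGood := dbl_iter_pos (by norm_num) 5

/-- A path that starts on the left side of a square between the starting points of two
crossings of the square is joined to these crossings. -/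
lemma isPathConnected_ladder {t B C : ℝ} {K₁ K₂ K₅ F : Set (ℝ × ℝ)} (k1 : IsPathConnected K₁)
    (k2 : IsPathConnected K₂) (k5 : IsPathConnected K₅) (kF : IsPathConnected F) (hB : B ≤ -t)
    (hC : t ≤ C) (ht : 0 ≤ t)
    (D1 : K₁ ⊆ rect 0 (2 * t) (-t) t) (D2 : K₂ ⊆ rect 0 (2 * t) (-t) t)
    (D5 : K₅ ⊆ rect 0 (2 * t) (-t) t) (DF : F ⊆ rect 0 (3 * t) B C) {p1 q1 p2 q2 p5 q5 p q : ℝ × ℝ}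
    (hp1 : p1 ∈ K₁) (hq1 : q1 ∈ K₁) (hp2 : p2 ∈ K₂) (hq2 : q2 ∈ K₂) (hp5 : p5 ∈ K₅)
    (hq5 : q5 ∈ K₅) (hp : p ∈ F) (hq : q ∈ F) (e1 : p1.1 = 0) (e1' : q1.1 = 2 * t) (e2 : p2.1 = 0)
    (e2' : q2.1 = 2 * t) (e5 : p5.2 = -t) (e5' : q5.2 = t) (e : p.1 = 0) (e' : q.1 = 3 * t)
    (hle : p.2 ≤ p1.2) (hle' : p2.2 ≤ p.2) :
    IsPathConnected (((K₅ ∪ K₁) ∪ (K₅ ∪ K₂)) ∪ F) := by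
  have i1 : (K₅ ∩ K₁).Nonempty := by
    rw [inter_comm]
    exact meet k1 k5 hp1 hq1 hp5 hq5 (fun z hz => by rw [e1, e1']; exact (mem_rect.1 (D5 hz)).1)
      (fun z hz => by rw [e5, e5']; exact (mem_rect.1 (D1 hz)).2)
  have i2 : (K₅ ∩ K₂).Nonempty := by
    rw [inter_comm]
    exact meet k2 k5 hp2 hq2 hp5 hq5 (fun z hz => by rw [e2, e2']; exact (mem_rect.1 (D5 hz)).1)
      (fun z hz => by rw [e5, e5']; exact (mem_rect.1 (D2 hz)).2)
  have u := (k5.union k1 i1).union (k5.union k2 i2) ⟨_, Or.inl hp5, Or.inl hp5⟩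
  have D : (K₅ ∪ K₁) ∪ (K₅ ∪ K₂) ⊆ rect 0 (3 * t) B C :=
    (union_subset (union_subset D5 D1) (union_subset D5 D2)).trans
      (rect_subset le_rfl (by linarith) hB hC)
  refine u.union kF ?_
  rw [inter_comm]
  exact joinedIn_trap DF D (kF.joinedIn p hp q hq) (u.joinedIn p2 (Or.inr (Or.inr hp2)) p1
    (Or.inl (Or.inr hp1))) e e' (Or.inr ⟨e2, hle'⟩) (Or.inr ⟨e1, hle⟩)

/-- Long connections from a window below the connections of a smaller square make a crossing. -/
lemma Arm.glue {t β β' : ℝ} (ht : 0 < t) (hC : C₀ ≤ lam * (2 * t) ^ 2)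
    (hW : Arm lam (2 * t) β' ((2 * t) / 2) (3 / 25)) (hH : Arm lam (3 * t) 0 β (3 / 25))
    (hβ0 : 0 ≤ β) (hβt : β ≤ 3 * t / 2) (hβ : β ≤ 2 * β') :
    LR lam (3 * t / 16) (-t) (3 * t) (-(9 / 4 * t)) (3 / 2 * t) ((3 / 25) ^ 6 * (49 / 100)) := by
  have hm : 0 ≤ 2 * t / 16 := by positivity
  have hm' : 0 ≤ 3 * t / 16 := by positivity
  replace hW : BR univ lam (2 * t / 16) 0 (2 * t) (-t) t 0 0 β' t (2 * t) (2 * t) (-t) t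
      (3 / 25) := by
    simpa only [Arm, show 2 * t / 2 = t by ring] using hW
  have w2 := hW.refY (H' := univ) hm
  have w3 := (hW.refX (H' := univ) hm).trans (H' := univ) hm (2 * t) 0
  have w4 := (w2.refX (H' := univ) hm).trans (H' := univ) hm (2 * t) 0
  have w5 := TB.square_trans (s := 2 * t) (by positivity) hC 0 (-t)
  have h1 := hH.trans (H' := univ) hm' 0 (-(β / 2))
  have h2 := (h1.refX (H' := univ) hm').trans (H' := univ) hm' (2 * t) 0
  simp only [neg_neg, neg_zero, zero_add, add_zero, neg_add_cancel,
    show -t + 2 * t = t by ring] at w2 w3 w4 w5 h1 h2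
  let W := rect (-t - 3 * t / 16) (3 * t + 3 * t / 16) (-(9 / 4 * t) - 3 * t / 16)
    (3 / 2 * t + 3 * t / 16)
  have b1 : Bd univ lam W _ _ := hW.toBd
  have b2 : Bd univ lam W _ _ := w2.toBd
  have b3 : Bd univ lam W _ _ := w3.toBd
  have b4 : Bd univ lam W _ _ := w4.toBd
  have b5 : Bd univ lam W _ _ := w5.toBd
  have b6 : Bd univ lam W _ _ := h1.toBd
  have b7 : Bd univ lam W _ _ := h2.toBd
  have b := (((((b1.inter b2 (by norm_num)).inter b3 (by norm_num)).inter b4 (by norm_num)).inter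
    b5 (by norm_num)).inter b6 (by norm_num)).inter b7 (by norm_num)
  have k : 2 * t / 16 ≤ 3 * t / 16 := by linarith
  have hβ2 : -(β / 2) ≤ β / 2 := by linarith
  refine (b.mono Subset.rfl (c' := (3 / 25) ^ 6 * (49 / 100)) (by norm_num)).toBR hm' ?_
  clear b b1 b2 b3 b4 b5 b6 b7 w2 w3 w4 w5 h1 h2 hW hH W
  rintro S - ⟨⟨⟨⟨⟨⟨g1, g2⟩, g3⟩, g4⟩, g5⟩, g6⟩, g7⟩
  obtain ⟨K₁, k1, k1r, k1D, ⟨p1, hp1, hp1X⟩, q1, hq1, hq1Y⟩ := Conn.exists_set g1 hm k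
  obtain ⟨K₂, k2, k2r, k2D, ⟨p2, hp2, hp2X⟩, q2, hq2, hq2Y⟩ := Conn.exists_set g2 hm k
  obtain ⟨K₃, k3, k3r, k3D, ⟨p3, hp3, hp3X⟩, q3, hq3, hq3Y⟩ := Conn.exists_set g3 hm k
  obtain ⟨K₄, k4, k4r, k4D, ⟨p4, hp4, hp4X⟩, q4, hq4, hq4Y⟩ := Conn.exists_set g4 hm k
  obtain ⟨K₅, k5, k5r, k5D, ⟨p5, hp5, hp5X⟩, q5, hq5, hq5Y⟩ := Conn.exists_set g5 hm k
  obtain ⟨K₆, k6, k6r, k6D, ⟨p6, hp6, hp6X⟩, q6, hq6, hq6Y⟩ := Conn.exists_set g6 hm' le_rfl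
  obtain ⟨K₇, k7, k7r, k7D, ⟨p7, hp7, hp7X⟩, q7, hq7, hq7Y⟩ := Conn.exists_set g7 hm' le_rfl
  clear g1 g2 g3 g4 g5 g6 g7
  rw [mem_rect] at hp1X hq1Y hp2X hq2Y hp3X hq3Y hp4X hq4Y hp5X hq5Y hp6X hq6Y hp7X hq7Y
  have k6D' : K₆ ⊆ rect 0 (3 * t) (-(9 / 4 * t)) (3 / 2 * t) :=
    k6D.trans (rect_subset le_rfl le_rfl (by linarith) (by linarith))
  have k7D' : K₇ ⊆ rect (-t) (2 * t) (-(9 / 4 * t)) (3 / 2 * t) :=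
    k7D.trans (rect_subset (by linarith) le_rfl (by linarith) (by linarith))
  have v1 := isPathConnected_ladder k1 k2 k5 k6 (by linarith) (by linarith) ht.le k1D k2D k5D k6D'
    hp1 hq1 hp2 hq2 hp5 hq5 hp6 hq6 (le_antisymm hp1X.1.2 hp1X.1.1) (le_antisymm hq1Y.1.2 hq1Y.1.1)
    (le_antisymm hp2X.1.2 hp2X.1.1) (le_antisymm hq2Y.1.2 hq2Y.1.1) (le_antisymm hp5X.2.2 hp5X.2.1)
    (le_antisymm hq5Y.2.2 hq5Y.2.1) (le_antisymm hp6X.1.2 hp6X.1.1) (le_antisymm hq6Y.1.2 hq6Y.1.1)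
    (by linarith [hp6X.2.2, hp1X.2.1]) (by linarith [hp6X.2.1, hp2X.2.2])
  let σ : ℝ × ℝ → ℝ × ℝ := fun z => (2 * t - z.1, z.2)
  have hσ : Continuous σ := by fun_prop
  have hσσ : ∀ A, σ '' (σ '' A) = A := fun A => by
    rw [image_image]; simp [σ]
  have hσr : ∀ {A : Set (ℝ × ℝ)} {a b a' b' c d}, A ⊆ rect a b c d → a' ≤ 2 * t - b →
      2 * t - a ≤ b' →
      σ '' A ⊆ rect a' b' c d := by
    rintro A a b a' b' c d h h1 h2 _ ⟨z, hz, rfl⟩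
    have := mem_rect.1 (h hz)
    exact mem_rect.2 ⟨⟨by dsimp only [σ]; linarith, by dsimp only [σ]; linarith⟩, this.2⟩
  have v2 := (isPathConnected_ladder (k3.image hσ) (k4.image hσ) (k5.image hσ) (k7.image hσ)
    (B := -(9 / 4 * t)) (C := 3 / 2 * t) (by linarith) (by linarith) ht.le
    (hσr k3D (by linarith) (by linarith)) (hσr k4D (by linarith) (by linarith))
    (hσr k5D (by linarith) (by linarith)) (hσr k7D' (by linarith) (by linarith))
    (mem_image_of_mem σ hp3) (mem_image_of_mem σ hq3) (mem_image_of_mem σ hp4)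
    (mem_image_of_mem σ hq4) (mem_image_of_mem σ hp5) (mem_image_of_mem σ hq5)
    (mem_image_of_mem σ hp7) (mem_image_of_mem σ hq7)
    (by dsimp only [σ]; linarith [hp3X.1.1, hp3X.1.2])
    (by dsimp only [σ]; linarith [hq3Y.1.1, hq3Y.1.2])
    (by dsimp only [σ]; linarith [hp4X.1.1, hp4X.1.2])
    (by dsimp only [σ]; linarith [hq4Y.1.1, hq4Y.1.2]) (le_antisymm hp5X.2.2 hp5X.2.1)
    (le_antisymm hq5Y.2.2 hq5Y.2.1) (by dsimp only [σ]; linarith [hp7X.1.1, hp7X.1.2])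
    (by dsimp only [σ]; linarith [hq7Y.1.1, hq7Y.1.2])
    (by dsimp only [σ]; linarith [hp7X.2.2, hp3X.2.1])
    (by dsimp only [σ]; linarith [hp7X.2.1, hp4X.2.2])).image hσ
  simp only [image_union, hσσ] at v2
  have v := v2.union v1 ⟨_, Or.inl (Or.inl (Or.inl hp5)), Or.inl (Or.inl (Or.inl hp5))⟩
  have j5 : K₅ ⊆ rect (-t) (3 * t) (-(9 / 4 * t)) (3 / 2 * t) :=
    k5D.trans (rect_subset (by linarith) (by linarith) (by linarith) (by linarith))
  have j : ∀ {A : Set (ℝ × ℝ)}, A ⊆ rect 0 (2 * t) (-t) t →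
      A ⊆ rect (-t) (3 * t) (-(9 / 4 * t)) (3 / 2 * t) := fun h =>
    h.trans (rect_subset (by linarith) (by linarith) (by linarith) (by linarith))
  have j6 := k6D'.trans (rect_subset (a' := -t) (b' := 3 * t) (by linarith) le_rfl le_rfl le_rfl)
  have j7 := k7D'.trans (rect_subset (a' := -t) (b' := 3 * t) le_rfl (by linarith) le_rfl le_rfl)
  refine Conn.of_set v ?_ ?_ ⟨q7, Or.inl (Or.inr hq7), mem_rect.2 ?_⟩
    ⟨q6, Or.inr (Or.inr hq6), mem_rect.2 ⟨hq6Y.1, (mem_rect.1 (k6D' hq6)).2⟩⟩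
  · simp only [union_subset_iff]
    exact ⟨⟨⟨⟨k5r, k3r⟩, k5r, k4r⟩, k7r⟩, ⟨⟨k5r, k1r⟩, k5r, k2r⟩, k6r⟩
  · simp only [union_subset_iff]
    exact ⟨⟨⟨⟨j5, j k3D⟩, j5, j k4D⟩, j7⟩, ⟨⟨j5, j k1D⟩, j5, j k2D⟩, j6⟩
  · exact ⟨⟨by linarith [hq7Y.1.1], by linarith [hq7Y.1.2]⟩, (mem_rect.1 (k7D' hq7)).2⟩

/-- Good scales have crossings in the long direction. -/
lemma RSW.of_arms {t β β' : ℝ} (ht : 0 < t) (hC : C₀ ≤ lam * (2 * t) ^ 2)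
    (hW : Arm lam (2 * t) β' ((2 * t) / 2) (3 / 25)) (hH : Arm lam (3 * t) 0 β (3 / 25))
    (hβ0 : 0 ≤ β) (hβt : β ≤ 3 * t / 2) (hβ : β ≤ 2 * β') :
    RSW lam (15 / 4 * t) cGood := by
  have h1 := (Arm.glue ht hC hW hH hβ0 hβt hβ).trans (H' := univ) (by positivity) t (9 / 4 * t)
  have h2 : LR lam (15 / 4 * t / 4) 0 (15 / 4 * t + t / 4) 0 (15 / 4 * t)
      ((3 / 25) ^ 6 * (49 / 100)) :=
    h1.mono (by positivity)
  have hC' : C₀ ≤ lam * (15 / 4 * t) ^ 2 := hC.trans (by gcongr; linarith)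
  have h3 := h2.iterate (by positivity) (by positivity) hC' (by linarith) (by norm_num) 5
  exact h3.shorten (by positivity) (by positivity) (by linarith)

end Extend

/-! ### Circuits and the one-arm bound -/

section Ring

variable {lam : ℝ≥0}

lemma mul_le_pr_inter (Λ : Measure CPt) [IsFiniteMeasure Λ] {A B : Set (Set CPt)}
    (hA : RedEv Aᶜ) (hB : RedEv Bᶜ) {c c' : ℝ} (h : c ≤ pr Λ A) (h' : c' ≤ pr Λ B) (hc : 0 ≤ c') :
    c * c' ≤ pr Λ (A ∩ B) := by
  have oA : Obs A := by simpa using hA.obs.compl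
  have oB : Obs B := by simpa using hB.obs.compl
  have h1 := RedEv.inter_le Λ hA hB oB
  have h2 := pr_inter_add_diff Λ (A := B) oA
  rw [pr_compl Λ oA, inter_comm, ← sdiff_eq] at h1
  rw [inter_comm A B]
  have := mul_le_mul h h' hc (pr_nonneg _ _)
  nlinarith

/-- The circuit of colour `col` around `(x, y)` made of four crossings of rectangles. -/
def Ring (col : Bool) (m u x y : ℝ) : Set (Set CPt) :=
  ((Ev m col (rect (x - 3 * u) (x + 3 * u) (y + u) (y + 3 * u))
      (rect (x - 3 * u) (x - 3 * u) (y + u) (y + 3 * u))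
      (rect (x + 3 * u) (x + 3 * u) (y + u) (y + 3 * u)) ∩
    Ev m col (rect (x - 3 * u) (x + 3 * u) (y - 3 * u) (y - u))
      (rect (x - 3 * u) (x - 3 * u) (y - 3 * u) (y - u))
      (rect (x + 3 * u) (x + 3 * u) (y - 3 * u) (y - u))) ∩
    Ev m col (rect (x - 3 * u) (x - u) (y - 3 * u) (y + 3 * u))
      (rect (x - 3 * u) (x - u) (y - 3 * u) (y - 3 * u))
      (rect (x - 3 * u) (x - u) (y + 3 * u) (y + 3 * u))) ∩
    Ev m col (rect (x + u) (x + 3 * u) (y - 3 * u) (y + 3 * u))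
      (rect (x + u) (x + 3 * u) (y - 3 * u) (y - 3 * u))
      (rect (x + u) (x + 3 * u) (y + 3 * u) (y + 3 * u))

lemma RSW.rects {u c : ℝ} (h : RSW lam (2 * u) c) (hu : 0 < u) (x y : ℝ) :
    LR lam (u / 2) (x - 3 * u) (x + 3 * u) (y + u) (y + 3 * u) c ∧
    LR lam (u / 2) (x - 3 * u) (x + 3 * u) (y - 3 * u) (y - u) c ∧
    TB lam (u / 2) (x - 3 * u) (x - u) (y - 3 * u) (y + 3 * u) c ∧
    TB lam (u / 2) (x + u) (x + 3 * u) (y - 3 * u) (y + 3 * u) c := by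
  have hm : 0 ≤ 2 * u / 4 := by positivity
  have h1 : ∀ x' y', LR lam (u / 2) (x' - 3 * u) (x' + 3 * u) y' (y' + 2 * u) c := fun x' y' => by
    have := h.trans (H' := univ) hm (x' - 3 * u) y'
    convert this using 1 <;> ring
  have h2 : ∀ x' y', TB lam (u / 2) x' (x' + 2 * u) (y' - 3 * u) (y' + 3 * u) c := fun x' y' =>
    (h1 y' x').swap (by positivity)
  refine ⟨?_, ?_, ?_, ?_⟩
  · convert h1 x (y + u) using 1
    ring
  · convert h1 x (y - 3 * u) using 1; ring
  · convert h2 (x - 3 * u) y using 1; ring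
  · convert h2 (x + u) y using 1; ring

lemma obs_rect (m : ℝ) (col : Bool) (a b c d x₁ x₂ x₃ x₄ y₁ y₂ y₃ y₄ : ℝ) :
    Obs (Ev m col (rect a b c d) (rect x₁ x₂ x₃ x₄) (rect y₁ y₂ y₃ y₄)) :=
  obs_Ev m col (isCompact_rect _ _ _ _) (convex_rect _ _ _ _) (isClosed_rect _ _ _ _)
    (isClosed_rect _ _ _ _)

lemma obs_ring (col : Bool) (m u x y : ℝ) : Obs (Ring col m u x y) :=
  (((obs_rect _ _ _ _ _ _ _ _ _ _ _ _ _ _).inter (obs_rect _ _ _ _ _ _ _ _ _ _ _ _ _ _)).inter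
    (obs_rect _ _ _ _ _ _ _ _ _ _ _ _ _ _)).inter (obs_rect _ _ _ _ _ _ _ _ _ _ _ _ _ _)

/-- The set on which the ring around `(x, y)` depends. -/
lemma dep_ring (col : Bool) {u x y : ℝ} (hu : 0 < u) {W : Set (ℝ × ℝ)}
    (hW : ∀ p ∈ rect (x - 7 / 2 * u) (x + 7 / 2 * u) (y - 7 / 2 * u) (y + 7 / 2 * u),
      (u / 2 ≤ |p.1 - x| ∨ u / 2 ≤ |p.2 - y|) → p ∈ W) :
    Dep (W ×ˢ univ) (Ring col (u / 2) u x y) := by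
  have key : ∀ {a b c d : ℝ} {X Y : Set (ℝ × ℝ)}, (∀ p ∈ rect (a - u / 2) (b + u / 2) (c - u / 2)
      (d + u / 2), p ∈ W) → Dep (W ×ˢ univ) (Ev (u / 2) col (rect a b c d) X Y) := fun h =>
    dep_mono (prod_mono ((nb_rect_subset (by positivity)).trans h) Subset.rfl) (dep_Ev _ _ _ _ _)
  refine dep_inter (dep_inter (dep_inter ?_ ?_) ?_) ?_ <;> refine key fun p hp => ?_ <;>
    rw [mem_rect] at hp <;> refine hW p (mem_rect.2 ⟨⟨?_, ?_⟩, ?_, ?_⟩) ?_ <;> try linarith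
  · exact Or.inr (le_trans (by linarith) (le_abs_self _))
  · exact Or.inr (le_trans (by linarith) (neg_le_abs _))
  · exact Or.inl (le_trans (by linarith) (neg_le_abs _))
  · exact Or.inl (le_trans (by linarith) (le_abs_self _))

lemma RSW.ring_le {u c : ℝ} (h : RSW lam (2 * u) c) (hu : 0 < u) (hc : 0 ≤ c) (x y : ℝ) (R : Dom)
    (hR : rect (x - 7 / 2 * u) (x + 7 / 2 * u) (y - 7 / 2 * u) (y + 7 / 2 * u) ⊆ R.s) :
    c * c * c * c ≤ pr (Lam lam R) (Ring false (u / 2) u x y) := by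
  obtain ⟨h1, h2, h3, h4⟩ := h.rects hu x y
  have key : ∀ {a b c' d x₁ x₂ x₃ x₄ y₁ y₂ y₃ y₄ : ℝ},
      BR univ lam (u / 2) a b c' d x₁ x₂ x₃ x₄ y₁ y₂ y₃ y₄ c →
      rect (a - u / 2) (b + u / 2) (c' - u / 2) (d + u / 2) ⊆ R.s → c ≤ pr (Lam lam R)
      (Ev (u / 2) false (rect a b c' d) (rect x₁ x₂ x₃ x₄) (rect y₁ y₂ y₃ y₄)) := by
    intro a b c' d x₁ x₂ x₃ x₄ y₁ y₂ y₃ y₄ h hs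
    rw [pr_false_eq _ _ _ (isCompact_rect _ _ _ _) (convex_rect _ _ _ _) (isClosed_rect _ _ _ _)
      (isClosed_rect _ _ _ _)]
    exact h.le R (by rw [univ_inter]; exact inter_eq_right.2 hs)
  have hF : ∀ {a b c' d x₁ x₂ x₃ x₄ y₁ y₂ y₃ y₄ : ℝ}, RedEv
      (Ev (u / 2) false (rect a b c' d) (rect x₁ x₂ x₃ x₄) (rect y₁ y₂ y₃ y₄))ᶜ := by
    intros
    exact redEv_false_compl _ (isCompact_rect _ _ _ _) (convex_rect _ _ _ _) (isClosed_rect _ _ _ _)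
      (isClosed_rect _ _ _ _)
  have hU : ∀ {A B : Set (Set CPt)}, RedEv Aᶜ → RedEv Bᶜ → RedEv (A ∩ B)ᶜ := fun h h' => by
    rw [compl_inter]; exact h.union h'
  have s : ∀ {a b c' d}, x - 7 / 2 * u ≤ a → b ≤ x + 7 / 2 * u → y - 7 / 2 * u ≤ c' →
      d ≤ y + 7 / 2 * u → rect a b c' d ⊆ R.s := fun i1 i2 i3 i4 =>
          (rect_subset i1 i2 i3 i4).trans hR
  exact mul_le_pr_inter _ (hU (hU hF hF) hF) hF (mul_le_pr_inter _ (hU hF hF) hF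
    (mul_le_pr_inter _ hF hF
      (key h1 (s (by linarith) (by linarith) (by linarith) (by linarith)))
      (key h2 (s (by linarith) (by linarith) (by linarith) (by linarith))) hc)
      (key h3 (s (by linarith) (by linarith) (by linarith) (by linarith))) hc)
      (key h4 (s (by linarith) (by linarith) (by linarith) (by linarith))) hc

/-- A path from inside a circuit to outside crosses one of the four rectangles. -/
lemma cross_annulus {u x y : ℝ} {F : Set (ℝ × ℝ)} (hF : IsPathConnected F) {p q : ℝ × ℝ}
    (hp : p ∈ F) (hq : q ∈ F) (hpD : p ∈ rect (x - u) (x + u) (y - u) (y + u)) (hu : 0 < u)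
    (hqD : q.1 ≤ x - 3 * u ∨ x + 3 * u ≤ q.1 ∨ q.2 ≤ y - 3 * u ∨ y + 3 * u ≤ q.2) :
    ∃ F' ⊆ F, IsPathConnected F' ∧
      ((F' ⊆ rect (x - 3 * u) (x + 3 * u) (y + u) (y + 3 * u) ∧
          (∃ z ∈ F', z.2 = y + u) ∧ ∃ z ∈ F', z.2 = y + 3 * u) ∨
        (F' ⊆ rect (x - 3 * u) (x + 3 * u) (y - 3 * u) (y - u) ∧
          (∃ z ∈ F', z.2 = y - 3 * u) ∧ ∃ z ∈ F', z.2 = y - u) ∨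
        (F' ⊆ rect (x - 3 * u) (x - u) (y - 3 * u) (y + 3 * u) ∧
          (∃ z ∈ F', z.1 = x - 3 * u) ∧ ∃ z ∈ F', z.1 = x - u) ∨
        (F' ⊆ rect (x + u) (x + 3 * u) (y - 3 * u) (y + 3 * u) ∧
          (∃ z ∈ F', z.1 = x + u) ∧ ∃ z ∈ F', z.1 = x + 3 * u)) := by
  rw [mem_rect] at hpD
  obtain ⟨G, hGF, hG, hGD, hpG, r, hr, h⟩ := exists_exit hF hp hq (A₁ := x - 3 * u)
    (A₂ := x + 3 * u) (B₁ := y - 3 * u) (B₂ := y + 3 * u)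
    (mem_rect.2 ⟨⟨by linarith, by linarith⟩, by linarith, by linarith⟩) hqD
  rcases h with h | h | h | h
  · obtain ⟨F', h1, h2, h3, h4, h5⟩ := exists_strip hG continuous_fst
      (a := x - 3 * u) (b := x - u) (by linarith) hr hpG h.le (by linarith)
    exact ⟨F', h1.trans hGF, h2, Or.inr (Or.inr (Or.inl
      ⟨fun z hz => mem_rect.2 ⟨h3 z hz, (mem_rect.1 (hGD (h1 hz))).2⟩, h4, h5⟩))⟩
  · obtain ⟨F', h1, h2, h3, h4, h5⟩ := exists_strip hG continuous_fst
      (a := x + u) (b := x + 3 * u) (by linarith) hpG hr (by linarith) h.ge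
    exact ⟨F', h1.trans hGF, h2, Or.inr (Or.inr (Or.inr
      ⟨fun z hz => mem_rect.2 ⟨h3 z hz, (mem_rect.1 (hGD (h1 hz))).2⟩, h4, h5⟩))⟩
  · obtain ⟨F', h1, h2, h3, h4, h5⟩ := exists_strip hG continuous_snd
      (a := y - 3 * u) (b := y - u) (by linarith) hr hpG h.le (by linarith)
    exact ⟨F', h1.trans hGF, h2, Or.inr (Or.inl
      ⟨fun z hz => mem_rect.2 ⟨(mem_rect.1 (hGD (h1 hz))).1, h3 z hz⟩, h4, h5⟩)⟩
  · obtain ⟨F', h1, h2, h3, h4, h5⟩ := exists_strip hG continuous_snd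
      (a := y + u) (b := y + 3 * u) (by linarith) hpG hr (by linarith) h.ge
    exact ⟨F', h1.trans hGF, h2, Or.inl
      ⟨fun z hz => mem_rect.2 ⟨(mem_rect.1 (hGD (h1 hz))).1, h3 z hz⟩, h4, h5⟩⟩

lemma meet_rect {a b c d : ℝ} {K L : Set (ℝ × ℝ)} (hK : IsPathConnected K) (hL : IsPathConnected L)
    (hKD : K ⊆ rect a b c d) (hLD : L ⊆ rect a b c d) (k1 : ∃ z ∈ K, z.1 = a) (k2 : ∃ z ∈ K,
      z.1 = b)
    (l1 : ∃ z ∈ L, z.2 = c) (l2 : ∃ z ∈ L, z.2 = d) : (K ∩ L).Nonempty := by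
  obtain ⟨_, hp, rfl⟩ := k1
  obtain ⟨_, hq, rfl⟩ := k2
  obtain ⟨_, hr, rfl⟩ := l1
  obtain ⟨_, hs, rfl⟩ := l2
  exact meet hK hL hp hq hr hs (fun z hz => (mem_rect.1 (hLD hz)).1)
    fun z hz => (mem_rect.1 (hKD hz)).2

lemma Conn.exists_LR {m m' : ℝ} {S : Set CPt} {col : Bool} {a b c d : ℝ}
    (h : Conn m S col (rect a b c d) (rect a a c d) (rect b b c d)) (hm : 0 ≤ m) (hm' : m ≤ m') :
    ∃ K, IsPathConnected K ∧ K ⊆ Reg m' S col ∧ K ⊆ rect a b c d ∧ (∃ z ∈ K, z.1 = a) ∧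
      ∃ z ∈ K, z.1 = b := by
  obtain ⟨K, h1, h2, h3, ⟨p, hp, hpX⟩, q, hq, hqX⟩ := h.exists_set hm hm'
  rw [mem_rect] at hpX hqX
  exact ⟨K, h1, h2, h3, ⟨p, hp, le_antisymm hpX.1.2 hpX.1.1⟩, q, hq, le_antisymm hqX.1.2 hqX.1.1⟩

lemma Conn.exists_TB {m m' : ℝ} {S : Set CPt} {col : Bool} {a b c d : ℝ}
    (h : Conn m S col (rect a b c d) (rect a b c c) (rect a b d d)) (hm : 0 ≤ m) (hm' : m ≤ m') :
    ∃ K, IsPathConnected K ∧ K ⊆ Reg m' S col ∧ K ⊆ rect a b c d ∧ (∃ z ∈ K, z.2 = c) ∧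
      ∃ z ∈ K, z.2 = d := by
  obtain ⟨K, h1, h2, h3, ⟨p, hp, hpX⟩, q, hq, hqX⟩ := h.exists_set hm hm'
  rw [mem_rect] at hpX hqX
  exact ⟨K, h1, h2, h3, ⟨p, hp, le_antisymm hpX.2.2 hpX.2.1⟩, q, hq, le_antisymm hqX.2.2 hqX.2.1⟩

/-- A circuit meets every path from inside to outside. -/
lemma Ring.exists_set {col : Bool} {m m' u x y : ℝ} {S : Set CPt} (h : S ∈ Ring col m u x y)
    (hm : 0 ≤ m) (hm' : m ≤ m') (hu : 0 < u) :
    ∃ K, IsPathConnected K ∧ K ⊆ Reg m' S col ∧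
      K ⊆ rect (x - 3 * u) (x + 3 * u) (y - 3 * u) (y + 3 * u) ∧
      ∀ F, IsPathConnected F → ∀ p ∈ F, ∀ q ∈ F, p ∈ rect (x - u) (x + u) (y - u) (y + u) →
        (q.1 ≤ x - 3 * u ∨ x + 3 * u ≤ q.1 ∨ q.2 ≤ y - 3 * u ∨ y + 3 * u ≤ q.2) →
        (F ∩ K).Nonempty := by
  obtain ⟨⟨⟨h1, h2⟩, h3⟩, h4⟩ := h
  obtain ⟨K₁, k1, r1, D1, l1, l1'⟩ := Conn.exists_LR h1 hm hm'
  obtain ⟨K₂, k2, r2, D2, l2, l2'⟩ := Conn.exists_LR h2 hm hm'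
  obtain ⟨K₃, k3, r3, D3, l3, l3'⟩ := Conn.exists_TB h3 hm hm'
  obtain ⟨K₄, k4, r4, D4, l4, l4'⟩ := Conn.exists_TB h4 hm hm'
  have E1 := D1.trans (rect_subset (a' := x - 3 * u) (b' := x + 3 * u) (c' := y - 3 * u)
    (d' := y + 3 * u) le_rfl le_rfl (by linarith) le_rfl)
  have E2 := D2.trans (rect_subset (a' := x - 3 * u) (b' := x + 3 * u) (c' := y - 3 * u)
    (d' := y + 3 * u) le_rfl le_rfl le_rfl (by linarith))
  have E3 := D3.trans (rect_subset (a' := x - 3 * u) (b' := x + 3 * u) (c' := y - 3 * u)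
    (d' := y + 3 * u) le_rfl (by linarith) le_rfl le_rfl)
  have E4 := D4.trans (rect_subset (a' := x - 3 * u) (b' := x + 3 * u) (c' := y - 3 * u)
    (d' := y + 3 * u) (by linarith) le_rfl le_rfl le_rfl)
  have i13 := meet_rect k1 k3 E1 E3 l1 l1' l3 l3'
  have i23 := meet_rect k2 k3 E2 E3 l2 l2' l3 l3'
  have i14 := meet_rect k1 k4 E1 E4 l1 l1' l4 l4'
  refine ⟨((K₃ ∪ K₁) ∪ K₂) ∪ K₄, (((k3.union k1 (by rwa [inter_comm])).union k2 ?_).union k4 ?_),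
    union_subset (union_subset (union_subset r3 r1) r2) r4,
    union_subset (union_subset (union_subset E3 E1) E2) E4, ?_⟩
  · rw [inter_comm]
    exact i23.mono (inter_subset_inter_right _ subset_union_left)
  · exact i14.mono (inter_subset_inter_left _ fun z hz => Or.inl (Or.inr hz))
  · intro F hF p hp q hq hpD hqD
    obtain ⟨F', hF', f, h | h | h | h⟩ := cross_annulus hF hp hq hpD hu hqD
    · rw [inter_comm]
      exact (meet_rect k1 f D1 h.1 l1 l1' h.2.1 h.2.2).mono
        (inter_subset_inter (fun z hz => Or.inl (Or.inl (Or.inr hz))) hF')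
    · rw [inter_comm]
      exact (meet_rect k2 f D2 h.1 l2 l2' h.2.1 h.2.2).mono
        (inter_subset_inter (fun z hz => Or.inl (Or.inr hz)) hF')
    · exact (meet_rect f k3 h.1 D3 h.2.1 h.2.2 l3 l3').mono
        (inter_subset_inter hF' (fun z hz => Or.inl (Or.inl (Or.inl hz))))
    · exact (meet_rect f k4 h.1 D4 h.2.1 h.2.2 l4 l4').mono
        (inter_subset_inter hF' (fun z hz => Or.inr hz))

lemma pr_LR_TB (R : Dom) (m m' a b c d : ℝ) :
    pr (Lam lam R) (Ev m true (rect a b c d) (rect a a c d) (rect b b c d) ∩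
      Ev m' false (rect a b c d) (rect a b c c) (rect a b d d)) = 0 := by
  refine pr_exclusive lam R (isCompact_rect _ _ _ _) (convex_rect _ _ _ _) (isClosed_rect _ _ _ _)
    (convex_rect _ _ _ _) (isClosed_rect _ _ _ _) (convex_rect _ _ _ _) (isCompact_rect _ _ _ _)
    (convex_rect _ _ _ _) (isClosed_rect _ _ _ _) (isClosed_rect _ _ _ _) ?_
  intro x hx y hy x' hx' y' hy' F hF G hG h h'
  rw [mem_rect] at hx hy hx' hy'
  exact joinedIn_cross h h'
    (fun z hz => by have := mem_rect.1 (hG hz); constructor <;> linarith)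
    (fun z hz => by have := mem_rect.1 (hF hz); constructor <;> linarith)

lemma pr_TB_LR (R : Dom) (m m' a b c d : ℝ) :
    pr (Lam lam R) (Ev m true (rect a b c d) (rect a b c c) (rect a b d d) ∩
      Ev m' false (rect a b c d) (rect a a c d) (rect b b c d)) = 0 := by
  refine pr_exclusive lam R (isCompact_rect _ _ _ _) (convex_rect _ _ _ _) (isClosed_rect _ _ _ _)
    (convex_rect _ _ _ _) (isClosed_rect _ _ _ _) (convex_rect _ _ _ _) (isCompact_rect _ _ _ _)
    (convex_rect _ _ _ _) (isClosed_rect _ _ _ _) (isClosed_rect _ _ _ _) ?_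
  intro x hx y hy x' hx' y' hy' F hF G hG h h'
  rw [mem_rect] at hx hy hx' hy'
  rw [inter_comm]
  exact joinedIn_cross h' h
    (fun z hz => by have := mem_rect.1 (hF hz); constructor <;> linarith)
    (fun z hz => by have := mem_rect.1 (hG hz); constructor <;> linarith)

lemma pr_eq_zero_of_subset {Λ : Measure CPt} [IsFiniteMeasure Λ] {A E₁ E₂ E₃ E₄ : Set (Set CPt)}
    (h₁ : pr Λ E₁ = 0) (h₂ : pr Λ E₂ = 0) (h₃ : pr Λ E₃ = 0) (h₄ : pr Λ E₄ = 0)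
    (h : A ⊆ E₁ ∪ (E₂ ∪ (E₃ ∪ E₄))) : pr Λ A = 0 := by
  have := pr_nonneg Λ A
  have := pr_mono Λ h
  have := pr_union_le Λ E₁ (E₂ ∪ (E₃ ∪ E₄))
  have := pr_union_le Λ E₂ (E₃ ∪ E₄)
  have := pr_union_le Λ E₃ E₄
  linarith

/-- A blue circuit prevents a red connection. -/
lemma pr_inter_ring (R : Dom) {m m' u x y : ℝ} (hm : 0 ≤ m) (hu : 0 < u) {D X Y : Set (ℝ × ℝ)}
    (hX : X ⊆ rect (x - u) (x + u) (y - u) (y + u))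
    (hY : ∀ q ∈ Y, q.1 ≤ x - 3 * u ∨ x + 3 * u ≤ q.1 ∨ q.2 ≤ y - 3 * u ∨ y + 3 * u ≤ q.2) :
    pr (Lam lam R) (Ev m true D X Y ∩ Ring false m' u x y) = 0 := by
  have key : ∀ {a b c d : ℝ} {F : Set (ℝ × ℝ)} {S : Set CPt}, IsPathConnected F → F ⊆ Reg m S true →
      F ⊆ rect a b c d → (∃ z ∈ F, z.1 = a) → (∃ z ∈ F, z.1 = b) →
      Conn m S true (rect a b c d) (rect a a c d) (rect b b c d) := by
    rintro a b c d F S h1 h2 h3 ⟨z, hz, rfl⟩ ⟨z', hz', rfl⟩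
    exact Conn.of_set h1 h2 h3 ⟨z, hz, mem_rect.2 ⟨⟨le_rfl, le_rfl⟩, (mem_rect.1 (h3 hz)).2⟩⟩
      ⟨z', hz', mem_rect.2 ⟨⟨le_rfl, le_rfl⟩, (mem_rect.1 (h3 hz')).2⟩⟩
  have key' : ∀ {a b c d : ℝ} {F : Set (ℝ × ℝ)} {S : Set CPt}, IsPathConnected F →
      F ⊆ Reg m S true →
      F ⊆ rect a b c d → (∃ z ∈ F, z.2 = c) → (∃ z ∈ F, z.2 = d) →
      Conn m S true (rect a b c d) (rect a b c c) (rect a b d d) := by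
    rintro a b c d F S h1 h2 h3 ⟨z, hz, rfl⟩ ⟨z', hz', rfl⟩
    exact Conn.of_set h1 h2 h3 ⟨z, hz, mem_rect.2 ⟨(mem_rect.1 (h3 hz)).1, ⟨le_rfl, le_rfl⟩⟩⟩
      ⟨z', hz', mem_rect.2 ⟨(mem_rect.1 (h3 hz')).1, ⟨le_rfl, le_rfl⟩⟩⟩
  refine pr_eq_zero_of_subset
    (pr_TB_LR (lam := lam) R m m' (x - 3 * u) (x + 3 * u) (y + u) (y + 3 * u))
    (pr_TB_LR (lam := lam) R m m' (x - 3 * u) (x + 3 * u) (y - 3 * u) (y - u))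
    (pr_LR_TB (lam := lam) R m m' (x - 3 * u) (x - u) (y - 3 * u) (y + 3 * u))
    (pr_LR_TB (lam := lam) R m m' (x + u) (x + 3 * u) (y - 3 * u) (y + 3 * u)) ?_
  · rintro S ⟨hS, ⟨⟨h1, h2⟩, h3⟩, h4⟩
    obtain ⟨F, hF, hFr, -, ⟨p, hp, hpX⟩, q, hq, hqY⟩ := Conn.exists_set hS hm le_rfl
    obtain ⟨F', hF', f, h | h | h | h⟩ := cross_annulus hF hp hq (hX hpX) hu (hY q hqY)
    · exact Or.inl ⟨key' f (hF'.trans hFr) h.1 h.2.1 h.2.2, h1⟩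
    · exact Or.inr (Or.inl ⟨key' f (hF'.trans hFr) h.1 h.2.1 h.2.2, h2⟩)
    · exact Or.inr (Or.inr (Or.inl ⟨key f (hF'.trans hFr) h.1 h.2.1 h.2.2, h3⟩))
    · exact Or.inr (Or.inr (Or.inr ⟨key f (hF'.trans hFr) h.1 h.2.1 h.2.2, h4⟩))

/-- Disjoint annuli are all free of circuits with exponentially small probability. -/
lemma pr_no_ring_le {c x y : ℝ} {u : ℕ → ℝ} (hu0 : ∀ l, 0 < u l) (hu : ∀ l, 7 * u l < u (l + 1))
    (hc : 0 ≤ c) (R : Dom) (L : ℕ) (h : ∀ l < L, RSW lam (2 * u l) c)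
    (hR : ∀ l < L, rect (x - 7 / 2 * u l) (x + 7 / 2 * u l) (y - 7 / 2 * u l) (y + 7 / 2 * u l) ⊆
      R.s) :
    Obs {S | ∀ l < L, S ∉ Ring false (u l / 2) (u l) x y} ∧
    pr (Lam lam R) {S | ∀ l < L, S ∉ Ring false (u l / 2) (u l) x y} ≤
      (1 - c * c * c * c) ^ L := by
  have hmono : ∀ l l', l < l' → 7 * u l < u l' := by
    intro l l' hl
    induction l', hl using Nat.le_induction with
    | base => exact hu l
    | succ k _ ih => have := hu k; have := hu0 k; linarith
  induction L with
  | zero => exact ⟨by simpa using obs_univ, by simpa using pr_le_one _ _⟩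
  | succ L ih =>
    obtain ⟨ih1, ih2⟩ := ih (fun l hl => h l (hl.trans L.lt_succ_self))
      fun l hl => hR l (hl.trans L.lt_succ_self)
    have hset : {S | ∀ l < L + 1, S ∉ Ring false (u l / 2) (u l) x y} =
        {S | ∀ l < L, S ∉ Ring false (u l / 2) (u l) x y} ∩
          (Ring false (u L / 2) (u L) x y)ᶜ := by
      ext S
      simp only [mem_ofPred_eq, mem_inter_iff, mem_compl_iff, Nat.lt_succ_iff_lt_or_eq]
      exact ⟨fun h => ⟨fun l hl => h l (Or.inl hl), h L (Or.inr rfl)⟩,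
        fun h l hl => hl.elim (h.1 l) fun e => e ▸ h.2⟩
    have hLc := (obs_ring false (u L / 2) (u L) x y).compl
    rw [hset]
    refine ⟨ih1.inter hLc, ?_⟩
    let W : Set (ℝ × ℝ) := Ioo (x - u L / 2) (x + u L / 2) ×ˢ Ioo (y - u L / 2) (y + u L / 2)
    have hW : MeasurableSet W := measurableSet_Ioo.prod measurableSet_Ioo
    have d1 : Dep (W ×ˢ univ) {S | ∀ l < L, S ∉ Ring false (u l / 2) (u l) x y} := by
      intro S
      simp only [mem_ofPred_eq]
      refine forall₂_congr fun l hl => not_congr (dep_ring false (hu0 l) (fun p hp _ => ?_) S)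
      have := hmono l L hl
      rw [mem_rect] at hp
      exact mk_mem_prod ⟨by linarith, by linarith⟩ ⟨by linarith, by linarith⟩
    have d2 : Dep (W ×ˢ univ)ᶜ (Ring false (u L / 2) (u L) x y)ᶜ := by
      have e : (W ×ˢ (univ : Set Bool))ᶜ = Wᶜ ×ˢ univ := by ext ⟨p, b⟩; simp
      rw [e]
      intro S
      refine not_congr (dep_ring false (hu0 L) ?_ S)
      intro p hp h' hpW
      rcases h' with h' | h'
      · exact absurd h' (not_le.2 (abs_lt.2 ⟨by linarith [hpW.1.1], by linarith [hpW.1.2]⟩))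
      · exact absurd h' (not_le.2 (abs_lt.2 ⟨by linarith [hpW.2.1], by linarith [hpW.2.2]⟩))
    rw [pr_indep _ (hW.prod MeasurableSet.univ) ih1 hLc d1 d2, pow_succ,
      pr_compl _ (obs_ring false (u L / 2) (u L) x y)]
    have := (h L L.lt_succ_self).ring_le (hu0 L) hc x y R (hR L L.lt_succ_self)
    have h1 := pr_le_one (Lam lam R) (Ring false (u L / 2) (u L) x y)
    exact mul_le_mul ih2 (by linarith) (by linarith) ((pr_nonneg _ _).trans ih2)

/-- The one-arm bound. -/
lemma pr_arm_le {c x y m : ℝ} {u : ℕ → ℝ} (hu0 : ∀ l, 0 < u l) (hu : ∀ l, 7 * u l < u (l + 1))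
    (hc : 0 ≤ c) (R : Dom) (L : ℕ) (h : ∀ l < L, RSW lam (2 * u l) c)
    (hR : ∀ l < L, rect (x - 7 / 2 * u l) (x + 7 / 2 * u l) (y - 7 / 2 * u l) (y + 7 / 2 * u l) ⊆
      R.s)
    (hm : 0 ≤ m) {D X Y : Set (ℝ × ℝ)}
    (hX : ∀ l < L, X ⊆ rect (x - u l) (x + u l) (y - u l) (y + u l))
    (hY : ∀ l < L, ∀ q ∈ Y, q.1 ≤ x - 3 * u l ∨ x + 3 * u l ≤ q.1 ∨ q.2 ≤ y - 3 * u l ∨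
      y + 3 * u l ≤ q.2) :
    pr (Lam lam R) (Ev m true D X Y) ≤ (1 - c * c * c * c) ^ L := by
  refine (pr_le_add _ (B := {S | ∀ l < L, S ∉ Ring false (u l / 2) (u l) x y})
    (C := ⋃ l ∈ Finset.range L, Ev m true D X Y ∩ Ring false (u l / 2) (u l) x y) ?_).trans ?_
  · intro S hS
    by_cases hh : ∀ l < L, S ∉ Ring false (u l / 2) (u l) x y
    · exact Or.inl hh
    · push Not at hh
      obtain ⟨l, hl, hl'⟩ := hh
      exact Or.inr (mem_biUnion (Finset.mem_coe.2 (Finset.mem_range.2 hl)) ⟨hS, hl'⟩)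
  · have h1 := (pr_no_ring_le hu0 hu hc R L h hR).2
    have h2 := pr_biUnion_le (Lam lam R) (Finset.range L)
      fun l => Ev m true D X Y ∩ Ring false (u l / 2) (u l) x y
    rw [Finset.sum_eq_zero fun l hl => pr_inter_ring R hm (hu0 l) (hX l (Finset.mem_range.1 hl))
      (hY l (Finset.mem_range.1 hl))] at h2
    linarith

end Ring

/-! ### Crossings of rectangles in the plane -/

section Bulk

variable {lam : ℝ≥0}

lemma redEv_redCov (m : ℝ) (D : Set (ℝ × ℝ)) : RedEv (RedCov m D) := by
  constructor
  · rw [← compl_compl (RedCov m D)]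
    refine Obs.compl fun k => ?_
    have e : {z : Fin k → CPt | range z ∈ (RedCov m D)ᶜ} =
        ⋃ p ∈ D, ⋂ i, ({z | (z i).2 = true}ᶜ ∪ {z | m ^ 2 < sqDist p (z i).1}) := by
      ext z
      simp only [RedCov, mem_ofPred_eq, mem_compl_iff, mem_iUnion, mem_iInter, mem_union,
          not_forall,
        not_exists, not_and, not_le, exists_prop]
      refine exists_congr fun p => and_congr_right fun _ => ⟨fun h i => ?_, ?_⟩
      · by_cases hi : (z i).2 = true
        · exact Or.inr (h _ ⟨i, Prod.ext rfl hi⟩)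
        · exact Or.inl hi
      · rintro h x ⟨i, hi⟩
        rcases h i with h | h
        · simp [hi] at h
        · simpa [hi] using h
    refine IsOpen.measurableSet ?_
    change IsOpen {z : Fin k → CPt | range z ∈ (RedCov m D)ᶜ}
    rw [e]
    refine isOpen_biUnion fun p _ => isOpen_iInter_of_finite fun i => IsOpen.union ?_ ?_
    · exact (isClosed_singleton.preimage (f := fun z : Fin k → CPt => (z i).2)
        (by fun_prop) : IsClosed {z : Fin k → CPt | (z i).2 = true}).isOpen_compl
    · refine isOpen_lt continuous_const ?_
      exact continuous_sqDist.comp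
          (continuous_const.prodMk (by fun_prop : Continuous fun z : Fin k → CPt => (z i).1))
  · intro S S' h h1 _ p hp
    obtain ⟨x, hx, hpx⟩ := h p hp
    exact ⟨x, h1 x hx, hpx⟩

/-- A rectangle without blue points around it that is covered by red points is crossed. -/
lemma exp_le_pr (R : Dom) {m a b c d : ℝ} (hm : 0 < m) (hab : m ≤ b - a) (hcd : m ≤ d - c)
    (hR : rect a b c d ⊆ R.s) (hE : err lam m (b - a) (d - c) ≤ 1 / 2) {X Y : Set (ℝ × ℝ)}
    {x y : ℝ × ℝ} (hx : x ∈ X) (hxD : x ∈ rect a b c d) (hy : y ∈ Y) (hyD : y ∈ rect a b c d) :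
    Real.exp (-(lam * ((b - a + 2 * m) * (d - c + 2 * m)))) * (1 / 2) ≤
      pr (Lam lam R) (Ev m true (rect a b c d) X Y) := by
  set W := rect (a - m) (b + m) (c - m) (d + m)
  have hW : MeasurableSet W := measurableSet_rect _ _ _ _
  have hWb : MeasurableSet (W ×ˢ {false} : Set CPt) := hW.prod (measurableSet_singleton _)
  have h1 : RedEv {S : Set CPt | S ∩ W ×ˢ {false} = ∅} := by
    have e : {S : Set CPt | S ∩ W ×ˢ {false} = ∅} = {S | S ⊆ (W ×ˢ {false})ᶜ} := by
      ext S
      exact disjoint_iff_inter_eq_empty.symm.trans subset_compl_iff_disjoint_right.symm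
    refine ⟨e ▸ obs_subset hWb.compl, fun S S' h _ h2 => ?_⟩
    rw [mem_ofPred_eq, eq_empty_iff_forall_notMem] at h ⊢
    rintro ⟨z, b⟩ ⟨hz, hzW, hb⟩
    obtain rfl : b = false := hb
    exact h (z, false) ⟨h2 z hz, hzW, rfl⟩
  have e1 : (Lam lam R).real (W ×ˢ {false}) ≤ lam * ((b - a + 2 * m) * (d - c + 2 * m)) := by
    have e2 : volume.real W = (b - a + 2 * m) * (d - c + 2 * m) := by
      rw [volume_rect (by linarith) (by linarith)]; ring
    have e3 : (Lam lam R) (W ×ˢ {false}) ≤ lam * volume W := by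
      rw [Lam, Measure.prod_prod, Measure.count_singleton, mul_one, Measure.smul_apply, smul_eq_mul]
      gcongr
      exact Measure.restrict_le_self
    have := ENNReal.toReal_mono (ENNReal.mul_ne_top ENNReal.coe_ne_top
      (isCompact_rect _ _ _ _).measure_lt_top.ne) e3
    rw [ENNReal.toReal_mul, ENNReal.coe_toReal] at this
    rw [← e2]
    exact this
  have e2 : Real.exp (-(lam * ((b - a + 2 * m) * (d - c + 2 * m)))) ≤
      pr (Lam lam R) {S : Set CPt | S ∩ W ×ˢ {false} = ∅} := by
    rw [pr_void _ hWb]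
    exact Real.exp_le_exp.2 (neg_le_neg e1)
  have e3 := pr_not_redCov_le lam R hm hab hcd hR
  rw [pr_compl _ (redEv_redCov _ _).obs] at e3
  refine (h1.le_inter _ (redEv_redCov m (rect a b c d)) e2 (by linarith) (by norm_num)).trans
    (pr_mono _ ?_)
  rintro S ⟨hS, hC⟩
  have hsub : rect a b c d ⊆ Reg m S true := by
    intro p hp
    obtain ⟨z, hz, hpz⟩ := hC p hp
    refine ⟨z, hz, hpz, fun w hw => ?_⟩
    by_contra! hlt
    rw [mem_ofPred_eq, eq_empty_iff_forall_notMem] at hS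
    exact hS (w, false) ⟨hw,
        nb_rect_subset hm.le ⟨p, hp, by rw [sqDist_comm]; exact hlt.le.trans hpz⟩,
      rfl⟩
  exact Conn.of_set ((convex_rect a b c d).isPathConnected ⟨x, hxD⟩) hsub Subset.rfl ⟨x, hxD, hx⟩
    ⟨y, hyD, hy⟩

/-- The bound at the smallest scale. -/
noncomputable def cBase : ℝ := Real.exp (-(21 / 4 * C₀)) * (1 / 2)

lemma RSW.base {s : ℝ} (hs : 0 < s) (hC : lam * s ^ 2 = C₀) : RSW lam s cBase := by
  have hm : 0 < s / 4 := by positivity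
  refine BR.of_pr (A := -s) (B := 4 * s) (C := -s) (E := 2 * s) hm.le ?_
  have := exp_le_pr (lam := lam) (rectDom (-s) (4 * s) (-s) (2 * s)) hm (a := 0) (b := 3 * s) (c :=
      0)
    (d := s) (by linarith) (by linarith)
    (rect_subset (by linarith) (by linarith) (by linarith) (by linarith)) ?_
    (X := rect 0 0 0 s) (Y := rect (3 * s) (3 * s) 0 s) (x := (0, 0)) (y := (3 * s, 0))
    (mem_rect.2 ⟨⟨le_rfl, le_rfl⟩, le_rfl, hs.le⟩)
    (mem_rect.2 ⟨⟨le_rfl, by linarith⟩, le_rfl, hs.le⟩)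
    (mem_rect.2 ⟨⟨le_rfl, le_rfl⟩, le_rfl, hs.le⟩)
    (mem_rect.2 ⟨⟨by linarith, le_rfl⟩, le_rfl, hs.le⟩)
  · refine le_trans (le_of_eq ?_) this
    rw [cBase, ← hC]
    congr 3
    ring
  · have h1 : err lam (s / 4) (3 * s - 0) (s - 0) = 432 * Real.exp (-(lam * s ^ 2 / 144)) := by
      rw [err]; field_simp; ring_nf
    have h2 := exp_neg_le (x := lam * s ^ 2 / 144) (by rw [hC, C₀]; norm_num)
    rw [h1]; norm_num at h2 ⊢; linarith

/-- A connection from the inside of a circuit and its reflection make a crossing. -/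
lemma RSW.of_arm {s₀ s c : ℝ} (h : RSW lam s₀ c) (hs₀ : 0 < s₀) (hc : 0 < c)
    (hC : C₀ ≤ lam * s₀ ^ 2) (hs : 3 * s₀ ≤ s) (hA : Arm lam s 0 (s₀ / 2) (3 / 25)) :
    RSW lam s (dbl (3 / 25 * (3 / 25) * c * c * c * c)) := by
  have hm : 0 ≤ s / 16 := by linarith
  have hu : 0 < s₀ / 2 := by linarith
  have hA' := hA.refX (H' := univ) hm
  simp only [neg_zero] at hA'
  obtain ⟨h1, h2, h3, h4⟩ := RSW.rects (u := s₀ / 2) (c := c) (by convert h using 2; ring) hu 0 0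
  let W := rect (-s - s / 4) (s + s / 4) (-(s / 2) - s / 4) (s / 2 + s / 4)
  have b1 : Bd univ lam W _ _ := hA.toBd
  have b2 : Bd univ lam W _ _ := hA'.toBd
  have b3 : Bd univ lam W _ _ := h1.toBd
  have b4 : Bd univ lam W _ _ := h2.toBd
  have b5 : Bd univ lam W _ _ := h3.toBd
  have b6 : Bd univ lam W _ _ := h4.toBd
  have b := (b1.inter b2 (by norm_num)).inter (((b3.inter b4 hc.le).inter b5 hc.le).inter b6 hc.le)
    (by positivity)
  have k : LR lam (s / 4) (-s) s (-(s / 2)) (s / 2) (3 / 25 * (3 / 25) * (c * c * c * c)) := by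
    refine Bd.toBR b (by linarith) ?_
    rintro S - ⟨⟨g1, g2⟩, g3⟩
    obtain ⟨K, k1, k2, k3, k4⟩ := Ring.exists_set (m' := s / 4) g3 (by linarith) (by linarith) hu
    obtain ⟨F, f1, f2, f3, ⟨p, hp, hpX⟩, q, hq, hqX⟩ :=
        Conn.exists_set (m' := s / 4) g1 hm (by linarith)
    obtain ⟨G, l1, l2, l3, ⟨p', hp', hpX'⟩, q', hq', hqX'⟩ :=
      Conn.exists_set (m' := s / 4) g2 hm (by linarith)
    rw [mem_rect] at hpX hqX hpX' hqX'
    have i1 := k4 F f1 p hp q hq (mem_rect.2 ⟨⟨by linarith, by linarith⟩, by linarith, by linarith⟩)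
      (Or.inr (Or.inl (by linarith)))
    have i2 := k4 G l1 p' hp' q' hq'
      (mem_rect.2 ⟨⟨by linarith, by linarith⟩, by linarith, by linarith⟩) (Or.inl (by linarith))
    have u := (f1.union k1 i1).union l1 (by
      rw [inter_comm]; exact i2.mono (inter_subset_inter_right _ subset_union_right))
    exact Conn.of_set u (union_subset (union_subset f2 k2) l2)
      (union_subset (union_subset
        (f3.trans (rect_subset (by linarith) le_rfl le_rfl le_rfl))
        (k3.trans (rect_subset (by linarith) (by linarith) (by linarith) (by linarith))))
        (l3.trans (rect_subset le_rfl (by linarith) le_rfl le_rfl)))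
      ⟨q', Or.inr hq', mem_rect.2 hqX'⟩ ⟨q, Or.inl (Or.inl hq), mem_rect.2 hqX⟩
  have k' := k.trans (H' := univ) (by linarith) s (s / 2)
  have k'' : LR lam (s / 4) 0 (s + s) 0 s (3 / 25 * (3 / 25) * c * c * c * c) := by
    convert k' using 1 <;> ring
  have hC' : C₀ ≤ lam * s ^ 2 := hC.trans (by gcongr; linarith)
  have := k''.double (by linarith) (by linarith) hC' (by linarith) (by positivity)
  convert this using 1
  ring

/-- Either one of many scales is good or the connections at large scales start in a small window. -/
lemma arm_or_good {s₀ : ℝ} (hs₀ : 0 < s₀) (hC : C₀ ≤ lam * s₀ ^ 2) (J : ℕ)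
    (hJ : ∀ j < J, ¬ RSW lam (15 / 8 * (s₀ * (3 / 2) ^ j)) cGood) (i : ℕ) (hi : i ≤ J) :
    Arm lam (s₀ * (3 / 2) ^ (J - i)) 0 (s₀ / 2 * ((3 / 4) ^ J * 2 ^ (J - i))) (3 / 25) := by
  have hCj : ∀ j, C₀ ≤ lam * (s₀ * (3 / 2) ^ j) ^ 2 := fun j => hC.trans (by
    gcongr
    exact le_mul_of_one_le_right hs₀.le (one_le_pow₀ (by norm_num)))
  induction i with
  | zero =>
    have := Arm.half (by positivity) (hCj J)
    have e : s₀ / 2 * ((3 / 4) ^ J * 2 ^ J) = s₀ * (3 / 2) ^ J / 2 := by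
      rw [← mul_pow]; norm_num; ring
    rw [Nat.sub_zero, e]
    exact this.mono (by positivity)
  | succ i ih =>
    obtain ⟨j, rfl⟩ := Nat.exists_eq_add_of_le' hi
    have ih := ih (by omega)
    rw [show j + (i + 1) - i = j + 1 by omega] at ih
    rw [show j + (i + 1) - (i + 1) = j by omega]
    set J := j + (i + 1)
    set s := s₀ * (3 / 2) ^ j with hs
    have hs0 : 0 < s := by positivity
    have e1 : s₀ * (3 / 2) ^ (j + 1) = 3 * (s / 2) := by rw [hs, pow_succ]; ring
    have e2 : s₀ / 2 * ((3 / 4) ^ J * 2 ^ (j + 1)) = 2 * (s₀ / 2 * ((3 / 4) ^ J * 2 ^ j)) := by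
      rw [pow_succ]; ring
    rw [e1, e2] at ih
    set β := s₀ / 2 * ((3 / 4) ^ J * 2 ^ j) with hβ
    have hβs : 2 * β ≤ 3 * (s / 2) / 2 := by
      have h1 : (3 / 4 : ℝ) ^ J ≤ (3 / 4) ^ (j + 1) :=
        pow_le_pow_of_le_one (by norm_num) (by norm_num) (by omega)
      have h2 : (3 / 4 : ℝ) ^ (j + 1) * 2 ^ (j + 1) = (3 / 2) ^ (j + 1) :=
          by rw [← mul_pow]; norm_num
      rw [← e1, ← e2]
      calc s₀ / 2 * ((3 / 4) ^ J * 2 ^ (j + 1)) ≤ s₀ / 2 * ((3 / 4) ^ (j + 1) * 2 ^ (j + 1)) :=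
          by gcongr
        _ = s₀ * (3 / 2) ^ (j + 1) / 2 := by rw [h2]; ring
    rcases Arm.or hs0 (hCj j) β with h | h
    · exact h
    · exfalso
      refine hJ j (by omega) ?_
      have := RSW.of_arms (t := s / 2) (β := 2 * β) (β' := β) (by positivity)
        (by convert hCj j using 2; ring)
        (by convert h using 1; ring; ring) ih (by positivity) hβs le_rfl
      convert this using 1
      ring

/-- Every scale with a bound is followed by a scale with the universal bound. -/
lemma exists_good {c : ℝ} (hc : 0 < c) : ∃ J : ℕ, ∀ (lam : ℝ≥0) (s₀ : ℝ), 0 < s₀ →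
    C₀ ≤ lam * s₀ ^ 2 → RSW lam s₀ c → ∃ j < J, RSW lam (15 / 8 * (s₀ * (3 / 2) ^ j)) cGood := by
  set c₃ := dbl (3 / 25 * (3 / 25) * c * c * c * c) with hc₃
  have hc₃0 : 0 < c₃ := by rw [hc₃, dbl]; positivity
  obtain ⟨L, hL⟩ := exists_pow_lt_of_lt_one (show (0 : ℝ) < 3 / 25 by norm_num)
    (show 1 - c₃ * c₃ * c₃ * c₃ < 1 by linarith [show 0 < c₃ * c₃ * c₃ * c₃ by positivity])
  refine ⟨3 * (5 * L), fun lam s₀ hs₀ hC h => ?_⟩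
  by_contra! hJ
  have harm : ∀ j ≤ 5 * L, Arm lam (s₀ * (3 / 2) ^ j) 0 (s₀ / 2) (3 / 25) := by
    intro j hj
    have := arm_or_good hs₀ hC _ hJ (3 * (5 * L) - j) (by omega)
    rw [show 3 * (5 * L) - (3 * (5 * L) - j) = j by omega] at this
    have e : s₀ / 2 * ((3 / 4) ^ (3 * (5 * L)) * 2 ^ j) ≤ s₀ / 2 := by
      refine mul_le_of_le_one_right (by positivity) ?_
      calc (3 / 4 : ℝ) ^ (3 * (5 * L)) * 2 ^ j ≤ (3 / 4) ^ (3 * (5 * L)) * 2 ^ (5 * L) := by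
            gcongr; norm_num
        _ = (27 / 32) ^ (5 * L) := by rw [pow_mul, ← mul_pow]; norm_num
        _ ≤ 1 := pow_le_one₀ (by norm_num) (by norm_num)
    exact this.mono (by positivity)
  have hpow : ∀ j k : ℕ, s₀ * (3 / 2) ^ (j + k) = (3 / 2) ^ k * (s₀ * (3 / 2) ^ j) := fun j k => by
    rw [pow_add]; ring
  have hge : ∀ j, s₀ ≤ s₀ * (3 / 2) ^ j := fun j =>
    le_mul_of_one_le_right hs₀.le (one_le_pow₀ (by norm_num))
  have hrsw : ∀ l < L, RSW lam (2 * (s₀ * (3 / 2) ^ (5 * l + 3) / 2)) c₃ := by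
    intro l hl
    rw [mul_div_cancel₀ _ (by norm_num : (2 : ℝ) ≠ 0)]
    refine h.of_arm hs₀ hc hC ?_ (harm _ (by omega))
    have := hge (5 * l)
    rw [hpow]
    norm_num
    linarith
  set S := s₀ * (3 / 2) ^ (5 * L)
  have hS : 0 < S := by positivity
  have hSl : ∀ l < L, 9 / 4 * (s₀ * (3 / 2) ^ (5 * l + 3)) ≤ S := by
    intro l hl
    calc 9 / 4 * (s₀ * (3 / 2) ^ (5 * l + 3)) = s₀ * (3 / 2) ^ (5 * l + 5) := by
          rw [pow_add, pow_add]; norm_num; ring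
      _ ≤ s₀ * (3 / 2) ^ (5 * L) := by
          gcongr
          · norm_num
          · omega
  have hA := (harm (5 * L) le_rfl).le_pr (A := -(2 * S)) (B := 2 * S) (C := -(2 * S)) (E := 2 * S)
  have hu0 : ∀ l : ℕ, 0 < s₀ * (3 / 2) ^ (5 * l + 3) / 2 := fun l => by positivity
  have := pr_arm_le (lam := lam) (x := 0) (y := 0) (m := S / 16)
    (u := fun l => s₀ * (3 / 2) ^ (5 * l + 3) / 2) hu0
    (fun l => by
      have := hpow (5 * l + 3) 5
      have := hu0 l
      simp only [show 5 * (l + 1) + 3 = 5 * l + 3 + 5 by ring]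
      rw [hpow (5 * l + 3) 5]
      norm_num
      linarith) hc₃0.le (rectDom (-(2 * S)) (2 * S) (-(2 * S)) (2 * S)) L hrsw
    (fun l hl => rect_subset (by linarith [hSl l hl, hu0 l]) (by linarith [hSl l hl, hu0 l])
      (by linarith [hSl l hl, hu0 l]) (by linarith [hSl l hl, hu0 l])) (by positivity)
    (D := rect 0 S (-(S / 2)) (S / 2)) (X := rect 0 0 0 (s₀ / 2)) (Y := rect S S (-(S / 2)) (S / 2))
    (fun l _ => rect_subset (by linarith [hge (5 * l + 3)]) (by linarith [hge (5 * l + 3)])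
      (by linarith [hge (5 * l + 3)]) (by linarith [hge (5 * l + 3)]))
    (fun l hl q hq => Or.inr (Or.inl (by
      rw [mem_rect] at hq
      linarith [hSl l hl, hu0 l])))
  linarith

/-- The box crossing property. -/
theorem exists_rsw : ∃ c : ℝ, 0 < c ∧ ∀ (lam : ℝ≥0) (s : ℝ), 0 < s → C₀ ≤ lam * s ^ 2 →
    RSW lam s c := by
  set c := min cBase cGood
  have hc : 0 < c := lt_min (by rw [cBase]; positivity) cGood_pos
  obtain ⟨J, hJ⟩ := exists_good hc
  set M : ℝ := 15 / 8 * (3 / 2) ^ J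
  obtain ⟨k, hk⟩ := pow_unbounded_of_one_lt (3 * M) (one_lt_two (α := ℝ))
  refine ⟨dbl^[k] c, dbl_iter_pos hc k, fun lam s hs hC => ?_⟩
  have hC₀ : (0 : ℝ) < C₀ := by norm_num [C₀]
  have hlam : (0 : ℝ) < lam := by
    by_contra! h
    have : (lam : ℝ) * s ^ 2 ≤ 0 := mul_nonpos_of_nonpos_of_nonneg h (sq_nonneg _)
    linarith
  set s₁ := Real.sqrt (C₀ / lam) with hs₁
  have hs₁0 : 0 < s₁ := Real.sqrt_pos.2 (by positivity)
  have hs₁2 : lam * s₁ ^ 2 = C₀ := by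
    rw [hs₁, Real.sq_sqrt (by positivity)]; field_simp
  have hs₁s : s₁ ≤ s := by
    refine Real.sqrt_le_iff.2 ⟨hs.le, ?_⟩
    rw [div_le_iff₀ hlam]; linarith
  have key : ∀ i : ℕ, ∃ s', s₁ ≤ s' ∧ s' ≤ s ∧ RSW lam s' c ∧
      (s ≤ M * s' ∨ (15 / 8) ^ i * s₁ ≤ s') := by
    intro i
    induction i with
    | zero => exact ⟨s₁, le_rfl, hs₁s, (RSW.base hs₁0 hs₁2).mono (by positivity)
        (hq := min_le_left _ _), Or.inr (by simp)⟩
    | succ i ih =>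
      obtain ⟨s', h1, h2, h3, h4⟩ := ih
      by_cases hM : s ≤ M * s'
      · exact ⟨s', h1, h2, h3, Or.inl hM⟩
      have h4 := h4.resolve_left hM
      have hs'0 : 0 < s' := hs₁0.trans_le h1
      obtain ⟨j, hj, hg⟩ := hJ lam s' hs'0 (hs₁2.ge.trans (by gcongr)) h3
      have hp : (1 : ℝ) ≤ (3 / 2) ^ j := one_le_pow₀ (by norm_num)
      have hge : s' ≤ s' * (3 / 2) ^ j := le_mul_of_one_le_right hs'0.le hp
      have hle : 15 / 8 * (s' * (3 / 2) ^ j) ≤ M * s' := by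
        have : (3 / 2 : ℝ) ^ j ≤ (3 / 2) ^ J := pow_le_pow_right₀ (by norm_num) hj.le
        calc 15 / 8 * (s' * (3 / 2) ^ j) ≤ 15 / 8 * (s' * (3 / 2) ^ J) := by gcongr
          _ = M * s' := by ring
      refine ⟨15 / 8 * (s' * (3 / 2) ^ j), by linarith, by linarith,
        hg.mono (by positivity) (hq := min_le_right _ _), Or.inr ?_⟩
      rw [pow_succ]
      linarith
  obtain ⟨i, hi⟩ := pow_unbounded_of_one_lt (s / s₁) (show (1 : ℝ) < 15 / 8 by norm_num)
  rw [div_lt_iff₀ hs₁0] at hi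
  obtain ⟨s', h1, h2, h3, h4⟩ := key i
  have hM : s ≤ M * s' := by
    rcases h4 with h | h
    · exact h
    · exact absurd (hi.trans_le h) (not_lt.2 h2)
  have hs'0 : 0 < s' := hs₁0.trans_le h1
  refine h3.grow hs'0 (hs₁2.ge.trans (by gcongr)) hc h2 ?_
  calc 3 * s ≤ 3 * M * s' := by linarith
    _ ≤ 2 ^ k * s' := by gcongr

end Bulk

/-! ### Windows in the boundary of a rectangle -/

section Windows

variable {lam : ℝ≥0}

lemma reg_inter_subset {m m' : ℝ} {S : Set CPt} {D : Set (ℝ × ℝ)} (hS : S ∈ Cov m D) (b : Bool) :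
    Reg m' S b ∩ D ⊆ Reg m S b ∩ D := by
  rintro p ⟨⟨x, hx, -, h⟩, hpD⟩
  obtain ⟨⟨y, c⟩, hs, hps⟩ := hS p hpD
  refine ⟨?_, hpD⟩
  rcases le_total (sqDist p x) (sqDist p y) with h1 | h1
  · exact ⟨x, hx, h1.trans hps, h⟩
  · by_cases hc : c = b
    · subst hc
      exact ⟨y, hs, hps, fun z hz => h1.trans (h z hz)⟩
    · obtain rfl : c = !b := by cases c <;> cases b <;> simp_all
      exact ⟨x, hx, (h y hs).trans hps, h⟩

/-- A dichotomy for connections from a part of the left side of a rectangle. -/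
lemma conn_window_or {S : Set CPt} (hS : S.Finite) {m x₀ x₁ y₀ u y₁ : ℝ} (hx : x₀ ≤ x₁)
    (h1 : y₀ ≤ u) (h2 : u ≤ y₁) (hC : S ∈ Cov m (rect x₀ x₁ y₀ y₁)) :
    Conn m S true (rect x₀ x₁ y₀ y₁) (rect x₀ x₀ y₀ u) (rect x₁ x₁ y₀ y₁) ∨
    Conn m S false (rect x₀ x₁ y₀ y₁) (rect x₀ x₁ y₀ y₀)
      (rect x₀ x₀ u y₁ ∪ rect x₀ x₁ y₁ y₁) := by
  have key : ∀ {v₀ v₁ t : ℝ}, t ∈ Icc (0 : ℝ) 1 → v₀ ≤ v₁ →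
      v₀ ≤ v₀ + t * (v₁ - v₀) ∧ v₀ + t * (v₁ - v₀) ≤ v₁ := fun ht h => by
    constructor <;> nlinarith [ht.1, ht.2]
  set P : ℝ → ℝ := fun s => max 0 (2 * s - 1)
  set Q : ℝ → ℝ := fun s => min 1 (2 * s)
  have hP : ∀ s ∈ Icc (0 : ℝ) 1, P s ∈ Icc (0 : ℝ) 1 := fun s hs =>
    ⟨le_max_left _ _, max_le zero_le_one (by linarith [hs.2])⟩
  have hQ : ∀ s ∈ Icc (0 : ℝ) 1, Q s ∈ Icc (0 : ℝ) 1 := fun s hs =>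
    ⟨le_min zero_le_one (by linarith [hs.1]), min_le_left _ _⟩
  set φ : ℝ × ℝ → ℝ × ℝ := fun z =>
    (x₀ + ((1 - z.2) * z.1 + z.2 * P z.1) * (x₁ - x₀),
      y₀ + z.2 * (u + Q z.1 * (y₁ - u) - y₀))
  have hφ : Continuous φ := by fun_prop
  have hφD : ∀ s ∈ Icc (0 : ℝ) 1, ∀ t ∈ Icc (0 : ℝ) 1, φ (s, t) ∈ rect x₀ x₁ y₀ y₁ := by
    intro s hs t ht
    have e1 := key (hQ s hs) h2
    have e2 : (1 - t) * s + t * P s ∈ Icc (0 : ℝ) 1 := by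
      have := hP s hs
      constructor <;> nlinarith [ht.1, ht.2, hs.1, hs.2, this.1, this.2]
    have e3 := key e2 hx
    have e4 := key ht (v₀ := y₀) (v₁ := u + Q s * (y₁ - u)) (by linarith)
    exact mem_rect.2 ⟨e3, e4.1, by linarith⟩
  rcases conn_or_conn hS hφ (isClosed_rect _ _ _ _) (convex_rect x₀ x₁ y₀ y₁) hC hφD true with
    ⟨t, ht, t', ht', h⟩ | ⟨t, ht, t', ht', h⟩
  · left
    refine ⟨_, mem_rect.2 ?_, _, mem_rect.2 ?_, h⟩
    · have := key ht h1
      simp only [φ, P, Q]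
      norm_num
      constructor <;> linarith [this.1, this.2]
    · have := key ht' (h1.trans h2)
      simp only [φ, P, Q]
      norm_num
      constructor <;> linarith [this.1, this.2]
  · right
    refine ⟨_, mem_rect.2 ?_, _, ?_, h⟩
    · have := key ht hx
      simp only [φ]
      norm_num
      constructor <;> linarith [this.1, this.2]
    · rcases le_total (2 * t') 1 with h3 | h3
      · left
        have e1 : P t' = 0 := max_eq_left (by linarith)
        have := key (hQ t' ht') h2
        simp only [φ, e1]
        rw [mem_rect]
        norm_num
        constructor <;> linarith [this.1, this.2]
      · right
        have e1 : Q t' = 1 := min_eq_left h3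
        have := key (hP t' ht') hx
        simp only [φ, e1]
        rw [mem_rect]
        norm_num
        constructor <;> linarith [this.1, this.2]

/-- A red connection from a window that is not connected below it excludes a blue connection from
the bottom, except to the window itself. -/
lemma pr_window_le (R : Dom) {m x₀ x₁ y₀ y₁ u v : ℝ} (hx : x₀ ≤ x₁) (h1 : y₀ ≤ u) (h2 : u ≤ v)
    (h3 : v ≤ y₁) :
    pr (Lam lam R) (Ev m true (rect x₀ x₁ y₀ y₁) (rect x₀ x₀ u v) (rect x₁ x₁ y₀ y₁) \
      Ev m true (rect x₀ x₁ y₀ y₁) (rect x₀ x₀ y₀ u) (rect x₁ x₁ y₀ y₁)) ≤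
    pr (Lam lam R) (Cov m (rect x₀ x₁ y₀ y₁))ᶜ +
      pr (Lam lam R) (Ev m true (rect x₀ x₁ y₀ y₁) (rect x₀ x₀ u v) (rect x₁ x₁ y₀ y₁)) *
      pr (Lam lam R) (Ev m true (rect x₀ x₁ y₀ y₁) (rect x₀ x₀ u v) (rect x₀ x₁ y₀ y₀)) := by
  set Q := rect x₀ x₁ y₀ y₁ with hQ
  set A := Ev m true Q (rect x₀ x₀ u v) (rect x₁ x₁ y₀ y₁)
  set Z := rect x₀ x₀ v y₁ ∪ rect x₀ x₁ y₁ y₁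
  set B := Ev m false Q (rect x₀ x₀ u v) (rect x₀ x₁ y₀ y₀)
  set B' := Ev m false Q (rect x₀ x₁ y₀ y₀) Z
  have e0 : pr (Lam lam R) (A ∩ B') = 0 := by
    refine pr_exclusive lam R (isCompact_rect _ _ _ _) (convex_rect _ _ _ _) (isClosed_rect _ _ _ _)
      (convex_rect _ _ _ _) (isClosed_rect _ _ _ _) (convex_rect _ _ _ _) (isCompact_rect _ _ _ _)
      (convex_rect _ _ _ _) (isClosed_rect _ _ _ _)
      ((isClosed_rect _ _ _ _).union (isClosed_rect _ _ _ _)) ?_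
    intro x hx y hy x' hx' y' hy' F hF G hG h h'
    rw [mem_rect] at hx hy hx'
    refine joinedIn_trap hF hG h h' (by linarith) (by linarith) (Or.inl (by linarith)) ?_
    rcases hy' with hy' | hy' <;> rw [mem_rect] at hy'
    · exact Or.inr ⟨by linarith, by linarith⟩
    · exact Or.inl (by linarith)
  have e1 : pr (Lam lam R) (A ∩ B) ≤ pr (Lam lam R) A *
      pr (Lam lam R) (Ev m true Q (rect x₀ x₀ u v) (rect x₀ x₁ y₀ y₀)) := by
    rw [← pr_false_eq lam R m (isCompact_rect _ _ _ _) (convex_rect _ _ _ _)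
      (isClosed_rect x₀ x₀ u v) (isClosed_rect x₀ x₁ y₀ y₀)]
    exact RedEv.inter_le (Lam lam R) (redEv_rect _ _ _ _ _ _ _ _ _ _ _ _ _)
      (redEv_false_compl _ (isCompact_rect _ _ _ _) (convex_rect _ _ _ _) (isClosed_rect _ _ _ _)
      (isClosed_rect _ _ _ _)) (obs_rect _ _ _ _ _ _ _ _ _ _ _ _ _ _)
  have e2 : pr (Lam lam R) (A \ Ev m true Q (rect x₀ x₀ y₀ u) (rect x₁ x₁ y₀ y₁)) ≤
      pr (Lam lam R) (((Cov m Q)ᶜ ∪ (A ∩ B)) ∪ (A ∩ B')) := by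
    refine pr_mono_finite _ fun S hS hSA => ?_
    by_cases hC : S ∈ Cov m Q
    · rcases conn_window_or hS hx h1 (h2.trans h3) hC with h | ⟨p, hp, q, hq, h⟩
      · exact absurd h hSA.2
      · rcases hq with hq | hq
        · rcases rect_split x₀ x₀ u v y₁ hq with hq | hq
          · exact Or.inl (Or.inr ⟨hSA.1, q, hq, p, hp, h.symm⟩)
          · exact Or.inr ⟨hSA.1, p, hp, q, Or.inl hq, h⟩
        · exact Or.inr ⟨hSA.1, p, hp, q, Or.inr hq, h⟩
    · exact Or.inl (Or.inl hC)
  have e3 := pr_union_le (Lam lam R) ((Cov m Q)ᶜ ∪ (A ∩ B)) (A ∩ B')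
  have e4 := pr_union_le (Lam lam R) (Cov m Q)ᶜ (A ∩ B)
  linarith

end Windows

section Windows

variable {lam : ℝ≥0}

/-- The connection from the window number `i` of the left side of a rectangle at distance `r` from
the vertical axis to the right side. -/
def Win (r : ℝ) (k i : ℕ) : Set (Set CPt) :=
  Ev (r / 4) true (rect r ((4 * k + 2) * r) 0 (4 * k * r)) (rect r r (4 * r * i) (4 * r * (i + 1)))
    (rect ((4 * k + 2) * r) ((4 * k + 2) * r) 0 (4 * k * r))

/-- The windows below a given height. -/
def Low (r : ℝ) (k j : ℕ) : Set (Set CPt) :=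
  Ev (r / 4) true (rect r ((4 * k + 2) * r) 0 (4 * k * r)) (rect r r 0 (4 * r * j))
    (rect ((4 * k + 2) * r) ((4 * k + 2) * r) 0 (4 * k * r))

lemma low_succ_subset (r : ℝ) (k j : ℕ) : Low r k (j + 1) ⊆ Low r k j ∪
    (Win r k j \ Low r k j) := by
  intro S hS
  by_cases h : S ∈ Low r k j
  · exact Or.inl h
  · refine Or.inr ⟨?_, h⟩
    rcases Ev_union_left (rect_split r r 0 (4 * r * j) (4 * r * ((j + 1 : ℕ) : ℝ))) hS with h' | h'
    · exact absurd h' h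
    · rw [Nat.cast_add_one] at h'
      exact h'

lemma pr_low_le (R : Dom) {r : ℝ} (hr : 0 < r) {k i₀ : ℕ} {e q : ℝ}
    (he : pr (Lam lam R) (Cov (r / 4) (rect r ((4 * k + 2) * r) 0 (4 * k * r)))ᶜ ≤ e)
    (hq : ∀ i, i₀ ≤ i → i < k → pr (Lam lam R) (Ev (r / 4) true
      (rect r ((4 * k + 2) * r) 0 (4 * k * r)) (rect r r (4 * r * i) (4 * r * (i + 1)))
      (rect r ((4 * k + 2) * r) 0 0)) ≤ q) {j : ℕ} (hj : i₀ ≤ j) (hjk : j ≤ k) :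
    pr (Lam lam R) (Low r k j) ≤ pr (Lam lam R) (Low r k i₀) +
      ∑ i ∈ Finset.Ico i₀ j, (e + pr (Lam lam R) (Win r k i) * q) := by
  induction j, hj using Nat.le_induction with
  | base => simp
  | succ j hj ih =>
    rw [Finset.sum_Ico_succ_top hj, ← add_assoc]
    refine (pr_le_add _ (low_succ_subset r k j)).trans (add_le_add (ih (by omega)) ?_)
    have hk : (j : ℝ) + 1 ≤ k := by exact_mod_cast hjk
    have hj0 : (0 : ℝ) ≤ j := j.cast_nonneg
    refine (pr_window_le R (m := r / 4) (x₀ := r) (x₁ := (4 * k + 2) * r) (y₀ := 0)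
      (y₁ := 4 * k * r) (u := 4 * r * j) (v := 4 * r * (j + 1)) (by nlinarith) (by positivity)
      (by nlinarith) (by nlinarith)).trans (add_le_add he ?_)
    exact mul_le_mul_of_nonneg_left (hq j hj (by omega)) (pr_nonneg _ _)

lemma RSW.le_low (R : Dom) {r c : ℝ} (hr : 0 < r) {k : ℕ} (hk : (1 : ℝ) ≤ k)
    (h : RSW lam (4 * k * r) c)
    (hR : rect (r - k * r) ((5 * k + 2) * r) (-(k * r)) (5 * k * r) ⊆ R.s) :
    c ≤ pr (Lam lam R) (Low r k k) +
      pr (Lam lam R) (Cov (r / 4) (rect r ((4 * k + 2) * r) 0 (4 * k * r)))ᶜ := by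
  have hkr : r ≤ k * r := le_mul_of_one_le_left hr.le ‹_›
  have h1 : LR lam (k * r) 0 ((4 * k + 1) * r) 0 (4 * k * r) c := by
    have := LR.shorten h (b := (4 * k + 1) * r) (by positivity) (by positivity) (by nlinarith)
    convert this using 1; ring
  have h2 := BR.trans (H' := univ) h1 (by positivity) r 0
  have e1 : rect (0 + r) ((4 * k + 1) * r + r) (0 + 0) (4 * k * r + 0) =
    rect r ((4 * k + 2) * r) 0 (4 * k * r) := by congr 1 <;> ring
  have h3 := h2.le R (by
    rw [univ_inter]
    refine inter_eq_right.2 ((rect_subset ?_ ?_ ?_ ?_).trans hR) <;> linarith)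
  refine h3.trans ((pr_mono _ ?_).trans (pr_union_le (Lam lam R) (Low r k k)
    (Cov (r / 4) (rect r ((4 * k + 2) * r) 0 (4 * k * r)))ᶜ))
  intro S hS
  by_cases hC : S ∈ Cov (r / 4) (rect r ((4 * k + 2) * r) 0 (4 * k * r))
  · left
    obtain ⟨x, hx, y, hy, hj⟩ := hS
    rw [e1] at hj
    rw [mem_rect] at hx hy
    refine ⟨x, mem_rect.2 ⟨⟨?_, ?_⟩, ?_, ?_⟩, y, mem_rect.2 ⟨⟨?_, ?_⟩, ?_, ?_⟩,
      hj.mono (reg_inter_subset hC true)⟩ <;> linarith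
  · exact Or.inr hC

lemma pr_arm_pow_le {c t T x y m : ℝ} (ht : 0 < t) (hc : 0 ≤ c)
    (h : ∀ s, t ≤ s → RSW lam s c) (R : Dom) (L : ℕ) (hL : t * 8 ^ L ≤ 2 * T)
    (hR : rect (x - T) (x + T) (y - T) (y + T) ⊆ R.s) (hm : 0 ≤ m) {D X Y : Set (ℝ × ℝ)}
    (hX : X ⊆ rect (x - t) (x + t) (y - t) (y + t))
    (hY : ∀ q ∈ Y, q.1 ≤ x - T ∨ x + T ≤ q.1 ∨ q.2 ≤ y - T ∨ y + T ≤ q.2) :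
    pr (Lam lam R) (Ev m true D X Y) ≤ (1 - c * c * c * c) ^ L := by
  have h1 : ∀ l : ℕ, t ≤ t * 8 ^ l := fun l =>
    le_mul_of_one_le_right ht.le (one_le_pow₀ (by norm_num))
  have h2 : ∀ l < L, 4 * (t * 8 ^ l) ≤ T := fun l hl => by
    have : (8 : ℝ) ^ (l + 1) ≤ 8 ^ L := pow_le_pow_right₀ (by norm_num) hl
    have := mul_le_mul_of_nonneg_left this ht.le
    rw [pow_succ] at this
    linarith
  refine pr_arm_le (x := x) (y := y) (u := fun l => t * 8 ^ l) (fun l =>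
      by positivity) (fun l => ?_)
    hc R L (fun l _ => h _ (by linarith [h1 l])) (fun l hl => ?_) hm (fun l hl => hX.trans ?_)
    (fun l hl p hp => ?_)
  · have := h1 l
    simp only [pow_succ]; linarith
  · have := h2 l hl
    have := h1 l
    refine (rect_subset ?_ ?_ ?_ ?_).trans hR <;> linarith
  · have := h1 l
    refine rect_subset ?_ ?_ ?_ ?_ <;> linarith
  · have := h2 l hl
    have := h1 l
    rcases hY p hp with h | h | h | h
    · exact Or.inl (by linarith)
    · exact Or.inr (Or.inl (by linarith))
    · exact Or.inr (Or.inr (Or.inl (by linarith)))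
    · exact Or.inr (Or.inr (Or.inr (by linarith)))

lemma exists_exp_le (T : ℝ) {c : ℝ} (hc : 0 < c) : ∃ C, ∀ x, C ≤ x → T * Real.exp (-x) ≤ c := by
  refine ⟨|T| / c, fun x hx => ?_⟩
  have h1 : T ≤ c * x := (le_abs_self T).trans (by rwa [div_le_iff₀' hc] at hx)
  have h2 := Real.add_one_le_exp x
  rw [Real.exp_neg, ← div_eq_mul_inv, div_le_iff₀ (Real.exp_pos x)]
  nlinarith

lemma exists_windows {c : ℝ} (hc : 0 < c)
    (h : ∀ (lam : ℝ≥0) (s : ℝ), 0 < s → C₀ ≤ lam * s ^ 2 → RSW lam s c) (M : ℝ) :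
    ∃ k : ℕ, 1 ≤ k ∧ ∃ C : ℝ, ∀ (lam : ℝ≥0) (r : ℝ), 0 < r → C ≤ lam * r ^ 2 → ∀ R : Dom,
      rect (-(20 * (k + 1) * r)) (20 * (k + 1) * r) (-(20 * (k + 1) * r)) (20 * (k + 1) * r) ⊆ R.s →
      M ≤ ∑ i ∈ Finset.range k, pr (Lam lam R) (Win r k i) := by
  obtain ⟨q, hq⟩ : ∃ q, q = 1 - c * c * c * c := ⟨_, rfl⟩
  have hq1 : q < 1 := by have : 0 < c * c * c * c := by positivity
                         linarith
  have hq0 : 0 ≤ q := by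
    have h1 : RSW (C₀ : ℝ).toNNReal 1 c := h _ 1 one_pos (by
      rw [Real.coe_toNNReal _ (by norm_num [C₀])]; norm_num)
    have hc1 : c ≤ 1 := (BR.le_pr h1 (A := -10) (B := 10) (C := -10) (E := 10)).trans
        (pr_le_one _ _)
    have : c * c * c * c ≤ 1 := by
      have : c * c ≤ 1 := by nlinarith
      have : c * c * c ≤ 1 := by nlinarith
      nlinarith
    linarith
  obtain ⟨L₀, hL₀⟩ := exists_pow_lt_of_lt_one (show 0 < c / (4 * (|M| + 1)) by positivity) hq1
  obtain ⟨L₁, hL₁⟩ := exists_pow_lt_of_lt_one (show 0 < c / 4 by positivity) hq1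
  obtain ⟨i₀, hi₀⟩ : ∃ i : ℕ, i = 2 * 8 ^ L₀ := ⟨_, rfl⟩
  obtain ⟨k, hk⟩ : ∃ k : ℕ, k = 3 * i₀ * 8 ^ L₁ := ⟨_, rfl⟩
  have hi1 : 1 ≤ i₀ := by have : 1 ≤ 8 ^ L₀ := Nat.one_le_pow _ _ (by norm_num)
                          omega
  have hik : 3 * i₀ ≤ k := by
    have : 1 ≤ 8 ^ L₁ := Nat.one_le_pow _ _ (by norm_num)
    rw [hk]; nlinarith
  obtain ⟨C, hC⟩ := exists_exp_le ((k + 1) * (144 * (4 * k + 1) * (4 * k)))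
      (show 0 < c / 4 by positivity)
  refine ⟨k, by omega, max C₀ (144 * C), fun lam r hr hlam R hR => ?_⟩
  have hlam0 : C₀ ≤ lam * r ^ 2 := (le_max_left _ _).trans hlam
  have hlamC : C ≤ lam * r ^ 2 / 144 := by
    have := (le_max_right _ _).trans hlam; linarith
  have hkR : (1 : ℝ) ≤ k := by exact_mod_cast (by omega : 1 ≤ k)
  have hi0R : (k : ℝ) = 3 * i₀ * 8 ^ L₁ := by rw [hk]; push_cast; ring
  have hi0R' : (i₀ : ℝ) = 2 * 8 ^ L₀ := by rw [hi₀]; push_cast; ring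
  have hi1R : (1 : ℝ) ≤ i₀ := by exact_mod_cast hi1
  have hkr : r ≤ k * r := le_mul_of_one_le_left hr.le ‹_›
  have hgrow : ∀ {s}, r ≤ s → RSW lam s c := fun {s} hs => h lam s (hr.trans_le hs)
    (hlam0.trans (mul_le_mul_of_nonneg_left (by nlinarith) lam.2))
  set e := err lam (r / 4) ((4 * k + 2) * r - r) (4 * k * r - 0)
  have he : pr (Lam lam R) (Cov (r / 4) (rect r ((4 * k + 2) * r) 0 (4 * k * r)))ᶜ ≤ e := by
    refine pr_not_cov_le lam R (by positivity) (by linarith) (by linarith)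
      ((rect_subset ?_ ?_ ?_ ?_).trans hR) <;> linarith
  have heC : (k + 1) * e ≤ c / 4 := by
    refine le_trans (le_of_eq ?_) (hC _ hlamC)
    simp only [e, err]
    have h1 : (lam : ℝ) * (r / 4) ^ 2 / 9 = lam * r ^ 2 / 144 := by ring
    rw [h1]
    field_simp
    ring
  have he0 : 0 ≤ e := (pr_nonneg _ _).trans he
  have hL1 : (i₀ : ℝ) ≤ k := by exact_mod_cast (by omega : i₀ ≤ k)
  have e1 : ∀ i, i₀ ≤ i → i < k → pr (Lam lam R) (Ev (r / 4) true
      (rect r ((4 * k + 2) * r) 0 (4 * k * r)) (rect r r (4 * r * i) (4 * r * (i + 1)))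
      (rect r ((4 * k + 2) * r) 0 0)) ≤ q ^ L₀ := by
    intro i hi hik
    have hiR : (i₀ : ℝ) ≤ i := by exact_mod_cast hi
    have hikR : (i : ℝ) + 1 ≤ k := by exact_mod_cast hik
    have hri : i₀ * r ≤ i * r := mul_le_mul_of_nonneg_right hiR hr.le
    have hrk : (i + 1) * r ≤ k * r := mul_le_mul_of_nonneg_right hikR hr.le
    have hir : 0 ≤ i₀ * r := by positivity
    rw [hq]
    refine pr_arm_pow_le (x := r) (y := 4 * r * i + 2 * r) (t := 2 * r) (T := 4 * r * i)
        (by positivity)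
      hc.le (fun s hs => hgrow (by linarith)) R L₀ ?_ ((rect_subset ?_ ?_ ?_ ?_).trans hR)
      (by positivity) (rect_subset ?_ ?_ ?_ ?_) fun p hp => ?_
    · have : 2 * r * 8 ^ L₀ = i₀ * r := by rw [hi0R']; ring
      linarith
    any_goals linarith
    rw [mem_rect] at hp
    exact Or.inr (Or.inr (Or.inl (by linarith)))
  have e2 : pr (Lam lam R) (Low r k i₀) ≤ c / 4 := by
    have hri : r ≤ i₀ * r := le_mul_of_one_le_left hr.le hi1R
    refine le_trans ?_ hL₁.le
    rw [hq]
    refine pr_arm_pow_le (x := r) (y := 0) (t := 4 * i₀ * r) (T := 4 * k * r) (by positivity)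
      hc.le (fun s hs => hgrow (by linarith)) R L₁ ?_ ((rect_subset ?_ ?_ ?_ ?_).trans hR)
      (by positivity) (rect_subset ?_ ?_ ?_ ?_) fun p hp => ?_
    · have : 4 * i₀ * r * 8 ^ L₁ = 4 / 3 * (k * r) := by rw [hi0R]; ring
      linarith
    any_goals linarith
    rw [mem_rect] at hp
    exact Or.inr (Or.inl (by linarith))
  have e3 : c ≤ pr (Lam lam R) (Low r k k) + e :=
    (RSW.le_low R hr hkR (hgrow (by linarith)) ((rect_subset (by linarith) (by linarith)
      (by linarith) (by linarith)).trans hR)).trans (add_le_add_right he _)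
  have e4 := pr_low_le R hr he e1 (by omega : i₀ ≤ k) le_rfl
  rw [Finset.sum_add_distrib, ← Finset.sum_mul, Finset.sum_const, Nat.card_Ico, nsmul_eq_mul] at e4
  have e5 : ((k - i₀ : ℕ) : ℝ) * e ≤ k * e := mul_le_mul_of_nonneg_right (by
    exact_mod_cast Nat.sub_le _ _) he0
  set T := ∑ i ∈ Finset.Ico i₀ k, pr (Lam lam R) (Win r k i)
  have e6 : T ≤ ∑ i ∈ Finset.range k, pr (Lam lam R) (Win r k i) := by
    rw [Finset.range_eq_Ico]
    exact Finset.sum_le_sum_of_subset_of_nonneg (Finset.Ico_subset_Ico (Nat.zero_le _) le_rfl)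
      fun _ _ _ => pr_nonneg _ _
  refine le_trans ?_ e6
  by_contra hM
  push Not at hM
  have e7 : T * q ^ L₀ ≤ c / 4 := by
    have h1 : 0 < |M| + 1 := by positivity
    have h2 : q ^ L₀ * (|M| + 1) ≤ c / 4 := by
      have := mul_le_mul_of_nonneg_right hL₀.le h1.le
      refine this.trans (le_of_eq ?_)
      field_simp
    have h3 : T ≤ |M| + 1 := by linarith [le_abs_self M]
    linarith [mul_le_mul_of_nonneg_right h3 (pow_nonneg hq0 L₀)]
  linarith

end Windows

/-! ### Crossings from the boundary of a half-plane -/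

section Boundary

variable {lam : ℝ≥0}

/-- Crossings of a square next to the boundary of the half-plane. -/
abbrev Box (lam : ℝ≥0) (r w : ℝ) : Prop :=
  BR HP lam (r / 4) 0 (2 * r) (-r) r 0 0 (-r) r (2 * r) (2 * r) (-r) r w

/-- The crossing of the box next to the boundary at height `y`. -/
def BoxEv (r y : ℝ) : Set (Set CPt) :=
  Ev (r / 4) true (rect 0 (2 * r) (y - r) (y + r)) (rect 0 0 (y - r) (y + r))
    (rect (2 * r) (2 * r) (y - r) (y + r))

/-- The four crossings that separate a window at height `y` from infinity. -/
def Cage (r y : ℝ) : Set (Set CPt) :=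
  ((Ev (r / 4) true (rect r (4 * r) (y + 2 * r) (y + 3 * r)) (rect r r (y + 2 * r) (y + 3 * r))
      (rect (4 * r) (4 * r) (y + 2 * r) (y + 3 * r)) ∩
    Ev (r / 4) true (rect r (4 * r) (y - 3 * r) (y - 2 * r)) (rect r r (y - 3 * r) (y - 2 * r))
      (rect (4 * r) (4 * r) (y - 3 * r) (y - 2 * r))) ∩
    Ev (r / 4) true (rect (3 * r) (4 * r) (y - 3 * r) (y + 3 * r))
      (rect (3 * r) (4 * r) (y - 3 * r) (y - 3 * r))
        (rect (3 * r) (4 * r) (y + 3 * r) (y + 3 * r))) ∩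
    Ev (r / 4) true (rect r (2 * r) (y - 3 * r) (y + 3 * r))
      (rect r (2 * r) (y - 3 * r) (y - 3 * r)) (rect r (2 * r) (y + 3 * r) (y + 3 * r))

lemma redEv_boxEv (r y : ℝ) : RedEv (BoxEv r y) := redEv_rect _ _ _ _ _ _ _ _ _ _ _ _ _

lemma redEv_cage (r y : ℝ) : RedEv (Cage r y) :=
  (((redEv_rect _ _ _ _ _ _ _ _ _ _ _ _ _).inter (redEv_rect _ _ _ _ _ _ _ _ _ _ _ _ _)).inter
    (redEv_rect _ _ _ _ _ _ _ _ _ _ _ _ _)).inter (redEv_rect _ _ _ _ _ _ _ _ _ _ _ _ _)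

lemma redEv_win (r : ℝ) (k i : ℕ) : RedEv (Win r k i) := redEv_rect _ _ _ _ _ _ _ _ _ _ _ _ _

/-- A path from a window to distance crosses the cage. -/
lemma cross_cage {r y : ℝ} (hr : 0 < r) {K T U V : Set (ℝ × ℝ)} (hK : IsPathConnected K)
    (hT : IsPathConnected T) (hU : IsPathConnected U) (hV : IsPathConnected V)
    (hTD : T ⊆ rect r (4 * r) (y + 2 * r) (y + 3 * r))
    (hUD : U ⊆ rect r (4 * r) (y - 3 * r) (y - 2 * r))
    (hVD : V ⊆ rect (3 * r) (4 * r) (y - 3 * r) (y + 3 * r))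
    (hT1 : ∃ z ∈ T, z.1 = r) (hT2 : ∃ z ∈ T, z.1 = 4 * r)
    (hU1 : ∃ z ∈ U, z.1 = r) (hU2 : ∃ z ∈ U, z.1 = 4 * r)
    (hV1 : ∃ z ∈ V, z.2 = y - 3 * r) (hV2 : ∃ z ∈ V, z.2 = y + 3 * r)
    (hKr : ∀ z ∈ K, r ≤ z.1) {p q : ℝ × ℝ} (hp : p ∈ K) (hq : q ∈ K) (hp1 : p.1 = r)
    (hp2 : y - 2 * r ≤ p.2) (hp3 : p.2 ≤ y + 2 * r) (hq1 : 4 * r ≤ q.1) :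
    (K ∩ (T ∪ U ∪ V)).Nonempty := by
  have hpD : p ∈ rect (r - 1) (4 * r) (y - 3 * r) (y + 3 * r) :=
    mem_rect.2 ⟨⟨by linarith, by linarith⟩, by linarith, by linarith⟩
  obtain ⟨L, hLK, hL, hLD, hpL, z, hz, hz'⟩ : ∃ L ⊆ K, IsPathConnected L ∧
      L ⊆ rect (r - 1) (4 * r) (y - 3 * r) (y + 3 * r) ∧ p ∈ L ∧
      ∃ z ∈ L, z.1 = 4 * r ∨ z.2 = y - 3 * r ∨ z.2 = y + 3 * r := by
    obtain ⟨L, hLK, hL, hLD, hpL, z, hz, hz'⟩ :=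
      exists_exit hK hp hq hpD (Or.inr (Or.inl hq1))
    refine ⟨L, hLK, hL, hLD, hpL, z, hz, hz'.resolve_left fun h => ?_⟩
    have := hKr z (hLK hz)
    linarith
  have hL4 : ∀ w ∈ L, w ∈ rect r (4 * r) (y - 3 * r) (y + 3 * r) := fun w hw => by
    have h1 := mem_rect.1 (hLD hw)
    exact mem_rect.2 ⟨⟨hKr w (hLK hw), h1.1.2⟩, h1.2⟩
  rcases hz' with h | h | h
  · obtain ⟨M, hML, hM, hMf, h1, h2⟩ := exists_strip hL continuous_fst (a := 3 * r) (b := 4 * r)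
      (by linarith) hpL hz (by linarith) h.ge
    refine (meet_rect hM hV (fun w hw => ?_) hVD h1 h2 hV1 hV2).mono
      (inter_subset_inter (hML.trans hLK) subset_union_right)
    exact mem_rect.2 ⟨hMf w hw, (mem_rect.1 (hL4 w (hML hw))).2⟩
  · obtain ⟨M, hML, hM, hMf, h1, h2⟩ := exists_strip hL continuous_snd (a := y - 3 * r)
      (b := y - 2 * r) (by linarith) hz hpL h.le hp2
    have := meet_rect hU hM hUD (fun w hw => mem_rect.2 ⟨(mem_rect.1 (hL4 w (hML hw))).1, hMf w hw⟩)
      hU1 hU2 h1 h2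
    rw [inter_comm] at this
    exact this.mono (inter_subset_inter (hML.trans hLK)
      (subset_union_right.trans subset_union_left))
  · obtain ⟨M, hML, hM, hMf, h1, h2⟩ := exists_strip hL continuous_snd (a := y + 2 * r)
      (b := y + 3 * r) (by linarith) hpL hz hp3 h.ge
    have := meet_rect hT hM hTD (fun w hw => mem_rect.2 ⟨(mem_rect.1 (hL4 w (hML hw))).1, hMf w hw⟩)
      hT1 hT2 h1 h2
    rw [inter_comm] at this
    exact this.mono (inter_subset_inter (hML.trans hLK)
      (subset_union_left.trans subset_union_left))

/-- A connection from a window is joined to the crossing of a box by a cage. -/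
lemma conn_of_cage {r y W H lo hi m : ℝ} (hr : 0 < r) (hm : r / 4 ≤ m) (hW : 4 * r ≤ W)
    (hlo : lo ≤ 0) (hlo' : lo ≤ y - 3 * r) (hhi : H ≤ hi) (hhi' : y + 3 * r ≤ hi) {S : Set CPt}
    (hA : Conn (r / 4) S true (rect r W 0 H) (rect r r (y - 2 * r) (y + 2 * r)) (rect W W 0 H))
    (hB : S ∈ BoxEv r y) (hC : S ∈ Cage r y) :
    Conn m S true (rect 0 W lo hi) (rect 0 0 lo hi) (rect W W lo hi) := by
  have hr4 : 0 ≤ r / 4 := by positivity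
  obtain ⟨K, hK, hKr, hKD, ⟨p, hp, hpX⟩, q, hq, hqX⟩ := Conn.exists_set hA hr4 hm
  obtain ⟨B, hB, hBr, hBD, ⟨b, hb, hbX⟩, b', hb', hbX'⟩ := Conn.exists_set hB hr4 hm
  obtain ⟨⟨⟨hT, hU⟩, hV⟩, hL⟩ := hC
  obtain ⟨T, hT, hTr, hTD, ⟨t, ht, htX⟩, t', ht', htX'⟩ := Conn.exists_set hT hr4 hm
  obtain ⟨U, hU, hUr, hUD, ⟨u, hu, huX⟩, u', hu', huX'⟩ := Conn.exists_set hU hr4 hm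
  obtain ⟨V, hV, hVr, hVD, ⟨v, hv, hvX⟩, v', hv', hvX'⟩ := Conn.exists_set hV hr4 hm
  obtain ⟨L, hL, hLr, hLD, ⟨l, hl, hlX⟩, l', hl', hlX'⟩ := Conn.exists_set hL hr4 hm
  rw [mem_rect] at hpX hqX hbX hbX' htX htX' huX huX' hvX hvX' hlX hlX'
  have f1 : (B ∩ L).Nonempty := meet hB hL hb hb' hl hl'
    (fun z hz => by have := mem_rect.1 (hLD hz); constructor <;> linarith)
    (fun z hz => by have := mem_rect.1 (hBD hz); constructor <;> linarith)
  have f2 : (T ∩ L).Nonempty := meet hT hL ht ht' hl hl'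
    (fun z hz => by have := mem_rect.1 (hLD hz); constructor <;> linarith)
    (fun z hz => by have := mem_rect.1 (hTD hz); constructor <;> linarith)
  have f3 : (T ∩ V).Nonempty := meet hT hV ht ht' hv hv'
    (fun z hz => by have := mem_rect.1 (hVD hz); constructor <;> linarith)
    (fun z hz => by have := mem_rect.1 (hTD hz); constructor <;> linarith)
  have f4 : (U ∩ V).Nonempty := meet hU hV hu hu' hv hv'
    (fun z hz => by have := mem_rect.1 (hVD hz); constructor <;> linarith)
    (fun z hz => by have := mem_rect.1 (hUD hz); constructor <;> linarith)
  have f5 : (K ∩ (T ∪ U ∪ V)).Nonempty := cross_cage hr hK hT hU hV hTD hUD hVD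
    ⟨t, ht, by linarith⟩ ⟨t', ht', by linarith⟩ ⟨u, hu, by linarith⟩ ⟨u', hu', by linarith⟩
    ⟨v, hv, by linarith⟩ ⟨v', hv', by linarith⟩ (fun z hz => (mem_rect.1 (hKD hz)).1.1) hp hq
    (by linarith) (by linarith) (by linarith) (by linarith)
  have g1 : IsPathConnected (T ∪ V ∪ U) := (hT.union hV f3).union hU (by
    rw [inter_comm]; exact f4.mono (inter_subset_inter_right _ subset_union_right))
  have g2 : IsPathConnected (B ∪ L) := hB.union hL f1
  have g3 : IsPathConnected ((B ∪ L) ∪ (T ∪ V ∪ U)) := g2.union g1 (by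
    rw [inter_comm]
    exact f2.mono (inter_subset_inter (subset_union_left.trans subset_union_left)
        subset_union_right))
  have g4 : IsPathConnected (K ∪ ((B ∪ L) ∪ (T ∪ V ∪ U))) := hK.union g3 (f5.mono
    (inter_subset_inter_right _ (by
      rw [union_assoc, union_comm U V, ← union_assoc]; exact subset_union_right)))
  refine Conn.of_set g4 ?_ ?_ ⟨b, ?_, mem_rect.2 ?_⟩ ⟨q, Or.inl hq, mem_rect.2 ?_⟩
  · exact union_subset hKr (union_subset (union_subset hBr hLr)
      (union_subset (union_subset hTr hVr) hUr))
  · refine union_subset (hKD.trans (rect_subset ?_ ?_ ?_ ?_)) (union_subset (union_subset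
      (hBD.trans (rect_subset ?_ ?_ ?_ ?_)) (hLD.trans (rect_subset ?_ ?_ ?_ ?_)))
      (union_subset (union_subset (hTD.trans (rect_subset ?_ ?_ ?_ ?_))
      (hVD.trans (rect_subset ?_ ?_ ?_ ?_))) (hUD.trans (rect_subset ?_ ?_ ?_ ?_)))) <;> linarith
  · exact Or.inr (Or.inl (Or.inl hb))
  · refine ⟨⟨?_, ?_⟩, ?_, ?_⟩ <;> linarith
  · refine ⟨⟨?_, ?_⟩, ?_, ?_⟩ <;> linarith

end Boundary

section Bonferroni

variable {X : Type*} [MeasurableSpace X] (Λ : Measure X) [IsFiniteMeasure Λ]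

lemma pr_union_ge {E : ℕ → Set (Set X)} (hE : ∀ i, Obs (E i)) {δ : ℝ} (hδ : 0 ≤ δ) (n : ℕ)
    (h : ∀ i < n, ∀ j < n, i ≠ j → pr Λ (E i ∩ E j) ≤ δ) :
    ∑ i ∈ Finset.range n, pr Λ (E i) - n ^ 2 * δ ≤ pr Λ (⋃ i ∈ Finset.range n, E i) := by
  induction n with
  | zero => simp [pr_nonneg]
  | succ n ih =>
    have h1 := ih fun i hi j hj => h i (by omega) j (by omega)
    have h2 : pr Λ (E n ∩ ⋃ i ∈ Finset.range n, E i) ≤ n * δ := by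
      rw [inter_iUnion₂]
      refine (pr_biUnion_le Λ _ _).trans ((Finset.sum_le_card_nsmul _ _ δ fun i hi => ?_).trans ?_)
      · have := Finset.mem_range.1 hi
        exact h n (by omega) i (by omega) (by omega)
      · simp
    have h3 : Obs (⋃ i ∈ Finset.range n, E i) := Obs.iUnion fun i => by
      by_cases hi : i ∈ Finset.range n
      · simpa [hi] using hE i
      · exact fun k => by simp [hi]
    have h4 := pr_inter_add_diff Λ (A := E n) h3
    have h5 := pr_add_disjoint Λ (A := E n \ ⋃ i ∈ Finset.range n, E i) h3 disjoint_sdiff_left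
    rw [sdiff_union_self] at h5
    have h6 : (⋃ i ∈ Finset.range (n + 1), E i) = E n ∪ ⋃ i ∈ Finset.range n, E i := by
      rw [Finset.range_add_one, Finset.set_biUnion_insert]
    rw [h6, h5, Finset.sum_range_succ]
    push_cast
    have : (0 : ℝ) ≤ (n : ℝ) * δ := by positivity
    nlinarith

end Bonferroni

/-- The inequality behind the induction over scales. -/
lemma le_of_bonferroni {k : ℕ} (hk : 1 ≤ k) {f w q M g : ℝ} {a : ℕ → ℝ} (hw : 0 ≤ w) (hwf : w ≤ f)
    (hwk : w ≤ 2 / k ^ 3) (hq : 0 ≤ q) (hM : 2 ≤ M * q)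
    (hS : M ≤ ∑ i ∈ Finset.range k, a i)
    (h1 : (∑ i ∈ Finset.range k, a i * f * q) - k ^ 2 * (f * f) ≤ g)
    (h2 : ∀ i < k, a i * f * q ≤ g) : w ≤ g := by
  have hk' : (1 : ℝ) ≤ k := by exact_mod_cast hk
  have hf : 0 ≤ f := hw.trans hwf
  by_cases h : f * k ^ 2 ≤ 1
  · rw [← Finset.sum_mul, ← Finset.sum_mul] at h1
    have e1 : M * (f * q) ≤ (∑ i ∈ Finset.range k, a i) * (f * q) := by gcongr
    have e2 : f * 2 ≤ f * (M * q) := by gcongr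
    have e3 : f * (f * k ^ 2) ≤ f * 1 := by gcongr
    linarith
  · push Not at h
    obtain ⟨i, hi, hai⟩ : ∃ i ∈ Finset.range k, M / k ≤ a i := by
      apply Finset.exists_le_of_sum_le ⟨0, Finset.mem_range.2 hk⟩
      rw [Finset.sum_const, Finset.card_range, nsmul_eq_mul, mul_div_cancel₀ _ (by positivity)]
      exact hS
    refine hwk.trans (le_trans ?_ (h2 i (Finset.mem_range.1 hi)))
    have e1 : 1 / (k : ℝ) ^ 2 ≤ f := by
      rw [div_le_iff₀ (by positivity)]; exact h.le
    calc 2 / (k : ℝ) ^ 3 = 2 / k * (1 / (k : ℝ) ^ 2) := by field_simp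
      _ ≤ M * q / k * f := by gcongr
      _ = M / k * (f * q) := by ring
      _ ≤ a i * (f * q) := by gcongr
      _ = a i * f * q := by ring

section Step

variable {lam : ℝ≥0} {r w c M : ℝ} {k : ℕ}

/-- A domain that agrees with the half-plane near the origin. -/
def halfDom (B : ℝ) : Dom := rectDom 0 B (-B) B

lemma halfDom_inter {B a b c d : ℝ} (hb : b ≤ B) (hc : -B ≤ c) (hd : d ≤ B) :
    (halfDom B).s ∩ rect a b c d = HP ∩ rect a b c d := by
  ext p
  have e : p ∈ (halfDom B).s ↔ (0 ≤ p.1 ∧ p.1 ≤ B) ∧ -B ≤ p.2 ∧ p.2 ≤ B := mem_rect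
  rw [mem_inter_iff, mem_inter_iff, e, mem_rect]
  constructor
  · rintro ⟨h1, h2⟩
    exact ⟨h1.1.1, h2⟩
  · rintro ⟨h1, h2⟩
    exact ⟨⟨⟨h1, by linarith⟩, by linarith, by linarith⟩, h2⟩

lemma halfDom_inter_univ {B a b c d : ℝ} (ha : 0 ≤ a) (hb : b ≤ B) (hc : -B ≤ c) (hd : d ≤ B) :
    (halfDom B).s ∩ rect a b c d = univ ∩ rect a b c d := by
  rw [univ_inter, inter_eq_right]
  exact rect_subset ha hb hc hd

lemma preimage_HP (v : ℝ) : (fun p : ℝ × ℝ => (p.1 + 0, p.2 + v)) ⁻¹' HP = HP := by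
  ext p; simp [HP]

lemma Bd.box {B y : ℝ} {q : ℝ} (hr : 0 < r) (hB : 3 * r ≤ B) (h1 : -B ≤ y - 2 * r)
    (h2 : y + 2 * r ≤ B)
    (hq : q ≤ pr (Lam lam (halfDom B)) (BoxEv r y)) : Box lam r q := by
  have h : BR HP lam (r / 4) 0 (2 * r) (y - r) (y + r) 0 0 (y - r) (y + r) (2 * r) (2 * r) (y - r)
      (y + r) q :=
    Bd.of_dom (measurableSet_rect _ _ _ _) (redEv_boxEv r y)
      (dep_rect _ _ (by positivity) le_rfl le_rfl le_rfl le_rfl)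
      (halfDom_inter (by linarith) (by linarith) (by linarith)) hq
  exact (h.trans (by positivity) 0 (-y) (preimage_HP _)).mono (by positivity)

lemma Box.le_pr {B y : ℝ} {q : ℝ} (h : Box lam r q) (hr : 0 < r) (hB : 3 * r ≤ B)
    (h1 : -B ≤ y - 2 * r) (h2 : y + 2 * r ≤ B) : q ≤ pr (Lam lam (halfDom B)) (BoxEv r y) := by
  have h' := (h.trans (by positivity) 0 y (preimage_HP _)).mono (by positivity) (m' := r / 4)
    (a' := 0) (b' := 2 * r) (c' := y - r) (d' := y + r) (x₁' := 0) (x₂' := 0) (x₃' := y - r)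
    (x₄' := y + r) (y₁' := 2 * r) (y₂' := 2 * r) (y₃' := y - r) (y₄' := y + r) (q' := q)
  exact h'.le _ (halfDom_inter (by linarith) (by linarith) (by linarith))

lemma pr_boxEv_inter {B y y' : ℝ} (hr : 0 < r) (hyy : y + 4 * r ≤ y') :
    pr (Lam lam (halfDom B)) (BoxEv r y ∩ BoxEv r y') =
      pr (Lam lam (halfDom B)) (BoxEv r y) * pr (Lam lam (halfDom B)) (BoxEv r y') := by
  have hr4 : 0 ≤ r / 4 := by positivity
  refine pr_indep _ (W := rect (0 - r / 4) (2 * r + r / 4) (y - r - r / 4) (y + r + r / 4) ×ˢ univ)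
    ((measurableSet_rect _ _ _ _).prod MeasurableSet.univ) (redEv_boxEv r y).obs
    (redEv_boxEv r y').obs (dep_rect _ _ hr4 le_rfl le_rfl le_rfl le_rfl)
    (dep_mono ?_ (dep_rect _ _ hr4 le_rfl le_rfl le_rfl le_rfl))
  rintro p ⟨hp, -⟩ ⟨hp', -⟩
  rw [mem_rect] at hp hp'
  linarith [hp.2.1, hp'.2.2]

/-- The lower bound for the probability of a cage. -/
lemma RSW.le_cage {B y : ℝ} (h : RSW lam r c) (hr : 0 < r) (hC : C₀ ≤ lam * r ^ 2) (hc : 0 < c)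
    (hB : 5 * r ≤ B) (h1 : -B ≤ y - 4 * r) (h2 : y + 4 * r ≤ B) :
    dbl^[3] c * dbl^[3] c * dbl^[3] c * dbl^[3] c ≤ pr (Lam lam (halfDom B)) (Cage r y) := by
  have hr4 : 0 ≤ r / 4 := by positivity
  have hq : 0 < dbl^[3] c := dbl_iter_pos hc 3
  obtain ⟨q, hqe⟩ : ∃ q, q = dbl^[3] c := ⟨_, rfl⟩
  have k3 : LR lam (r / 4) 0 (3 * r) 0 r (dbl^[3] c) :=
    h.long hr hC hc (by positivity) (by linarith)
  have k6 : LR lam (r / 4) 0 (6 * r) 0 r (dbl^[3] c) :=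
    h.long hr hC hc (by positivity) (by linarith)
  have t6 : TB lam (r / 4) 0 r 0 (6 * r) (dbl^[3] c) := k6.swap (H' := univ) hr4
  rw [← hqe] at k3 t6 hq ⊢
  have e1 := BR.mono (k3.trans (H' := univ) hr4 r (y + 2 * r)) hr4 (m' := r / 4) (q' := q)
    (a' := r) (b' := 4 * r) (c' := y + 2 * r) (d' := y + 3 * r)
    (x₁' := r) (x₂' := r) (x₃' := y + 2 * r) (x₄' := y + 3 * r)
    (y₁' := 4 * r) (y₂' := 4 * r) (y₃' := y + 2 * r) (y₄' := y + 3 * r)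
  have e2 := BR.mono (k3.trans (H' := univ) hr4 r (y - 3 * r)) hr4 (m' := r / 4) (q' := q)
    (a' := r) (b' := 4 * r) (c' := y - 3 * r) (d' := y - 2 * r)
    (x₁' := r) (x₂' := r) (x₃' := y - 3 * r) (x₄' := y - 2 * r)
    (y₁' := 4 * r) (y₂' := 4 * r) (y₃' := y - 3 * r) (y₄' := y - 2 * r)
  have e3 := BR.mono (t6.trans (H' := univ) hr4 (3 * r) (y - 3 * r)) hr4 (m' := r / 4) (q' := q)
    (a' := 3 * r) (b' := 4 * r) (c' := y - 3 * r) (d' := y + 3 * r)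
    (x₁' := 3 * r) (x₂' := 4 * r) (x₃' := y - 3 * r) (x₄' := y - 3 * r)
    (y₁' := 3 * r) (y₂' := 4 * r) (y₃' := y + 3 * r) (y₄' := y + 3 * r)
  have e4 := BR.mono (t6.trans (H' := univ) hr4 r (y - 3 * r)) hr4 (m' := r / 4) (q' := q)
    (a' := r) (b' := 2 * r) (c' := y - 3 * r) (d' := y + 3 * r)
    (x₁' := r) (x₂' := 2 * r) (x₃' := y - 3 * r) (x₄' := y - 3 * r)
    (y₁' := r) (y₂' := 2 * r) (y₃' := y + 3 * r) (y₄' := y + 3 * r)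
  have g1 := e1.le (halfDom B)
    (halfDom_inter_univ (by linarith) (by linarith) (by linarith) (by linarith))
  have g2 := e2.le (halfDom B)
    (halfDom_inter_univ (by linarith) (by linarith) (by linarith) (by linarith))
  have g3 := e3.le (halfDom B)
    (halfDom_inter_univ (by linarith) (by linarith) (by linarith) (by linarith))
  have g4 := e4.le (halfDom B)
    (halfDom_inter_univ (by linarith) (by linarith) (by linarith) (by linarith))
  exact ((e1.red.inter e2.red).inter e3.red).le_inter _ e4.red
    ((e1.red.inter e2.red).le_inter _ e3.red (e1.red.le_inter _ e2.red g1 g2 hq.le) g3 hq.le) g4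
      hq.le

/-- The passage from a box to a larger box. -/
lemma Box.grow (hw : 0 ≤ w) (h : Box lam r w) (hr : 0 < r) (hC : C₀ ≤ lam * r ^ 2) (hc : 0 < c)
    (hR : RSW lam r c) (hk : 1 ≤ k) (hwk : w ≤ 2 / k ^ 3)
    (hM : 2 ≤ M * (dbl^[3] c * dbl^[3] c * dbl^[3] c * dbl^[3] c))
    (hS : ∀ R : Dom,
      rect (-(20 * (k + 1) * r)) (20 * (k + 1) * r) (-(20 * (k + 1) * r)) (20 * (k + 1) * r) ⊆ R.s →
      M ≤ ∑ i ∈ Finset.range k, pr (Lam lam R) (Win r k i)) : Box lam ((2 * k + 1) * r) w := by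
  obtain ⟨B, hB⟩ : ∃ B, B = 20 * (k + 1) * r := ⟨_, rfl⟩
  have hk' : (1 : ℝ) ≤ k := by exact_mod_cast hk
  have hkr : r ≤ k * r := by nlinarith
  have hr4 : 0 ≤ r / 4 := by positivity
  have hy : ∀ i : ℕ, 0 ≤ i * r := fun i => by positivity
  have hyk : ∀ i < k, (i : ℝ) * r + r ≤ k * r := fun i hi => by
    have : (i : ℝ) + 1 ≤ k := by exact_mod_cast hi
    nlinarith
  obtain ⟨q, hq⟩ : ∃ q, q = dbl^[3] c * dbl^[3] c * dbl^[3] c * dbl^[3] c := ⟨_, rfl⟩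
  have hq0 : 0 ≤ q := by have := dbl_iter_pos hc 3; rw [hq]; positivity
  obtain ⟨f, hf⟩ : ∃ f, f = pr (Lam lam (halfDom B)) (BoxEv r 0) := ⟨_, rfl⟩
  have hf0 : 0 ≤ f := hf ▸ pr_nonneg _ _
  have hwf : w ≤ f := hf ▸ h.le_pr hr (by linarith) (by linarith) (by linarith)
  have hbox : ∀ i < k, pr (Lam lam (halfDom B)) (BoxEv r (4 * r * i + 2 * r)) = f := fun i hi => by
    have h1 := hy i
    have h2 := hyk i hi
    rw [hf]
    exact le_antisymm
      ((Bd.box (y := 4 * r * i + 2 * r) hr (by linarith) (by linarith) (by linarith) le_rfl).le_pr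
        hr (by linarith) (by linarith) (by linarith))
      ((Bd.box (y := 0) hr (by linarith) (by linarith) (by linarith) le_rfl).le_pr
        hr (by linarith) (by linarith) (by linarith))
  have hwin : ∀ i, pr (Lam lam (halfDom B)) (Win r k i) =
      pr (Lam lam (rectDom (-B) B (-B) B)) (Win r k i) := fun i => by
    refine pr_congr_dom lam (W := rect (r - r / 4) ((4 * k + 2) * r + r / 4) (0 - r / 4)
      (4 * k * r + r / 4)) (measurableSet_rect _ _ _ _) (redEv_win r k i).obs
      (dep_rect _ _ hr4 le_rfl le_rfl le_rfl le_rfl) ?_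
    rw [halfDom_inter_univ (by linarith) (by linarith) (by linarith) (by linarith), univ_inter,
        eq_comm,
      inter_eq_right]
    exact rect_subset (by linarith) (by linarith) (by linarith) (by linarith)
  obtain ⟨E, hE⟩ : ∃ E : ℕ → Set (Set CPt), E = fun i : ℕ =>
      Win r k i ∩ BoxEv r (4 * r * i + 2 * r) ∩
    Cage r (4 * r * i + 2 * r) := ⟨_, rfl⟩
  have hEr : ∀ i, RedEv (E i) := fun i => by
    rw [hE]; exact ((redEv_win r k i).inter (redEv_boxEv _ _)).inter (redEv_cage _ _)
  have hEp : ∀ i < k, pr (Lam lam (halfDom B)) (Win r k i) * f * q ≤ pr (Lam lam (halfDom B))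
      (E i) := by
    intro i hi
    have h1 := hy i
    have h2 := hyk i hi
    rw [hE]
    refine ((redEv_win r k i).inter (redEv_boxEv _ _)).le_inter _ (redEv_cage _ _)
      ((redEv_win r k i).le_inter _ (redEv_boxEv _ _) le_rfl (hbox i hi).ge hf0) ?_ hq0
    rw [hq]
    exact hR.le_cage hr hC hc (by linarith) (by linarith) (by linarith)
  have hEE : ∀ i < k, ∀ j < k, i ≠ j → pr (Lam lam (halfDom B)) (E i ∩ E j) ≤ f * f := by
    have key : ∀ i < k, ∀ j < k, i < j → pr (Lam lam (halfDom B)) (E i ∩ E j) ≤ f * f := by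
      intro i hi j hj hij
      have h3 : (i : ℝ) * r + r ≤ j * r := by
        have : (i : ℝ) + 1 ≤ j := by exact_mod_cast hij
        nlinarith
      calc pr (Lam lam (halfDom B)) (E i ∩ E j) ≤ pr (Lam lam (halfDom B))
            (BoxEv r (4 * r * i + 2 * r) ∩ BoxEv r (4 * r * j + 2 * r)) := by
            rw [hE]
            exact pr_mono _ fun S hS => ⟨hS.1.1.2, hS.2.1.2⟩
        _ = f * f := by rw [pr_boxEv_inter hr (by linarith), hbox i hi, hbox j hj]
    intro i hi j hj hij
    rcases lt_or_gt_of_ne hij with h | h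
    · exact key i hi j hj h
    · rw [inter_comm]; exact key j hj i hi h
  obtain ⟨T, hT⟩ : ∃ T, T = Ev ((2 * k + 1) * r / 4) true
    (rect 0 ((4 * k + 2) * r) (-r) ((4 * k + 1) * r)) (rect 0 0 (-r) ((4 * k + 1) * r))
    (rect ((4 * k + 2) * r) ((4 * k + 2) * r) (-r) ((4 * k + 1) * r)) := ⟨_, rfl⟩
  have hET : ∀ i < k, E i ⊆ T := fun i hi S hS => by
    have h1 := hy i
    have h2 := hyk i hi
    rw [hE] at hS
    rw [hT]
    obtain ⟨⟨a1, a2⟩, a3⟩ := hS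
    refine conn_of_cage (H := 4 * k * r) (y := 4 * r * i + 2 * r) hr (by linarith) (by linarith)
      (by linarith) (by linarith) (by linarith) (by linarith) ?_ a2 a3
    have e1 : 4 * r * i + 2 * r - 2 * r = 4 * r * i := by ring
    have e2 : 4 * r * i + 2 * r + 2 * r = 4 * r * (i + 1) := by ring
    rw [e1, e2]
    exact a1
  have hw' : w ≤ pr (Lam lam (halfDom B)) T := by
    refine le_of_bonferroni (a := fun i => pr (Lam lam (halfDom B)) (Win r k i)) hk hw hwf hwk hq0
      (by rw [hq]; exact hM) ?_ ?_ fun i hi => (hEp i hi).trans (pr_mono _ (hET i hi))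
    · simp only [hwin]
      exact hS _ (by rw [hB]; exact Subset.rfl)
    · refine le_trans ?_ ((pr_union_ge (Lam lam (halfDom B)) (fun i => (hEr i).obs)
        (mul_nonneg hf0 hf0) k hEE).trans (pr_mono _ (iUnion₂_subset fun i hi =>
          hET i (Finset.mem_range.1 hi))))
      exact sub_le_sub_right (Finset.sum_le_sum fun i hi => hEp i (Finset.mem_range.1 hi)) _
  have hbig : BR HP lam ((2 * k + 1) * r / 4) 0 ((4 * k + 2) * r) (-r) ((4 * k + 1) * r) 0 0 (-r)
      ((4 * k + 1) * r) ((4 * k + 2) * r) ((4 * k + 2) * r) (-r) ((4 * k + 1) * r) w := by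
    refine Bd.of_dom (R := halfDom B) (measurableSet_rect _ _ _ _)
        (redEv_rect _ _ _ _ _ _ _ _ _ _ _ _ _)
      (dep_rect _ _ (by positivity) le_rfl le_rfl le_rfl le_rfl)
      (halfDom_inter (by linarith) (by linarith) (by linarith)) ?_
    rw [← hT]
    exact hw'
  exact (hbig.trans (by positivity) 0 (-(2 * k * r)) (preimage_HP _)).mono (by positivity)

lemma Box.base {Q : ℝ} (hr : 0 < r) (hC : C₀ ≤ lam * r ^ 2) (hQ : lam * r ^ 2 ≤ Q) :
    Box lam r (Real.exp (-(7 * Q)) * (1 / 2)) := by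
  refine Bd.box (B := 3 * r) (y := 0) hr le_rfl (by linarith) (by linarith) (le_trans ?_
    (exp_le_pr (lam := lam) (halfDom (3 * r)) (a := 0) (b := 2 * r) (c := 0 - r) (d := 0 + r)
      (m := r / 4) (x := (0, 0)) (y := (2 * r, 0)) (by positivity) (by linarith) (by linarith)
      (rect_subset le_rfl (by linarith) (by linarith) (by linarith)) ?_ ?_ ?_ ?_ ?_))
  · have h1 : (0 : ℝ) ≤ lam * r ^ 2 := by positivity
    have h2 : lam * ((2 * r - 0 + 2 * (r / 4)) * (0 + r - (0 - r) + 2 * (r / 4))) ≤ 7 * Q := by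
      linarith
    exact mul_le_mul_of_nonneg_right (Real.exp_le_exp.2 (neg_le_neg h2)) (by norm_num)
  · have e : err lam (r / 4) (2 * r - 0) (0 + r - (0 - r)) =
        576 * Real.exp (-(lam * r ^ 2 / 144)) := by
      rw [err]
      congr 1
      · field_simp; ring
      · ring_nf
    rw [e]
    have := exp_neg_le (x := lam * r ^ 2 / 144) (by rw [C₀] at hC; linarith)
    linarith
  all_goals
    exact mem_rect.2
      ⟨⟨by simp; try linarith, by simp; try linarith⟩, by simp; try linarith, by simp; try linarith⟩

end Step

/-- Boxes next to the boundary are crossed with a probability bounded from below. -/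
theorem exists_box : ∃ C c : ℝ, 0 < c ∧ ∀ (lam : ℝ≥0) (r : ℝ), 0 < r → C ≤ lam * r ^ 2 →
    Box lam r c := by
  obtain ⟨c, hc, hR⟩ := exists_rsw
  have hq : 0 < dbl^[3] c := dbl_iter_pos hc 3
  obtain ⟨k, hk, C, hW⟩ := exists_windows hc hR
    (2 / (dbl^[3] c * dbl^[3] c * dbl^[3] c * dbl^[3] c))
  have hk' : (1 : ℝ) ≤ k := by exact_mod_cast hk
  obtain ⟨N, hN⟩ : ∃ N : ℝ, N = 2 * k + 1 := ⟨_, rfl⟩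
  have hN1 : 1 < N := by linarith
  have hN2 : 1 < N ^ 2 := by nlinarith
  obtain ⟨C', hC'⟩ : ∃ C', C' = max C₀ C := ⟨_, rfl⟩
  have hC0 : 0 < C' := by rw [hC']; exact lt_max_of_lt_left (by norm_num [C₀])
  obtain ⟨w, hw⟩ : ∃ w, w = min (Real.exp (-(7 * (C' * N ^ 2))) * (1 / 2)) (2 / (k : ℝ) ^ 3) :=
      ⟨_, rfl⟩
  have hw0 : 0 < w := by rw [hw]; exact lt_min (by positivity) (by positivity)
  have key : ∀ (n : ℕ) (lam : ℝ≥0) (r : ℝ), 0 < r → C' ≤ lam * r ^ 2 →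
      lam * r ^ 2 ≤ C' * (N ^ 2) ^ (n + 1) → Box lam r w := by
    intro n
    induction n with
    | zero =>
      intro lam r hr h1 h2
      refine BR.mono (Box.base (Q := C' * N ^ 2) hr (le_trans (by rw [hC']; exact le_max_left _ _)
          h1)
        (by simpa using h2)) (by positivity) (hq := ?_)
      rw [hw]; exact min_le_left _ _
    | succ n ih =>
      intro lam r hr h1 h2
      by_cases h : lam * r ^ 2 ≤ C' * (N ^ 2) ^ (n + 1)
      · exact ih lam r hr h1 h
      · push Not at h
        have hN0 : 0 < N := by linarith
        have e : lam * (r / N) ^ 2 * N ^ 2 = lam * r ^ 2 := by field_simp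
        have h3 : C' ≤ lam * (r / N) ^ 2 := by
          refine le_of_mul_le_mul_right (a := N ^ 2) ?_ (by positivity)
          rw [e]
          refine le_trans ?_ h.le
          have : N ^ 2 ≤ (N ^ 2) ^ (n + 1) := le_self_pow₀ hN2.le (by omega)
          gcongr
        have h4 : lam * (r / N) ^ 2 ≤ C' * (N ^ 2) ^ (n + 1) := by
          refine le_of_mul_le_mul_right (a := N ^ 2) ?_ (by positivity)
          rw [e, mul_assoc, ← pow_succ]
          exact h2
        have hr' : 0 < r / N := by positivity
        have h5 : C₀ ≤ lam * (r / N) ^ 2 := le_trans (by rw [hC']; exact le_max_left _ _) h3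
        have := Box.grow hw0.le (ih lam _ hr' h3 h4) hr' h5 hc (hR lam _ hr' h5) hk
          (by rw [hw]; exact min_le_right _ _) (by rw [div_mul_cancel₀ _ (by positivity)])
          (hW lam _ hr' (le_trans (by rw [hC']; exact le_max_right _ _) h3))
        rwa [← hN, mul_div_cancel₀ _ hN0.ne'] at this
  refine ⟨C', w, hw0, fun lam r hr h1 => ?_⟩
  obtain ⟨n, hn⟩ := pow_unbounded_of_one_lt (lam * r ^ 2 / C') hN2
  refine key n lam r hr h1 ?_
  rw [div_lt_iff₀ hC0] at hn
  have : (N ^ 2) ^ n ≤ (N ^ 2) ^ (n + 1) := pow_le_pow_right₀ hN2.le (by omega)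
  nlinarith

section Counting

lemma add_one_pow_le (n : ℕ) : ((n : ℝ) + 1) ^ n ≤ Real.exp 1 * n ^ n := by
  rcases n.eq_zero_or_pos with rfl | hn
  · simp
  · have hn' : (0 : ℝ) < n := by exact_mod_cast hn
    have h1 : (1 : ℝ) / n + 1 ≤ Real.exp (1 / n) := Real.add_one_le_exp _
    have h2 : ((1 : ℝ) / n + 1) ^ n ≤ Real.exp 1 := by
      calc ((1 : ℝ) / n + 1) ^ n ≤ Real.exp (1 / n) ^ n := by gcongr
        _ = Real.exp 1 := by rw [← Real.exp_nat_mul]; congr 1; field_simp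
    have h3 : (n : ℝ) + 1 = (1 / n + 1) * n := by field_simp; ring
    rw [h3, mul_pow]
    gcongr

lemma monotone_factorial_mul_exp_div :
    Monotone fun n : ℕ => (n.factorial : ℝ) * Real.exp n / (n : ℝ) ^ n := by
  refine monotone_nat_of_le_succ fun n => ?_
  have hp : (0 : ℝ) < (n : ℝ) ^ n := by
    rcases n.eq_zero_or_pos with rfl | hn
    · simp
    · positivity
  have hq : (0 : ℝ) < ((n : ℝ) + 1) ^ n := by positivity
  have e : ((n + 1).factorial : ℝ) * Real.exp ((n + 1 : ℕ) : ℝ) / ((n + 1 : ℕ) : ℝ) ^ (n + 1) =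
      (n.factorial : ℝ) * Real.exp n * (Real.exp 1 / ((n : ℝ) + 1) ^ n) := by
    push_cast [Nat.factorial_succ]
    rw [Real.exp_add, pow_succ]
    field_simp
  rw [e, div_eq_mul_inv]
  gcongr
  rw [inv_eq_one_div, div_le_div_iff₀ hp hq]
  linarith [add_one_pow_le n]

lemma poisson_le_binomial {n j : ℕ} (hn : 0 < n) (hj : j ≤ n) {p : ℝ} (hp : p ≤ 1 / 2) :
    Real.exp (-(n * p)) * ((n : ℝ) ^ j / j.factorial) ≤
      Real.exp ((j - n * p) ^ 2 / (n * (1 - p))) * ((n.choose j : ℝ) * (1 - p) ^ (n - j)) := by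
  obtain ⟨k, rfl⟩ := Nat.exists_eq_add_of_le hj
  have hn' : (0 : ℝ) < ((j + k : ℕ) : ℝ) := by exact_mod_cast hn
  obtain ⟨N, hN⟩ : ∃ N : ℝ, N = ((j + k : ℕ) : ℝ) := ⟨_, rfl⟩
  have hNk : N = j + k := by rw [hN]; push_cast; rfl
  have hl : 0 < N * (1 - p) := by rw [hN]; apply mul_pos hn'; linarith
  rw [Nat.add_sub_cancel_left]
  have hm := monotone_factorial_mul_exp_div (Nat.le_add_left k j)
  simp only at hm
  rw [← hN] at hm hn' ⊢
  have hkk : (0 : ℝ) < (k : ℝ) ^ k := by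
    rcases k.eq_zero_or_pos with rfl | hk
    · simp
    · positivity
  have hNN : (0 : ℝ) < N ^ (j + k) := by positivity
  rw [div_le_div_iff₀ hkk hNN] at hm
  have hk1 : (k : ℝ) ^ k ≤ (N * (1 - p)) ^ k * Real.exp (k * (k / (N * (1 - p)) - 1)) := by
    have h1 : (k : ℝ) / (N * (1 - p)) ≤ Real.exp (k / (N * (1 - p)) - 1) := by
      have := Real.add_one_le_exp ((k : ℝ) / (N * (1 - p)) - 1)
      linarith
    have h2 : (k : ℝ) = (N * (1 - p)) * (k / (N * (1 - p))) := by
      rw [mul_div_cancel₀]; exact hl.ne'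
    calc (k : ℝ) ^ k = (N * (1 - p)) ^ k * (k / (N * (1 - p))) ^ k := by rw [← mul_pow, ← h2]
      _ ≤ (N * (1 - p)) ^ k * Real.exp (k / (N * (1 - p)) - 1) ^ k := by gcongr
      _ = _ := by rw [← Real.exp_nat_mul]
  have hch : ((j + k).choose j : ℝ) = ((j + k).factorial : ℝ) / (j.factorial * k.factorial) := by
    rw [Nat.choose_eq_factorial_div_factorial (Nat.le_add_right j k), Nat.add_sub_cancel_left,
      Nat.cast_div (Nat.factorial_mul_factorial_dvd_factorial_add j k) (by positivity)]
    push_cast; rfl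
  rw [hch]
  have key : Real.exp (-(N * p)) * N ^ (j + k) * k.factorial ≤
      Real.exp ((j - N * p) ^ 2 / (N * (1 - p))) * (j + k).factorial * (N * (1 - p)) ^ k := by
    have h3 : Real.exp ((j - N * p) ^ 2 / (N * (1 - p))) =
        Real.exp (-(N * p)) * Real.exp (-k) * Real.exp N *
          Real.exp (k * (k / (N * (1 - p)) - 1)) := by
      rw [← Real.exp_add, ← Real.exp_add, ← Real.exp_add]
      congr 1
      rw [div_eq_iff hl.ne']
      have h4 : k * (k / (N * (1 - p)) - 1) * (N * (1 - p)) = k * (k - N * (1 - p)) := by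
        rw [mul_assoc, sub_mul, div_mul_cancel₀ _ hl.ne', one_mul]
      have h5 : (j : ℝ) = N - k := by linarith
      linear_combination (exp := 1) (-1 : ℝ) * h4 + (j + (N - k) - 2 * N * p) * h5
    calc Real.exp (-(N * p)) * N ^ (j + k) * k.factorial
        = Real.exp (-(N * p)) * Real.exp (-k) * (k.factorial * Real.exp k * N ^ (j + k)) := by
          rw [Real.exp_neg (k : ℝ)]; field_simp
      _ ≤ Real.exp (-(N * p)) * Real.exp (-k) * ((j + k).factorial * Real.exp N * k ^ k) := by
          gcongr
      _ ≤ Real.exp (-(N * p)) * Real.exp (-k) * ((j + k).factorial * Real.exp N *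
          ((N * (1 - p)) ^ k * Real.exp (k * (k / (N * (1 - p)) - 1)))) := by gcongr
      _ = _ := by rw [h3]; ring
  rw [mul_pow, pow_add] at key
  have hNk : (0 : ℝ) < N ^ k := by positivity
  have e1 : Real.exp (-(N * p)) * (N ^ j / j.factorial) =
      (Real.exp (-(N * p)) * (N ^ j * N ^ k) * k.factorial) /
        (N ^ k * j.factorial * k.factorial) := by
    field_simp
  have e2 : Real.exp ((j - N * p) ^ 2 / (N * (1 - p))) *
      (((j + k).factorial : ℝ) / (j.factorial * k.factorial) * (1 - p) ^ k) =
      (Real.exp ((j - N * p) ^ 2 / (N * (1 - p))) * (j + k).factorial * (N ^ k * (1 - p) ^ k)) /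
        (N ^ k * j.factorial * k.factorial) := by
    field_simp
  rw [e1, e2]
  gcongr

lemma hasSum_sq_sub_poisson (a : ℝ) :
    HasSum (fun j : ℕ => ((j : ℝ) - a) ^ 2 * (Real.exp (-a) * (a ^ j / j.factorial))) a := by
  have h0 : HasSum (fun j : ℕ => a ^ j / j.factorial) (Real.exp a) := by
    have := NormedSpace.expSeries_div_hasSum_exp (𝔸 := ℝ) a
    rwa [← Real.exp_eq_exp_ℝ] at this
  have h1 : HasSum (fun j : ℕ => (j : ℝ) * (a ^ j / j.factorial)) (a * Real.exp a) := by
    rw [← hasSum_nat_add_iff' 1]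
    simp only [Finset.range_one, Finset.sum_singleton, Nat.cast_zero, zero_mul, sub_zero]
    refine (h0.mul_left a).congr_fun ?_
    intro j
    push_cast [Nat.factorial_succ]
    field_simp
    ring
  have h2 : HasSum (fun j : ℕ => (j : ℝ) * (j - 1) * (a ^ j / j.factorial))
      (a * (a * Real.exp a)) := by
    rw [← hasSum_nat_add_iff' 1]
    simp only [Finset.range_one, Finset.sum_singleton, Nat.cast_zero, zero_mul, sub_zero]
    refine (h1.mul_left a).congr_fun ?_
    intro j
    push_cast [Nat.factorial_succ]
    field_simp
    ring
  have h := ((h2.add (h1.mul_left (1 - 2 * a))).add (h0.mul_left (a ^ 2))).mul_left (Real.exp (-a))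
  have e : Real.exp (-a) * (a * (a * Real.exp a) + (1 - 2 * a) * (a * Real.exp a) +
      a ^ 2 * Real.exp a) = a := by
    rw [Real.exp_neg]
    field_simp
    ring
  rw [e] at h
  refine h.congr_fun fun j => ?_
  ring

lemma exp_mul_le_sum_choose {n : ℕ} {p c : ℝ} (hp0 : 0 ≤ p) (hp : p ≤ 1 / 2) (hc : 0 < c)
    (hn : 4 / c < n) {b : ℕ → ℝ} (hb0 : ∀ j, 0 ≤ b j) (hb : ∀ j, b j ≤ p ^ j)
    (h : c ≤ ∑' j : ℕ, Real.exp (-(n * p)) * ((n : ℝ) ^ j / j.factorial * b j)) :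
    Real.exp (-(2 / c)) * (c / 2) ≤
      ∑ j ∈ Finset.range (n + 1), (n.choose j : ℝ) * (1 - p) ^ (n - j) * b j := by
  have hn0 : (0 : ℝ) < n := lt_trans (by positivity) hn
  have hn1 : 0 < n := by exact_mod_cast hn0
  have h2 := (hasSum_sq_sub_poisson (n * p)).mul_left (c / n)
  obtain ⟨B, hB⟩ : ∃ B : ℕ → ℝ, B = fun j => if j < n + 1 then Real.exp (2 / c) *
    ((n.choose j : ℝ) * (1 - p) ^ (n - j) * b j) else 0 := ⟨_, rfl⟩
  have h1p : 0 ≤ 1 - p := by linarith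
  have hB0 : ∀ j, 0 ≤ B j := fun j => by
    rw [hB]
    dsimp only
    split_ifs
    · have := hb0 j
      positivity
    · exact le_rfl
  have h1 : HasSum B (∑ j ∈ Finset.range (n + 1), B j) :=
    hasSum_sum_of_ne_finset_zero fun j hj => by
      rw [hB]
      dsimp only
      rw [if_neg]
      simpa using hj
  have h3 := h1.add h2
  have hle : ∀ j : ℕ, Real.exp (-(n * p)) * ((n : ℝ) ^ j / j.factorial * b j) ≤
      B j + c / n * (((j : ℝ) - n * p) ^ 2 *
        (Real.exp (-(n * p)) * ((n * p) ^ j / j.factorial))) := by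
    intro j
    have hbj := hb0 j
    by_cases hj : ((j : ℝ) - n * p) ^ 2 ≤ n / c
    · have hjn : j ≤ n := by
        by_contra! hlt
        have hlt' : (n : ℝ) < j := by exact_mod_cast hlt
        have h5 : (n : ℝ) / 2 ≤ j - n * p := by nlinarith
        have h6 : ((n : ℝ) / 2) ^ 2 ≤ n / c := le_trans (by gcongr) hj
        rw [div_lt_iff₀ hc] at hn
        rw [le_div_iff₀ hc] at h6
        nlinarith
      have hBj : B j = Real.exp (2 / c) * ((n.choose j : ℝ) * (1 - p) ^ (n - j) * b j) := by
        rw [hB]; exact if_pos (by omega)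
      have h4 := poisson_le_binomial hn1 hjn hp
      have h7 : Real.exp (((j : ℝ) - n * p) ^ 2 / (n * (1 - p))) ≤ Real.exp (2 / c) := by
        rw [Real.exp_le_exp]
        have h8 : (n : ℝ) / 2 ≤ n * (1 - p) := by nlinarith
        calc ((j : ℝ) - n * p) ^ 2 / (n * (1 - p)) ≤ (n / c) / (n / 2) := by gcongr
          _ = 2 / c := by field_simp
      have h9 : 0 ≤ c / n * (((j : ℝ) - n * p) ^ 2 *
        (Real.exp (-(n * p)) * ((n * p) ^ j / j.factorial))) := by positivity
      calc Real.exp (-(n * p)) * ((n : ℝ) ^ j / j.factorial * b j)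
          = Real.exp (-(n * p)) * ((n : ℝ) ^ j / j.factorial) * b j := by ring
        _ ≤ Real.exp (((j : ℝ) - n * p) ^ 2 / (n * (1 - p))) *
            ((n.choose j : ℝ) * (1 - p) ^ (n - j)) * b j := by gcongr
        _ ≤ Real.exp (2 / c) * ((n.choose j : ℝ) * (1 - p) ^ (n - j)) * b j := by gcongr
        _ = B j := by rw [hBj]; ring
        _ ≤ _ := by linarith
    · push Not at hj
      have h5 : 1 ≤ c / n * ((j : ℝ) - n * p) ^ 2 := by
        rw [div_lt_iff₀ hc] at hj
        rw [div_mul_eq_mul_div, le_div_iff₀ hn0]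
        linarith
      have h6 : (n : ℝ) ^ j / j.factorial * b j ≤ (n * p) ^ j / j.factorial := by
        rw [mul_pow, div_mul_eq_mul_div]
        have := hb j
        gcongr
      have h7 : 0 ≤ Real.exp (-(n * p)) * ((n * p) ^ j / j.factorial) := by positivity
      calc Real.exp (-(n * p)) * ((n : ℝ) ^ j / j.factorial * b j)
          ≤ Real.exp (-(n * p)) * ((n * p) ^ j / j.factorial) := by gcongr
        _ ≤ (c / n * ((j : ℝ) - n * p) ^ 2) *
          (Real.exp (-(n * p)) * ((n * p) ^ j / j.factorial)) := le_mul_of_one_le_left h7 h5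
        _ ≤ _ := by rw [mul_assoc]; linarith [hB0 j]
  have hs : Summable fun j : ℕ => Real.exp (-(n * p)) * ((n : ℝ) ^ j / j.factorial * b j) :=
    Summable.of_nonneg_of_le (fun j => by have := hb0 j; positivity) hle h3.summable
  have h4 := (hs.tsum_le_tsum hle h3.summable).trans_eq h3.tsum_eq
  have h5 : ∑ j ∈ Finset.range (n + 1), B j = Real.exp (2 / c) *
      ∑ j ∈ Finset.range (n + 1), (n.choose j : ℝ) * (1 - p) ^ (n - j) * b j := by
    rw [Finset.mul_sum]
    refine Finset.sum_congr rfl fun j hj => ?_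
    rw [hB]
    exact if_pos (Finset.mem_range.1 hj)
  have h6 : c / n * (n * p) ≤ c / 2 := by
    rw [← mul_assoc, div_mul_cancel₀ _ hn0.ne']
    nlinarith
  rw [h5] at h4
  rw [Real.exp_neg, inv_mul_le_iff₀ (Real.exp_pos _)]
  linarith

end Counting

section Depoissonize

variable {X : Type*} [MeasurableSpace X] (μ : Measure X)

lemma pi_smul_eq [IsFiniteMeasure μ] (t : ℝ≥0)
    (k : ℕ) : Measure.pi (fun _ : Fin k => (t : ℝ≥0∞) • μ) =
      ((t : ℝ≥0∞) ^ k) • Measure.pi fun _ : Fin k => μ := by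
  have : IsFiniteMeasure ((t : ℝ≥0∞) • μ) := Measure.smul_finite μ ENNReal.coe_ne_top
  refine Measure.pi_eq fun s hs => ?_
  rw [Measure.smul_apply, Measure.pi_pi]
  simp [Finset.prod_mul_distrib]

lemma cnt_smul [IsFiniteMeasure μ] (t : ℝ≥0) (A : Set (Set X)) (k : ℕ) :
    cnt ((t : ℝ≥0∞) • μ) A k = (t : ℝ≥0∞) ^ k * cnt μ A k := by
  rw [cnt, pi_smul_eq, Measure.smul_apply, smul_eq_mul, cnt]

lemma cnt_subset [IsFiniteMeasure μ] (W : Set X) (k : ℕ) :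
    cnt μ {S | S ⊆ W} k = μ W ^ k := by
  have : {z : Fin k → X | range z ∈ {S | S ⊆ W}} = univ.pi fun _ => W := by
    ext z
    simp [range_subset_iff]
  rw [cnt, this, Measure.pi_pi]
  simp

lemma cnt_mono {A B : Set (Set X)} (h : A ⊆ B) (k : ℕ) : cnt μ A k ≤ cnt μ B k :=
  measure_mono fun _ hz => h hz

variable [IsProbabilityMeasure μ]

lemma cnt_le_one (A : Set (Set X)) (k : ℕ) : cnt μ A k ≤ 1 := prob_le_one

/-- An event depending on a region of measure at most `1/2` which is not too unlikely for the
Poisson process of intensity `n` is not too unlikely for `n` independent points. -/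
theorem exp_mul_le_cnt {W : Set X} (hW : MeasurableSet W) (hμW : μ.real W ≤ 1 / 2)
    {B : Set (Set X)} (hB : Obs B) (hBW : Dep W B) {n : ℕ} {c : ℝ} (hc : 0 < c)
    (hn : 4 / c < n) (h : c ≤ pr (((n : ℝ≥0) : ℝ≥0∞) • μ) B) :
    Real.exp (-(2 / c)) * (c / 2) ≤ (cnt μ B n).toReal := by
  have hfin : IsFiniteMeasure (((n : ℝ≥0) : ℝ≥0∞) • μ) := Measure.smul_finite μ ENNReal.coe_ne_top
  obtain ⟨b, hb⟩ : ∃ b : ℕ → ℝ, b = fun j => (cnt μ (B ∩ {S | S ⊆ W}) j).toReal := ⟨_, rfl⟩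
  have hb0 : ∀ j, 0 ≤ b j := fun j => by rw [hb]; exact ENNReal.toReal_nonneg
  have hb1 : ∀ j, b j ≤ μ.real W ^ j := fun j => by
    rw [hb, Measure.real, ← ENNReal.toReal_pow, ← cnt_subset]
    exact ENNReal.toReal_mono (ne_top_of_le_ne_top ENNReal.one_ne_top (cnt_le_one μ _ _))
      (cnt_mono μ inter_subset_right j)
  have hpr : pr (((n : ℝ≥0) : ℝ≥0∞) • μ) B =
      ∑' j : ℕ, Real.exp (-(n * μ.real W)) * ((n : ℝ) ^ j / j.factorial * b j) := by
    rw [pr_restrict _ hW hB hBW, pr, Measure.real, poisson_apply _ hB, ENNReal.toReal_mul,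
      ENNReal.toReal_ofReal (Real.exp_pos _).le, tsum_mul_left, measureReal_restrict_apply_univ,
      measureReal_ennreal_smul_apply, egf, ENNReal.tsum_toReal_eq]
    · congr 1
      refine tsum_congr fun j => ?_
      rw [cnt_restrict _ B hB, cnt_smul, hb]
      simp [ENNReal.toReal_mul]
      ring
    · intro j
      rw [cnt_restrict _ B hB, cnt_smul]
      have h1 : cnt μ (B ∩ {S | S ⊆ W}) j ≠ ⊤ :=
        ne_top_of_le_ne_top ENNReal.one_ne_top (cnt_le_one μ _ _)
      have h2 : ((j.factorial : ℝ≥0∞)⁻¹) ≠ ⊤ := by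
        simp [Nat.factorial_ne_zero]
      exact ENNReal.mul_ne_top h2 (ENNReal.mul_ne_top (ENNReal.pow_ne_top ENNReal.coe_ne_top) h1)
  have hcnt : (cnt μ B n).toReal =
      ∑ j ∈ Finset.range (n + 1), (n.choose j : ℝ) * (1 - μ.real W) ^ (n - j) * b j := by
    have h1 := cnt_inter_eq_sum μ hW hB obs_univ hBW (dep_univ Wᶜ) n
    rw [inter_univ] at h1
    simp_rw [cnt_split] at h1
    have h2 := Finset.sum_powerset_apply_card (x := (Finset.univ : Finset (Fin n)))
      (fun j => cnt μ (B ∩ {S | S ⊆ W}) j * cnt μ (univ ∩ {S | S ⊆ Wᶜ}) (n - j))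
    rw [Finset.powerset_univ, Finset.card_univ, Fintype.card_fin] at h2
    rw [h1, h2, ENNReal.toReal_sum]
    · refine Finset.sum_congr rfl fun j _ => ?_
      rw [univ_inter, cnt_subset, ENNReal.toReal_nsmul, ENNReal.toReal_mul, ENNReal.toReal_pow, hb,
        ← Measure.real, ← probReal_compl_eq_one_sub hW, nsmul_eq_mul]
      ring
    · intro j _
      rw [nsmul_eq_mul]
      exact ENNReal.mul_ne_top (ENNReal.natCast_ne_top _) (ENNReal.mul_ne_top
        (ne_top_of_le_ne_top ENNReal.one_ne_top (cnt_le_one μ _ _))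
        (ne_top_of_le_ne_top ENNReal.one_ne_top (cnt_le_one μ _ _)))
  rw [hcnt]
  rw [hpr] at h
  exact exp_mul_le_sum_choose measureReal_nonneg hμW hc hn hb0 hb1 h

lemma cnt_eq_zero {A : Set (Set X)} (hA : Obs A) {n : ℕ} (hn : 0 < n)
    (h : pr (((n : ℝ≥0) : ℝ≥0∞) • μ) A = 0) : cnt μ A n = 0 := by
  have hfin : IsFiniteMeasure (((n : ℝ≥0) : ℝ≥0∞) • μ) := Measure.smul_finite μ ENNReal.coe_ne_top
  rw [pr, Measure.real, ENNReal.toReal_eq_zero_iff] at h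
  rcases h with h | h
  · rw [poisson_apply _ hA, mul_eq_zero, egf, ENNReal.tsum_eq_zero] at h
    rcases h with h | h
    · rw [ENNReal.ofReal_eq_zero] at h
      exact absurd (Real.exp_pos _) (not_lt.2 h)
    · have h1 := h n
      rw [cnt_smul] at h1
      simpa [hn.ne'] using h1
  · exact absurd h (measure_ne_top _ _)

lemma cnt_add_cnt_le {A B : Set (Set X)} (hA : Obs A) (hB : Obs B) {n : ℕ} (hn : 0 < n)
    (h : pr (((n : ℝ≥0) : ℝ≥0∞) • μ) (A ∩ B) = 0) :
    (cnt μ A n).toReal + (cnt μ B n).toReal ≤ 1 := by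
  have h0 := cnt_eq_zero μ (hA.inter hB) hn h
  have h1 : cnt μ A n + cnt μ B n = cnt μ (A ∪ B) n := by
    have := measure_union_add_inter (μ := Measure.pi fun _ : Fin n => μ)
      {z : Fin n → X | range z ∈ A} (hB n)
    have h3 : Measure.pi (fun _ : Fin n => μ)
      ({z : Fin n → X | range z ∈ A} ∩ {z | range z ∈ B}) = 0 := h0
    rw [h3, add_zero] at this
    exact this.symm
  have hA1 : cnt μ A n ≠ ⊤ := ne_top_of_le_ne_top ENNReal.one_ne_top (cnt_le_one μ _ _)
  have hB1 : cnt μ B n ≠ ⊤ := ne_top_of_le_ne_top ENNReal.one_ne_top (cnt_le_one μ _ _)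
  rw [← ENNReal.toReal_add hA1 hB1, h1]
  exact ENNReal.toReal_le_of_le_ofReal zero_le_one (by simpa using cnt_le_one μ (A ∪ B) n)

end Depoissonize

section Link

lemma redSet_inter_eq {n : ℕ} {R D : Set (ℝ × ℝ)} {m : ℝ}
    (hm : ∀ p ∈ R, ∀ q ∈ R, sqDist p q ≤ m ^ 2) (hDR : D ⊆ R) (η : Fin n → ℝ × ℝ)
    (hη : ∀ i, η i ∈ R) (col : Fin n → Bool) :
    redSet R η col ∩ D = Reg m (range fun i => (η i, col i)) true ∩ D := by
  ext p
  refine and_congr_left fun hp => ?_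
  constructor
  · intro h
    simp only [redSet, mem_iUnion] at h
    obtain ⟨i, hi, hpi⟩ := h
    refine ⟨η i, ⟨i, Prod.ext rfl hi⟩, hm _ (hDR hp) _ (hη i), ?_⟩
    rintro y ⟨j, hj⟩
    have := hpi.2 j
    have hjy : η j = y := (Prod.ext_iff.1 hj).1
    rwa [← hjy]
  · rintro ⟨x, ⟨i, hi⟩, -, hx⟩
    obtain ⟨hi1, hi2⟩ := Prod.ext_iff.1 hi
    simp only at hi1 hi2
    obtain ⟨i', hi', hmin⟩ := Finset.exists_min_image (Finset.univ.filter fun i => col i = true)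
      (fun i => sqDist p (η i)) ⟨i, by simpa using hi2⟩
    simp only [redSet, mem_iUnion]
    refine ⟨i', by simpa using hi', hDR hp, fun j => ?_⟩
    cases hj : col j
    · refine (hmin i (by simpa using hi2)).trans ?_
      rw [hi1]
      exact hx _ ⟨j, Prod.ext rfl (by simpa using hj)⟩
    · exact hmin j (by simpa using hj)

lemma crossing_iff {n : ℕ} {R : Set (ℝ × ℝ)} {m a b c d : ℝ}
    (hm : ∀ p ∈ R, ∀ q ∈ R, sqDist p q ≤ m ^ 2) (hDR : rect a b c d ⊆ R) (η : Fin n → ℝ × ℝ)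
    (hη : ∀ i, η i ∈ R) (col : Fin n → Bool) :
    Crossing R a b c d η col ↔ (range fun i => (η i, col i)) ∈
      Ev m true (rect a b c d) (rect a a c d) (rect b b c d) := by
  rw [mem_Ev, Conn, Crossing, redSet_inter_eq hm hDR η hη col]
  constructor
  · rintro ⟨γ, hγ, h, h0, h1⟩
    have m0 := mem_rect.1 (h 0 (by simp)).2
    have m1 := mem_rect.1 (h 1 (by simp)).2
    refine ⟨γ 0, mem_rect.2 ⟨⟨h0.ge, h0.le⟩, m0.2⟩, γ 1, mem_rect.2 ⟨⟨h1.ge, h1.le⟩, m1.2⟩,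
      JoinedIn.ofLine hγ rfl rfl ?_⟩
    rintro _ ⟨t, ht, rfl⟩
    exact h t ht
  · rintro ⟨x, hx, y, hy, γ, hγ⟩
    refine ⟨γ.extend, γ.continuous_extend.continuousOn, fun t ht => ?_, ?_, ?_⟩
    · rw [γ.extend_apply ht]
      exact hγ _
    · rw [γ.extend_zero]
      exact le_antisymm (mem_rect.1 hx).1.2 (mem_rect.1 hx).1.1
    · rw [γ.extend_one]
      exact le_antisymm (mem_rect.1 hy).1.2 (mem_rect.1 hy).1.1

lemma card_eq_pi_count {n : ℕ} (A : Set (Fin n → Bool)) :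
    (Measure.pi fun _ : Fin n => (Measure.count : Measure Bool)) A =
      ((Finset.univ.filter fun c => c ∈ A).card : ℝ≥0∞) := by
  rw [← lintegral_indicator_one (Set.toFinite A).measurableSet, lintegral_fintype,
    Finset.card_filter]
  push_cast
  refine Finset.sum_congr rfl fun c _ => ?_
  have h : (Measure.pi fun _ : Fin n => (Measure.count : Measure Bool)) {c} = 1 := by
    rw [← univ_pi_singleton, Measure.pi_pi]
    simp
  rw [h, mul_one, indicator_apply]
  simp

theorem annealed_eq_cnt (R : Dom) (hR : volume R.s = 1) {m a b c d : ℝ}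
    (hm : ∀ p ∈ R.s, ∀ q ∈ R.s, sqDist p q ≤ m ^ 2) (hDR : rect a b c d ⊆ R.s) (n : ℕ) :
    annealed R.s a b c d n = (cnt (Lam (1 / 2) R)
      (Ev m true (rect a b c d) (rect a a c d) (rect b b c d)) n).toReal := by
  obtain ⟨A, hA⟩ : ∃ A, A = Ev m true (rect a b c d) (rect a a c d) (rect b b c d) := ⟨_, rfl⟩
  have hAo : Obs A := by
    rw [hA]
    exact obs_Ev m true (isCompact_rect a b c d) (convex_rect a b c d) (isClosed_rect a a c d)
      (isClosed_rect b b c d)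
  rw [← hA]
  have hprob : IsProbabilityMeasure (volume.restrict R.s) :=
    ⟨by rw [Measure.restrict_apply_univ, hR]⟩
  have hpts : pts R.s n = Measure.pi fun _ : Fin n => volume.restrict R.s := by
    rw [pts, unif, hR, inv_one, one_smul]
  obtain ⟨E, hE⟩ : ∃ E : Set ((Fin n → ℝ × ℝ) × (Fin n → Bool)),
      E = {w | (range fun i => (w.1 i, w.2 i)) ∈ A} := ⟨_, rfl⟩
  have hEm : MeasurableSet E := by
    have h1 : Measurable fun w : (Fin n → ℝ × ℝ) × (Fin n → Bool) =>
        (fun i => (w.1 i, w.2 i) : Fin n → CPt) :=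
      (MeasurableEquiv.arrowProdEquivProdArrow (ℝ × ℝ) Bool (Fin n)).symm.measurable
    rw [hE]
    exact h1 (hAo n)
  obtain ⟨G, hG⟩ : ∃ G : (Fin n → ℝ × ℝ) → ℝ≥0∞, G = fun η =>
      (Measure.pi fun _ : Fin n => (Measure.count : Measure Bool)) (Prod.mk η ⁻¹' E) := ⟨_, rfl⟩
  have hGm : Measurable G := by rw [hG]; exact measurable_measure_prodMk_left hEm
  have hGc : ∀ η, G η = ((Finset.univ.filter fun col => (η, col) ∈ E).card : ℝ≥0∞) := fun η => by
    rw [hG]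
    exact card_eq_pi_count _
  have h1 : cnt (Lam (1 / 2) R) A n = ((1 / 2 : ℝ≥0) : ℝ≥0∞) ^ n * ∫⁻ η, G η ∂(pts R.s n) := by
    have hpres := measurePreserving_arrowProdEquivProdArrow (ℝ × ℝ) Bool (Fin n)
      (fun _ => ((1 / 2 : ℝ≥0) : ℝ≥0∞) • volume.restrict R.s) (fun _ => Measure.count)
    have hpre : {z : Fin n → CPt | range z ∈ A} =
        (MeasurableEquiv.arrowProdEquivProdArrow (ℝ × ℝ) Bool (Fin n)) ⁻¹' E := by
      rw [hE]
      rfl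
    rw [cnt, hpre]
    unfold Lam
    rw [hpres.measure_preimage hEm.nullMeasurableSet, Measure.prod_apply hEm, pi_smul_eq,
      lintegral_smul_measure, smul_eq_mul, hpts, hG]
  have h2 : condProb R.s a b c d =ᵐ[pts R.s n] fun η => (G η).toReal / 2 ^ n := by
    have h3 : ∀ᵐ η ∂(pts R.s n), ∀ i, η i ∈ R.s := by
      rw [hpts, ae_all_iff]
      intro i
      exact (Measure.quasiMeasurePreserving_eval _ i).ae (ae_restrict_mem R.meas)
    filter_upwards [h3] with η hη
    rw [condProb, hGc, ENNReal.toReal_natCast]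
    congr 3
    refine Finset.filter_congr fun col _ => ?_
    rw [crossing_iff hm hDR η hη col, hE, ← hA]
    rfl
  rw [annealed, integral_congr_ae h2, integral_div, integral_toReal hGm.aemeasurable, h1,
    ENNReal.toReal_mul, ENNReal.toReal_pow]
  · simp
    ring
  · refine Filter.Eventually.of_forall fun η => ?_
    rw [hGc]
    exact ENNReal.natCast_lt_top _

end Link

section Strip

variable {lam : ℝ≥0} {r u y A E q c : ℝ}

lemma Box.left (h : Box lam r q) (hr : 0 < r) (hu : 5 * r ≤ 2 * u)
    (hA : A ≤ y - 3 / 2 * r) (hE : y + 3 / 2 * r ≤ E) :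
    q ≤ pr (Lam lam (rectDom (-u) u A E)) (Ev (r / 4) true (rect (-u) (-u + 2 * r) (y - r) (y + r))
      (rect (-u) (-u) (y - r) (y + r)) (rect (-u + 2 * r) (-u + 2 * r) (y - r) (y + r))) := by
  have h1 : BR {p : ℝ × ℝ | -u ≤ p.1} lam (r / 4) (-u) (-u + 2 * r) (y - r) (y + r)
      (-u) (-u) (y - r) (y + r) (-u + 2 * r) (-u + 2 * r) (y - r) (y + r) q :=
    (h.trans (H' := {p : ℝ × ℝ | -u ≤ p.1}) (by positivity) (-u) y
      (by ext p; simp [HP])).mono (by positivity)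
  refine h1.le _ ?_
  ext p
  have e : p ∈ (rectDom (-u) u A E).s ↔ (-u ≤ p.1 ∧ p.1 ≤ u) ∧ A ≤ p.2 ∧ p.2 ≤ E := mem_rect
  rw [mem_inter_iff, mem_inter_iff, e, mem_rect]
  refine and_congr_left fun hp => ⟨fun h => h.1.1, fun h => ⟨⟨h, ?_⟩, ?_, ?_⟩⟩ <;> linarith

lemma Box.right (h : Box lam r q) (hr : 0 < r) (hu : 5 * r ≤ 2 * u)
    (hA : A ≤ y - 3 / 2 * r) (hE : y + 3 / 2 * r ≤ E) :
    q ≤ pr (Lam lam (rectDom (-u) u A E)) (Ev (r / 4) true (rect (u - 2 * r) u (y - r) (y + r))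
      (rect u u (y - r) (y + r)) (rect (u - 2 * r) (u - 2 * r) (y - r) (y + r))) := by
  have h0 := h.refX (H' := {p : ℝ × ℝ | p.1 ≤ 0}) (by positivity) (by ext p; simp [HP])
  have h1 : BR {p : ℝ × ℝ | p.1 ≤ u} lam (r / 4) (u - 2 * r) u (y - r) (y + r)
      u u (y - r) (y + r) (u - 2 * r) (u - 2 * r) (y - r) (y + r) q :=
    (h0.trans (H' := {p : ℝ × ℝ | p.1 ≤ u}) (by positivity) u y
      (by ext p; simp)).mono (by positivity)
  refine h1.le _ ?_
  ext p
  have e : p ∈ (rectDom (-u) u A E).s ↔ (-u ≤ p.1 ∧ p.1 ≤ u) ∧ A ≤ p.2 ∧ p.2 ≤ E := mem_rect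
  rw [mem_inter_iff, mem_inter_iff, e, mem_rect]
  refine and_congr_left fun hp => ⟨fun h => h.1.2, fun h => ⟨⟨?_, h⟩, ?_, ?_⟩⟩ <;> linarith

lemma strip_meet {a b c d a' b' : ℝ} {K L : Set (ℝ × ℝ)} (hK : IsPathConnected K)
    (hL : IsPathConnected L) (hKD : K ⊆ rect a b c d) (hLD : L ⊆ rect a' b' c d)
    (k1 : ∃ z ∈ K, z.1 = a) (k2 : ∃ z ∈ K, z.1 = b) (l1 : ∃ z ∈ L, z.2 = c)
    (l2 : ∃ z ∈ L, z.2 = d) (ha : a ≤ a') (hb : b' ≤ b) : (K ∩ L).Nonempty :=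
  meet_rect hK hL hKD (hLD.trans (rect_subset ha hb le_rfl le_rfl)) k1 k2 l1 l2

/-- Crossings of a strip between two opposite sides of a rectangular domain. -/
theorem pr_strip_ge (hB : Box lam r q) (hq : 0 ≤ q) (h1 : RSW lam r c) (h2 : RSW lam (2 * r) c)
    (hc : 0 < c) (hr : 0 < r) (hC : C₀ ≤ lam * r ^ 2) {k : ℕ} (hk : 2 * u ≤ 2 ^ k * (2 * r))
    (hu : 5 * r ≤ 2 * u) (hA : A ≤ y - 3 / 2 * r) (hE : y + 3 / 2 * r ≤ E) :
    dbl^[k] c * (q * dbl^[1] c) * (q * dbl^[1] c) ≤ pr (Lam lam (rectDom (-u) u A E))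
      (Ev (r / 2) true (rect (-u) u (y - r) (y + r)) (rect (-u) (-u) (y - r) (y + r))
        (rect u u (y - r) (y + r))) := by
  have hd1 : 0 ≤ dbl^[1] c := (dbl_iter_pos hc 1).le
  have hr2 : 0 ≤ r / 2 := by positivity
  have hr4 : 0 ≤ r / 4 := by positivity
  have hC2 : C₀ ≤ lam * (2 * r) ^ 2 := by
    have : (0 : ℝ) ≤ lam * r ^ 2 := by positivity
    linarith
  have b1 : LR lam (r / 2) (-u + r) (u - r) (y - r) (y + r) (dbl^[k] c) :=
    ((h2.long (by positivity) hC2 hc (k := k) (L := 2 * u - 2 * r) (by linarith)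
      (by linarith)).trans (H' := univ) (by positivity) (-u + r) (y - r)).mono (by positivity)
  have b0 : TB lam (r / 4) 0 r 0 (2 * r) (dbl^[1] c) :=
    (h1.long hr hC hc (k := 1) (L := 2 * r) (by positivity) (by linarith)).swap (H' := univ) hr4
  have b2 : TB lam (r / 4) (-u + r) (-u + 2 * r) (y - r) (y + r) (dbl^[1] c) :=
    (b0.trans (H' := univ) hr4 (-u + r) (y - r)).mono hr4
  have b3 : TB lam (r / 4) (u - 2 * r) (u - r) (y - r) (y + r) (dbl^[1] c) :=
    (b0.trans (H' := univ) hr4 (u - 2 * r) (y - r)).mono hr4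
  have p1 := b1.le_pr (A := -u) (B := u) (C := A) (E := E)
  have p2 := b2.le_pr (A := -u) (B := u) (C := A) (E := E)
  have p3 := b3.le_pr (A := -u) (B := u) (C := A) (E := E)
  have p4 := hB.left hr hu hA hE
  have p5 := hB.right hr hu hA hE
  have r2 := (redEv_rect _ _ _ _ _ _ _ _ _ _ _ _ _).le_inter _
    (redEv_rect _ _ _ _ _ _ _ _ _ _ _ _ _) p4 p2 hd1
  have r3 := (redEv_rect _ _ _ _ _ _ _ _ _ _ _ _ _).le_inter _
    (redEv_rect _ _ _ _ _ _ _ _ _ _ _ _ _) p5 p3 hd1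
  have t2 := (redEv_rect _ _ _ _ _ _ _ _ _ _ _ _ _).le_inter _
    ((redEv_rect _ _ _ _ _ _ _ _ _ _ _ _ _).inter (redEv_rect _ _ _ _ _ _ _ _ _ _ _ _ _))
    p1 r2 (by positivity)
  have t3 := ((redEv_rect _ _ _ _ _ _ _ _ _ _ _ _ _).inter
    ((redEv_rect _ _ _ _ _ _ _ _ _ _ _ _ _).inter
      (redEv_rect _ _ _ _ _ _ _ _ _ _ _ _ _))).le_inter _
    ((redEv_rect _ _ _ _ _ _ _ _ _ _ _ _ _).inter (redEv_rect _ _ _ _ _ _ _ _ _ _ _ _ _))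
    t2 r3 (by positivity)
  refine t3.trans (pr_mono _ ?_)
  rintro S ⟨⟨g1, g4, g2⟩, g5, g3⟩
  obtain ⟨K, hK, hKr, hKD, K1, K2⟩ := Conn.exists_LR g1 hr2 le_rfl
  obtain ⟨L, hL, hLr, hLD, L1, L2⟩ := Conn.exists_LR g4 hr4 (by linarith : r / 4 ≤ r / 2)
  obtain ⟨M, hM, hMr, hMD, M1, M2⟩ := Conn.exists_TB g2 hr4 (by linarith : r / 4 ≤ r / 2)
  obtain ⟨L', hL', hLr', hLD', L1', L2'⟩ :=
    Conn.exists_LR (Conn.symm g5) hr4 (by linarith : r / 4 ≤ r / 2)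
  obtain ⟨M', hM', hMr', hMD', M1', M2'⟩ := Conn.exists_TB g3 hr4 (by linarith : r / 4 ≤ r / 2)
  have f1 : (L ∩ M).Nonempty := strip_meet hL hM hLD hMD L1 L2 M1 M2 (by linarith) (by linarith)
  have f2 : (K ∩ M).Nonempty := strip_meet hK hM hKD hMD K1 K2 M1 M2 (by linarith) (by linarith)
  have f3 : (K ∩ M').Nonempty :=
    strip_meet hK hM' hKD hMD' K1 K2 M1' M2' (by linarith) (by linarith)
  have f4 : (L' ∩ M').Nonempty :=
    strip_meet hL' hM' hLD' hMD' L1' L2' M1' M2' (by linarith) (by linarith)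
  have g := ((hL.union hM f1).union hK ((inter_comm K M ▸ f2).mono
    (inter_subset_inter_left _ subset_union_right))).union (hL'.union hM' f4)
    (f3.mono (inter_subset_inter subset_union_right subset_union_right))
  obtain ⟨z, hz, hz1⟩ := L1
  obtain ⟨z', hz', hz1'⟩ := L2'
  refine Conn.of_set g (union_subset (union_subset (union_subset hLr hMr) hKr)
    (union_subset hLr' hMr')) (union_subset (union_subset (union_subset ?_ ?_) ?_)
    (union_subset ?_ ?_)) ⟨z, Or.inl (Or.inl (Or.inl hz)), ?_⟩ ⟨z', Or.inr (Or.inl hz'), ?_⟩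
  · exact hLD.trans (rect_subset (by linarith) (by linarith) le_rfl le_rfl)
  · exact hMD.trans (rect_subset (by linarith) (by linarith) le_rfl le_rfl)
  · exact hKD.trans (rect_subset (by linarith) (by linarith) le_rfl le_rfl)
  · exact hLD'.trans (rect_subset (by linarith) (by linarith) le_rfl le_rfl)
  · exact hMD'.trans (rect_subset (by linarith) (by linarith) le_rfl le_rfl)
  · exact mem_rect.2 ⟨⟨hz1.ge, hz1.le⟩, (mem_rect.1 (hLD hz)).2⟩
  · exact mem_rect.2 ⟨⟨hz1'.ge, hz1'.le⟩, (mem_rect.1 (hLD' hz')).2⟩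

end Strip

section Main

lemma pr_swap_le (lam : ℝ≥0) {m a b c d x₁ x₂ x₃ x₄ y₁ y₂ y₃ y₄ A B C E : ℝ} (hm : 0 ≤ m) :
    pr (Lam lam (rectDom A B C E))
        (Ev m true (rect a b c d) (rect x₁ x₂ x₃ x₄) (rect y₁ y₂ y₃ y₄)) ≤
      pr (Lam lam (rectDom C E A B))
        (Ev m true (rect c d a b) (rect x₃ x₄ x₁ x₂) (rect y₃ y₄ y₁ y₂)) := by
  have h : BR (rect A B C E) lam m a b c d x₁ x₂ x₃ x₄ y₁ y₂ y₃ y₄ _ :=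
    Bd.of_dom (measurableSet_rect _ _ _ _) (redEv_rect _ _ _ _ _ _ _ _ _ _ _ _ _)
      (dep_rect m true hm le_rfl le_rfl le_rfl le_rfl) (R := rectDom A B C E) rfl le_rfl
  exact (h.swap (H' := rect C E A B) hm (by ext p; simp only [mem_preimage, mem_rect]; tauto)).le
    (rectDom C E A B) rfl

lemma count_univ_bool : Measure.count (univ : Set Bool) = 2 := by
  rw [Measure.count_univ]
  simp

lemma Lam_real_univ_le (lam : ℝ≥0) (R : Dom) {W : Set (ℝ × ℝ)} (hW : volume W ≠ ∞) :
    (Lam lam R).real (W ×ˢ univ) ≤ 2 * lam * volume.real W := by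
  rw [measureReal_def, Lam, Measure.prod_prod, Measure.smul_apply, smul_eq_mul, count_univ_bool,
    ENNReal.toReal_mul, ENNReal.toReal_mul, ENNReal.coe_toReal, ENNReal.toReal_ofNat]
  have h : (volume.restrict R.s W).toReal ≤ volume.real W :=
    ENNReal.toReal_mono hW (Measure.restrict_apply_le _ _)
  linarith [mul_le_mul_of_nonneg_left h lam.coe_nonneg]

lemma Lam_natCast (n : ℕ) (R : Dom) :
    Lam ((n : ℝ≥0) / 2) R = ((n : ℝ≥0) : ℝ≥0∞) • Lam (1 / 2) R := by
  rw [Lam, Lam, ← Measure.prod_smul_left, smul_smul, ← ENNReal.coe_mul]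
  congr 4
  ring

lemma volume_rectDom {u v : ℝ} (hu : 0 ≤ u) (hv : 0 ≤ v) (huv : 2 * u * (2 * v) = 1) :
    volume (rectDom (-u) u (-v) v).s = 1 := by
  have h : volume.real (rect (-u) u (-v) v) = 1 := by
    rw [volume_rect (by linarith) (by linarith)]
    linarith
  exact (ENNReal.toReal_eq_one_iff _).1 h

lemma isProbabilityMeasure_Lam {R : Dom} (hR : volume R.s = 1) :
    IsProbabilityMeasure (Lam (1 / 2) R) := by
  have h : (Lam (1 / 2) R).real univ = 1 := by
    rw [measureReal_def, Lam, ← univ_prod_univ, Measure.prod_prod, Measure.smul_apply,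
      Measure.restrict_apply_univ, hR, count_univ_bool]
    simp
  exact ⟨(ENNReal.toReal_eq_one_iff _).1 h⟩

lemma sqDist_le_of_mem {u v m : ℝ} (hu : 0 ≤ u) (hv : 0 ≤ v) (hm : 2 * u + 2 * v ≤ m) :
    ∀ p ∈ rect (-u) u (-v) v, ∀ q ∈ rect (-u) u (-v) v, sqDist p q ≤ m ^ 2 := by
  intro p hp q hq
  obtain ⟨⟨p1, p2⟩, p3, p4⟩ := mem_rect.1 hp
  obtain ⟨⟨q1, q2⟩, q3, q4⟩ := mem_rect.1 hq
  have h1 : (p.1 - q.1) ^ 2 ≤ (2 * u) ^ 2 := sq_le_sq' (by linarith) (by linarith)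
  have h2 : (p.2 - q.2) ^ 2 ≤ (2 * v) ^ 2 := sq_le_sq' (by linarith) (by linarith)
  have h3 : (2 * u + 2 * v) ^ 2 ≤ m ^ 2 := pow_le_pow_left₀ (by linarith) hm 2
  have h4 := mul_nonneg hu hv
  rw [sqDist]
  linarith [add_sq (2 * u) (2 * v)]

lemma horizontal_strip_subset {u a b c d y r m : ℝ} (hr : 0 ≤ r) (hm : r / 2 ≤ m) (hab : a ≤ b)
    (ha : -u ≤ a) (hb : b ≤ u) (hc : c ≤ y - r) (hd : y + r ≤ d) :
    Ev (r / 2) true (rect (-u) u (y - r) (y + r)) (rect (-u) (-u) (y - r) (y + r))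
        (rect u u (y - r) (y + r)) ⊆
      Ev m true (rect a b c d) (rect a a c d) (rect b b c d) := by
  intro S hS
  obtain ⟨K, hK, hKr, hKD, ⟨p, hp, hp'⟩, q, hq, hq'⟩ :=
    Conn.exists_set (mem_Ev.1 hS) (by positivity) hm
  obtain ⟨L, hLK, hL, hLf, ⟨x, hx, hx'⟩, z, hz, hz'⟩ := exists_strip hK continuous_fst hab hp hq
    ((mem_rect.1 hp').1.2.trans ha) (hb.trans (mem_rect.1 hq').1.1)
  have key : ∀ w ∈ L, c ≤ w.2 ∧ w.2 ≤ d := fun w hw =>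
    ⟨hc.trans (mem_rect.1 (hKD (hLK hw))).2.1, (mem_rect.1 (hKD (hLK hw))).2.2.trans hd⟩
  exact Conn.of_set hL (hLK.trans hKr) (fun w hw => mem_rect.2 ⟨hLf w hw, key w hw⟩)
    ⟨x, hx, mem_rect.2 ⟨⟨hx'.ge, hx'.le⟩, key x hx⟩⟩
    ⟨z, hz, mem_rect.2 ⟨⟨hz'.ge, hz'.le⟩, key z hz⟩⟩

lemma cross_vertical_strip {a b c d x v r : ℝ} (ha : a ≤ x - r) (hb : x + r ≤ b) (hc : -v ≤ c)
    (hd : d ≤ v) : ∀ p ∈ rect a a c d, ∀ q ∈ rect b b c d,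
      ∀ p' ∈ rect (x - r) (x + r) (-v) (-v), ∀ q' ∈ rect (x - r) (x + r) v v,
      ∀ F ⊆ rect a b c d, ∀ G ⊆ rect (x - r) (x + r) (-v) v, JoinedIn F p q → JoinedIn G p' q' →
      (F ∩ G).Nonempty := by
  intro p hp q hq p' hp' q' hq' F hF G hG hFj hGj
  have e1 := (mem_rect.1 hp).1
  have e2 := (mem_rect.1 hq).1
  have e3 := (mem_rect.1 hp').2
  have e4 := (mem_rect.1 hq').2
  refine joinedIn_cross hFj hGj (fun z hz => ?_) fun z hz => ?_
  · have := (mem_rect.1 (hG hz)).1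
    exact ⟨by linarith [this.1, e1.2], by linarith [this.2, e2.1]⟩
  · have := (mem_rect.1 (hF hz)).2
    exact ⟨by linarith [this.1, e3.2], by linarith [this.2, e4.1]⟩

/-- Bounds for strips in the Poisson model give bounds for crossings in the binomial model. -/
theorem annealed_bounds {u v a b c d r κ : ℝ} {n : ℕ} (hu : 0 ≤ u) (hv : 0 ≤ v)
    (huv : 2 * u * (2 * v) = 1) (hr : 0 < r) (ha : -u ≤ a) (hb : b ≤ u) (hc : -v ≤ c) (hd : d ≤ v)
    (hab : 4 * r ≤ b - a) (hcd : 4 * r ≤ d - c) (hur : (2 * u + r) * (3 * r) ≤ 1 / 2)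
    (hvr : (2 * v + r) * (3 * r) ≤ 1 / 2) (hκ : 0 < κ) (hn : 0 < n) (hnκ : 4 / κ < n)
    (h1 : ∀ y, -v ≤ y - 3 / 2 * r → y + 3 / 2 * r ≤ v →
      κ ≤ pr (Lam ((n : ℝ≥0) / 2) (rectDom (-u) u (-v) v))
        (Ev (r / 2) true (rect (-u) u (y - r) (y + r)) (rect (-u) (-u) (y - r) (y + r))
          (rect u u (y - r) (y + r))))
    (h2 : ∀ x, -u ≤ x - 3 / 2 * r → x + 3 / 2 * r ≤ u →
      κ ≤ pr (Lam ((n : ℝ≥0) / 2) (rectDom (-v) v (-u) u))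
        (Ev (r / 2) true (rect (-v) v (x - r) (x + r)) (rect (-v) (-v) (x - r) (x + r))
          (rect v v (x - r) (x + r)))) :
    Real.exp (-(2 / κ)) * (κ / 2) ≤ annealed (rect (-u) u (-v) v) a b c d n ∧
      annealed (rect (-u) u (-v) v) a b c d n ≤ 1 - Real.exp (-(2 / κ)) * (κ / 2) := by
  obtain ⟨D, hD⟩ : ∃ D, D = rectDom (-u) u (-v) v := ⟨_, rfl⟩
  obtain ⟨x, hx⟩ : ∃ x, x = (a + b) / 2 := ⟨_, rfl⟩
  obtain ⟨y, hy⟩ : ∃ y, y = (c + d) / 2 := ⟨_, rfl⟩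
  have hr2 : 0 ≤ r / 2 := by positivity
  have hDs : D.s = rect (-u) u (-v) v := by rw [hD]; rfl
  have hvol : volume D.s = 1 := by rw [hD]; exact volume_rectDom hu hv huv
  have hprob := isProbabilityMeasure_Lam hvol
  have hsub : rect a b c d ⊆ D.s := by rw [hDs]; exact rect_subset ha hb hc hd
  have hdist := sqDist_le_of_mem hu hv (m := 2 * u + 2 * v + r) (by linarith)
  rw [← hDs] at hdist
  rw [← hDs, annealed_eq_cnt D hvol hdist hsub n]
  have small : ∀ {x₁ x₂ y₁ y₂ : ℝ}, x₁ ≤ x₂ → y₁ ≤ y₂ → (x₂ - x₁) * (y₂ - y₁) ≤ 1 / 2 →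
      (Lam (1 / 2) D).real (rect x₁ x₂ y₁ y₂ ×ˢ univ) ≤ 1 / 2 := by
    intro x₁ x₂ y₁ y₂ e1 e2 e3
    refine (Lam_real_univ_le _ _ (isCompact_rect _ _ _ _).measure_lt_top.ne).trans ?_
    rw [volume_rect e1 e2]
    simpa using e3
  have obs : ∀ (m : ℝ) (col : Bool) (a b c d x₁ x₂ x₃ x₄ y₁ y₂ y₃ y₄ : ℝ),
      Obs (Ev m col (rect a b c d) (rect x₁ x₂ x₃ x₄) (rect y₁ y₂ y₃ y₄)) := by
    intros
    exact obs_Ev _ _ (isCompact_rect _ _ _ _) (convex_rect _ _ _ _) (isClosed_rect _ _ _ _)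
      (isClosed_rect _ _ _ _)
  have p1 := h1 y (by linarith) (by linarith)
  have p2 := (h2 x (by linarith) (by linarith)).trans (pr_swap_le _ hr2)
  rw [← hD, Lam_natCast] at p1
  rw [← hD, ← pr_false_eq _ _ _ (isCompact_rect _ _ _ _) (convex_rect _ _ _ _)
    (isClosed_rect _ _ _ _) (isClosed_rect _ _ _ _), Lam_natCast] at p2
  have q1 := exp_mul_le_cnt (Lam (1 / 2) D)
    (W := rect (-u - r / 2) (u + r / 2) (y - 3 / 2 * r) (y + 3 / 2 * r) ×ˢ univ)
    ((measurableSet_rect _ _ _ _).prod MeasurableSet.univ)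
    (small (by linarith) (by linarith) (by linarith)) (obs _ _ _ _ _ _ _ _ _ _ _ _ _ _)
    (dep_rect _ _ hr2 le_rfl le_rfl (by linarith) (by linarith)) hκ hnκ p1
  have q2 := exp_mul_le_cnt (Lam (1 / 2) D)
    (W := rect (x - 3 / 2 * r) (x + 3 / 2 * r) (-v - r / 2) (v + r / 2) ×ˢ univ)
    ((measurableSet_rect _ _ _ _).prod MeasurableSet.univ)
    (small (by linarith) (by linarith) (by linarith)) (obs _ _ _ _ _ _ _ _ _ _ _ _ _ _)
    (dep_rect _ _ hr2 (by linarith) (by linarith) le_rfl le_rfl) hκ hnκ p2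
  refine ⟨q1.trans (ENNReal.toReal_mono ((cnt_le_one _ _ _).trans_lt ENNReal.one_lt_top).ne
    (cnt_mono _ (horizontal_strip_subset hr.le (by linarith) (by linarith) ha hb (by linarith)
      (by linarith)) n)), ?_⟩
  have hex := pr_exclusive ((n : ℝ≥0) / 2) D (m := 2 * u + 2 * v + r) (m' := r / 2)
    (isCompact_rect a b c d) (convex_rect a b c d) (isClosed_rect a a c d) (convex_rect a a c d)
    (isClosed_rect b b c d) (convex_rect b b c d) (isCompact_rect _ _ _ _) (convex_rect _ _ _ _)
    (isClosed_rect _ _ _ _) (isClosed_rect _ _ _ _)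
    (cross_vertical_strip (x := x) (r := r) (by linarith) (by linarith) hc hd)
  rw [Lam_natCast] at hex
  have hle := cnt_add_cnt_le (Lam (1 / 2) D) (obs _ _ _ _ _ _ _ _ _ _ _ _ _ _)
    (obs _ _ _ _ _ _ _ _ _ _ _ _ _ _) hn hex
  linarith

/-- Half the side lengths of a rectangle of unit area and bounded aspect ratio. -/
lemma sides_bounds {θ ρ : ℝ} (hθ : 0 < θ) (hθ1 : θ < 1) (hρ : ρ ∈ Ioo θ (1 / θ)) :
    θ ≤ √ρ ∧ √ρ ≤ 1 / θ := by
  have h1 : 1 < 1 / θ := by rw [lt_div_iff₀ hθ]; linarith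
  refine ⟨Real.le_sqrt_of_sq_le ?_, Real.sqrt_le_iff.2 ⟨by positivity, ?_⟩⟩
  · nlinarith [hρ.1]
  · nlinarith [hρ.2]

/-- For every `θ > 0` there exist `c'' > 0` and `K ≥ 1` such that for all
`ρ ∈ (θ, 1/θ)`, all `n ≥ K` and every axis-parallel rectangle `R' ⊆ R(ρ)` of area at least `θ`,
the annealed crossing probability satisfies `c'' < P_{R(ρ)}(H_{R'}) < 1 - c''`. -/
theorem annealed_crossing_bounds (θ : ℝ) (hθ : 0 < θ) :
    ∃ c'' : ℝ, 0 < c'' ∧ ∃ K : ℕ, 1 ≤ K ∧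
      ∀ ρ : ℝ, ρ ∈ Ioo θ (1/θ) → ∀ n : ℕ, K ≤ n →
        ∀ a b c d : ℝ, a ≤ b → c ≤ d → rect a b c d ⊆ Rrect ρ 1 → θ ≤ (b - a) * (d - c) →
          c'' < annealed (Rrect ρ 1) a b c d n ∧
            annealed (Rrect ρ 1) a b c d n < 1 - c'' := by
  rcases le_or_gt 1 θ with hθ1 | hθ1
  · refine ⟨1, one_pos, 1, le_rfl, fun ρ hρ => absurd (hρ.1.trans hρ.2) ?_⟩
    rw [not_lt, div_le_iff₀ hθ]
    nlinarith
  obtain ⟨c₁, hc₁, hrsw⟩ := exists_rsw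
  obtain ⟨C, q, hq, hbox⟩ := exists_box
  obtain ⟨r, hrθ⟩ : ∃ r, r = θ ^ 2 / 16 := ⟨_, rfl⟩
  have hr : 0 < r := by rw [hrθ]; positivity
  have hrle : r ≤ θ / 16 := by rw [hrθ]; nlinarith
  obtain ⟨k, hk⟩ := pow_unbounded_of_one_lt (1 / θ / (2 * r)) (one_lt_two (α := ℝ))
  rw [div_lt_iff₀ (by positivity)] at hk
  obtain ⟨κ, hκe⟩ : ∃ κ, κ = dbl^[k] c₁ * (q * dbl^[1] c₁) * (q * dbl^[1] c₁) := ⟨_, rfl⟩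
  have hκ : 0 < κ := by
    have h1 := dbl_iter_pos hc₁ k
    have h2 := dbl_iter_pos hc₁ 1
    rw [hκe]
    positivity
  obtain ⟨K₁, hK₁⟩ := exists_nat_gt (4 / κ)
  obtain ⟨K₂, hK₂⟩ := exists_nat_gt (2 * max C₀ C / r ^ 2)
  have hpos : 0 < Real.exp (-(2 / κ)) * (κ / 2) := by positivity
  refine ⟨Real.exp (-(2 / κ)) * (κ / 2) / 2, by positivity, max 1 (max K₁ K₂), le_max_left _ _, ?_⟩
  intro ρ hρ n hn a b c d hab hcd hsub harea
  have hn1 : 0 < n := (le_max_left _ _).trans hn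
  have hnκ : 4 / κ < n := hK₁.trans_le
    (by exact_mod_cast (le_max_left _ _).trans ((le_max_right _ _).trans hn))
  have hnC : 2 * max C₀ C / r ^ 2 < n := hK₂.trans_le
    (by exact_mod_cast (le_max_right _ _).trans ((le_max_right _ _).trans hn))
  rw [div_lt_iff₀ (by positivity)] at hnC
  have hlam : (((n : ℝ≥0) / 2 : ℝ≥0) : ℝ) * r ^ 2 = n * r ^ 2 / 2 := by
    push_cast
    ring
  have hCn : C₀ ≤ ((n : ℝ≥0) / 2 : ℝ≥0) * r ^ 2 := by linarith [le_max_left C₀ C]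
  have hCn' : C ≤ ((n : ℝ≥0) / 2 : ℝ≥0) * r ^ 2 := by linarith [le_max_right C₀ C]
  have hCn2 : C₀ ≤ ((n : ℝ≥0) / 2 : ℝ≥0) * (2 * r) ^ 2 := by
    have : (0 : ℝ) ≤ ((n : ℝ≥0) / 2 : ℝ≥0) * r ^ 2 := by positivity
    linarith
  have hρ0 : 0 < ρ := hθ.trans hρ.1
  obtain ⟨u, hu⟩ : ∃ u, u = √ρ / 2 := ⟨_, rfl⟩
  obtain ⟨v, hv⟩ : ∃ v, v = √(1 / ρ) / 2 := ⟨_, rfl⟩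
  have hR : Rrect ρ 1 = rect (-u) u (-v) v := by
    rw [Rrect, Rco, hu, hv, mul_one, neg_div, neg_div]
  have hρ' : 1 / ρ ∈ Ioo θ (1 / θ) :=
    ⟨(lt_one_div hθ hρ0).2 hρ.2, one_div_lt_one_div_of_lt hθ hρ.1⟩
  obtain ⟨u1, u2⟩ := sides_bounds hθ hθ1 hρ
  obtain ⟨v1, v2⟩ := sides_bounds hθ hθ1 hρ'
  have huv : 2 * u * (2 * v) = 1 := by
    rw [hu, hv, mul_div_cancel₀ _ two_ne_zero, mul_div_cancel₀ _ two_ne_zero,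
      ← Real.sqrt_mul hρ0.le, mul_one_div_cancel hρ0.ne', Real.sqrt_one]
  rw [hR] at hsub ⊢
  obtain ⟨⟨s1, -⟩, s2, -⟩ := mem_rect.1 (hsub (mem_rect.2 ⟨⟨le_rfl, hab⟩, le_rfl, hcd⟩ :
    (a, c) ∈ rect a b c d))
  obtain ⟨⟨-, s3⟩, -, s4⟩ := mem_rect.1 (hsub (mem_rect.2 ⟨⟨hab, le_rfl⟩, hcd, le_rfl⟩ :
    (b, d) ∈ rect a b c d))
  simp only at s1 s2 s3 s4
  have side : ∀ {x y : ℝ}, 0 ≤ x → y ≤ 1 / θ → θ ≤ x * y → 16 * r ≤ x := by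
    intro x y hx hy h
    have h1 : θ ≤ x / θ := (h.trans (mul_le_mul_of_nonneg_left hy hx)).trans_eq (mul_one_div x θ)
    rw [le_div_iff₀ hθ] at h1
    rw [hrθ]
    linarith
  have hx := side (sub_nonneg.2 hab) (by linarith : d - c ≤ 1 / θ) harea
  have hy := side (sub_nonneg.2 hcd) (by linarith : b - a ≤ 1 / θ) (by linarith)
  have small : ∀ {x : ℝ}, x ≤ 1 / θ → (x + r) * (3 * r) ≤ 1 / 2 := by
    intro x hx
    have h1 : x * r ≤ 1 / 16 := by
      refine (mul_le_mul hx hrle hr.le (by positivity)).trans_eq ?_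
      field_simp
    nlinarith
  have hstrip : ∀ {u : ℝ}, 2 * u ≤ 1 / θ → 16 * r ≤ 2 * u → ∀ (A E y : ℝ), A ≤ y - 3 / 2 * r →
      y + 3 / 2 * r ≤ E → κ ≤ pr (Lam ((n : ℝ≥0) / 2) (rectDom (-u) u A E))
        (Ev (r / 2) true (rect (-u) u (y - r) (y + r)) (rect (-u) (-u) (y - r) (y + r))
          (rect u u (y - r) (y + r))) := fun h1 h2 A E y h3 h4 => by
    rw [hκe]
    exact pr_strip_ge (hbox _ r hr hCn') hq.le (hrsw _ r hr hCn)
        (hrsw _ (2 * r) (by positivity) hCn2)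
      hc₁ hr hCn (h1.trans hk.le) (by linarith) h3 h4
  have key := annealed_bounds (by linarith) (by linarith) huv hr s1 s3 s2 s4 (by linarith)
    (by linarith) (small (by linarith)) (small (by linarith)) hκ hn1 hnκ
    (hstrip (by linarith) (by linarith) (-v) v) (hstrip (by linarith) (by linarith) (-u) u)
  exact ⟨by linarith [key.1], by linarith [key.2]⟩

end Main

end VoronoiTest
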